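/- Let $1 \leq m \leq 9n/10$ and suppose $A \subseteq S^{n-1}$ and $B \subseteq \mathcal{G}_{n,n-m}$ are measurable with $\sigma(A) \geq C\exp(-cn^{1/3})$ and $\sigma_\mathcal{G}(B) \geq C\exp(-cn^{1/3})$. Then $\sigma_\mathcal{I}((A\times B)\cap\mathcal{I}_{n,m}) \geq 0.8\,\sigma(A)\,\sigma_\mathcal{G}(B)$. -/

import Mathlib

open MeasureTheory Metric

/-- The uniform (rotation-invariant) probability measure on the unit sphere
`S^{n-1} ⊂ ℝⁿ`. -/
noncomputable def uSphere (n : ℕ) : Measure (sphere (0 : EuclideanSpace ℝ (Fin n)) 1) :=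
  ((volume : Measure (EuclideanSpace ℝ (Fin n))).toSphere Set.univ)⁻¹ •
    (volume : Measure (EuclideanSpace ℝ (Fin n))).toSphere

/-- The map between unit spheres induced by a linear isometry. -/
noncomputable def sphereMap {m n : ℕ}
    (e : EuclideanSpace ℝ (Fin m) →ₗᵢ[ℝ] EuclideanSpace ℝ (Fin n))
    (ω : sphere (0 : EuclideanSpace ℝ (Fin m)) 1) :
    sphere (0 : EuclideanSpace ℝ (Fin n)) 1 :=
  ⟨e ω, by
    have hω : ‖(ω : EuclideanSpace ℝ (Fin m))‖ = 1 := mem_sphere_zero_iff_norm.mp ω.2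
    simp [mem_sphere_zero_iff_norm, e.norm_map, hω]⟩

/-- The average of `f : S^{n-1} → ℝ` over the equator parametrized by the linear
isometry `e : ℝ^{n-1} → ℝⁿ` (whose range is the hyperplane orthogonal to a point). -/
noncomputable def equatorAvg {n : ℕ} (f : sphere (0 : EuclideanSpace ℝ (Fin n)) 1 → ℝ)
    (e : EuclideanSpace ℝ (Fin (n - 1)) →ₗᵢ[ℝ] EuclideanSpace ℝ (Fin n)) : ℝ :=
  ∫ ω, f (sphereMap e ω) ∂uSphere (n - 1)

/-- The Grassmannian of `d`-dimensional subspaces of `ℝⁿ`, encoded as the set of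
symmetric idempotent `n × n` matrices of trace `d` (orthogonal projections). -/
def Grass (n d : ℕ) : Type :=
  {P : Matrix (Fin n) (Fin n) ℝ // P.IsSymm ∧ P * P = P ∧ P.trace = d}

instance (n d : ℕ) : MeasurableSpace (Grass n d) :=
  @Subtype.instMeasurableSpace _ _ (inferInstanceAs (MeasurableSpace (Fin n → Fin n → ℝ)))

namespace GaussianBL

lemma abs_exp_sub_quadratic_le {y : ℝ} (hy : |y| ≤ 1) :
    |Real.exp y - (1 + y + y ^ 2 / 2)| ≤ |y| ^ 3 := by
  have h := Real.exp_bound hy (n := 3) (by norm_num)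
  have e : ∑ m ∈ Finset.range 3, y ^ m / (m.factorial : ℝ) = 1 + y + y ^ 2 / 2 := by
    simp [Finset.sum_range_succ, Nat.factorial]
  rw [e] at h
  refine h.trans ?_
  have : 0 ≤ |y| ^ 3 := by positivity
  norm_num [Nat.factorial] at h ⊢
  linarith

lemma le_exp_of_taylor {M p q h H u : ℝ} (hM : 1 ≤ M) (hp : |p| ≤ M) (hq : |q| ≤ M)
    (hH : |h| ≤ H) (hHs : 8 * M * H ≤ 1)
    (hu : u ≤ 1 + p * h + q * h ^ 2 / 2 + M * H ^ 3) :
    u ≤ Real.exp (p * h + (q - p ^ 2) * h ^ 2 / 2 + 58 * M ^ 3 * H ^ 3) := by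
  have hH0 : 0 ≤ H := (abs_nonneg h).trans hH
  set e := (q - p ^ 2) * h ^ 2 / 2 + 58 * M ^ 3 * H ^ 3 with he
  have hph : |p * h| ≤ M * H := by
    rw [abs_mul]; exact mul_le_mul hp hH (abs_nonneg _) (by linarith)
  have hh2 : h ^ 2 ≤ H ^ 2 := by rw [← sq_abs h]; gcongr
  have hp2 : p ^ 2 ≤ M ^ 2 := by rw [← sq_abs p]; gcongr
  have hMM : M ≤ M ^ 2 := by nlinarith
  have hqp : |(q - p ^ 2) * h ^ 2 / 2| ≤ M ^ 2 * H ^ 2 := by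
    have h1 : |q - p ^ 2| ≤ 2 * M ^ 2 := by
      rw [abs_le] at hq ⊢
      constructor <;> nlinarith [sq_nonneg p]
    rw [abs_div, abs_mul, abs_of_nonneg (sq_nonneg h)]
    have : |q - p ^ 2| * h ^ 2 ≤ 2 * M ^ 2 * H ^ 2 :=
      mul_le_mul h1 hh2 (sq_nonneg _) (by positivity)
    norm_num
    linarith
  have hMH : 0 ≤ M * H := by positivity
  have hMH8 : M * H ≤ 1 / 8 := by linarith
  obtain ⟨x, hx⟩ : ∃ x, x = M * H := ⟨_, rfl⟩
  rw [← hx] at hph hMH hMH8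
  have hk : 58 * M ^ 3 * H ^ 3 = 58 * x ^ 3 := by rw [hx]; ring
  have hk2 : M ^ 2 * H ^ 2 = x ^ 2 := by rw [hx]; ring
  have hMx : M * H ^ 3 ≤ x ^ 3 := by
    rw [hx, mul_pow]; gcongr; nlinarith
  rw [hk2] at hqp
  rw [hk] at he ⊢
  have he' : |e| ≤ x ^ 2 + 58 * x ^ 3 := by
    rw [he]
    refine (abs_add_le _ _).trans (add_le_add hqp ?_)
    rw [abs_of_nonneg (by positivity)]
  have hx2 : x ^ 2 ≤ x / 8 := by nlinarith
  have hx3 : x ^ 3 ≤ x ^ 2 / 8 := by nlinarith [sq_nonneg x]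
  have hx4 : x ^ 4 ≤ x ^ 3 / 8 := by nlinarith [pow_nonneg hMH 3]
  have h0 : 0 ≤ x ^ 3 := by positivity
  have hexp : p * h + (q - p ^ 2) * h ^ 2 / 2 + 58 * x ^ 3 = p * h + e := by
    rw [he]; ring
  rw [hexp]
  have he3 : e = q * h ^ 2 / 2 - p ^ 2 * h ^ 2 / 2 + 58 * x ^ 3 := by rw [he]; ring
  clear_value e
  have hy : |p * h + e| ≤ 3 * x := by
    refine (abs_add_le _ _).trans ?_
    linarith
  have hE := abs_exp_sub_quadratic_le (hy.trans (by linarith))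
  have hcube : |p * h + e| ^ 3 ≤ 27 * x ^ 3 := by
    calc |p * h + e| ^ 3 ≤ (3 * x) ^ 3 := by gcongr
      _ = _ := by ring
  have hE2 := (abs_le.mp hE).1
  have hcross : -(x * (x ^ 2 + 58 * x ^ 3)) ≤ p * h * e := by
    have : |p * h * e| ≤ x * (x ^ 2 + 58 * x ^ 3) := by
      rw [abs_mul]; exact mul_le_mul hph he' (abs_nonneg _) hMH
    exact (abs_le.mp this).1
  have hcr : x * (x ^ 2 + 58 * x ^ 3) = x ^ 3 + 58 * x ^ 4 := by ring
  have hsq : (p * h + e) ^ 2 = p ^ 2 * h ^ 2 + 2 * (p * h * e) + e ^ 2 := by ring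
  have := sq_nonneg e
  linarith

set_option maxHeartbeats 400000 in
/-- Pointwise third order upper bound for a product of powers of perturbations of `1`. -/
lemma exists_prod_rpow_le {ι : Type*} [Fintype ι] (M : ℝ) (hM : 1 ≤ M) :
    ∃ K : ℝ, 0 ≤ K ∧ ∀ c : ℝ, 0 < c → c ≤ 1 → ∀ (p q h u : ι → ℝ) (H : ℝ), 0 ≤ H →
      (∀ i, |p i| ≤ M) → (∀ i, |q i| ≤ M) → (∀ i, |h i| ≤ H) → (∀ i, 0 < u i) →
      (∀ i, u i ≤ M) → (∀ i, u i ≤ 1 + p i * h i + q i * h i ^ 2 / 2 + M * H ^ 3) →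
      ∏ i, u i ^ c ≤ 1 + c * ∑ i, p i * h i + c * ∑ i, (q i - p i ^ 2) * h i ^ 2 / 2
        + (c * ∑ i, p i * h i) ^ 2 / 2 + K * H ^ 3 := by
  set k : ℝ := (Fintype.card ι : ℝ) with hk
  have hk0 : 0 ≤ k := by positivity
  set D : ℝ := 58 * (k + 1) * M ^ 3 with hD
  have hM2 : M ≤ M ^ 2 := by nlinarith
  have hM3 : M ^ 2 ≤ M ^ 3 := by nlinarith [sq_nonneg M]
  have hD1 : 58 * M ≤ D := by rw [hD]; nlinarith [mul_nonneg hk0 (by positivity : 0 ≤ M ^ 3)]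
  have hD58 : 58 ≤ D := by linarith
  have hDk : k * (58 * M ^ 3) ≤ D := by rw [hD]; nlinarith [(by positivity : 0 ≤ M ^ 3)]
  have hDk1 : k * M ≤ D := le_trans (by gcongr; nlinarith) hDk
  have hDk2 : k * M ^ 2 ≤ D := le_trans (by gcongr; nlinarith) hDk
  clear_value D
  refine ⟨64 * D ^ 3 + M ^ Fintype.card ι * (64 * D ^ 3), by positivity, ?_⟩
  intro c hc hc1 p q h u H hH0 hp hq hh hu0 huM hu
  set L := c * ∑ i, p i * h i with hL
  set Q := c * ∑ i, (q i - p i ^ 2) * h i ^ 2 / 2 with hQ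
  have hLb : |L| ≤ D * H := by
    rw [hL, abs_mul, abs_of_pos hc]
    have : |∑ i, p i * h i| ≤ ∑ i : ι, M * H := by
      refine (Finset.abs_sum_le_sum_abs _ _).trans (Finset.sum_le_sum fun i _ => ?_)
      rw [abs_mul]; exact mul_le_mul (hp i) (hh i) (abs_nonneg _) (by linarith)
    rw [Finset.sum_const, Finset.card_univ, nsmul_eq_mul, ← hk] at this
    calc c * |∑ i, p i * h i| ≤ 1 * (k * (M * H)) := by gcongr
      _ = k * M * H := by ring
      _ ≤ D * H := by gcongr
  have hQb : |Q| ≤ D * H ^ 2 := by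
    rw [hQ, abs_mul, abs_of_pos hc]
    have : |∑ i, (q i - p i ^ 2) * h i ^ 2 / 2| ≤ ∑ i : ι, M ^ 2 * H ^ 2 := by
      refine (Finset.abs_sum_le_sum_abs _ _).trans (Finset.sum_le_sum fun i _ => ?_)
      have h1 : |q i - p i ^ 2| ≤ 2 * M ^ 2 := by
        have hp2 : p i ^ 2 ≤ M ^ 2 := by rw [← sq_abs (p i)]; gcongr; exact hp i
        have := hq i
        rw [abs_le] at this ⊢
        constructor <;> nlinarith [sq_nonneg (p i)]
      have hh2 : h i ^ 2 ≤ H ^ 2 := by rw [← sq_abs (h i)]; gcongr; exact hh i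
      rw [abs_div, abs_mul, abs_of_nonneg (sq_nonneg (h i))]
      have : |q i - p i ^ 2| * h i ^ 2 ≤ 2 * M ^ 2 * H ^ 2 :=
        mul_le_mul h1 hh2 (sq_nonneg _) (by positivity)
      norm_num
      linarith
    rw [Finset.sum_const, Finset.card_univ, nsmul_eq_mul, ← hk] at this
    calc c * |∑ i, (q i - p i ^ 2) * h i ^ 2 / 2| ≤ 1 * (k * (M ^ 2 * H ^ 2)) := by gcongr
      _ = k * M ^ 2 * H ^ 2 := by ring
      _ ≤ D * H ^ 2 := by gcongr
  clear_value L Q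
  by_cases hsmall : 4 * D * H ≤ 1
  · have h8 : 8 * M * H ≤ 1 := by nlinarith
    have hprod : ∏ i, u i ^ c ≤ Real.exp (L + Q + c * (k * (58 * M ^ 3)) * H ^ 3) := by
      have h1 : ∀ i ∈ Finset.univ, u i ^ c ≤ Real.exp
          (c * (p i * h i + (q i - p i ^ 2) * h i ^ 2 / 2 + 58 * M ^ 3 * H ^ 3)) := by
        intro i _
        have := le_exp_of_taylor hM (hp i) (hq i) (hh i) h8 (hu i)
        calc u i ^ c ≤ (Real.exp _) ^ c := Real.rpow_le_rpow (hu0 i).le this hc.le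
          _ = _ := by rw [← Real.exp_mul, mul_comm]
      refine (Finset.prod_le_prod (fun i _ => (Real.rpow_pos_of_pos (hu0 i) c).le) h1).trans ?_
      rw [← Real.exp_sum, ← Finset.mul_sum, Finset.sum_add_distrib, Finset.sum_add_distrib,
        Finset.sum_const, Finset.card_univ, nsmul_eq_mul, ← hk]
      apply le_of_eq; congr 1; rw [hL, hQ]; ring
    set T := c * (k * (58 * M ^ 3)) * H ^ 3 with hT
    have hT0 : 0 ≤ T := by rw [hT]; have := hc.le; positivity
    have hTb : T ≤ D * H ^ 3 := by
      rw [hT]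
      calc c * (k * (58 * M ^ 3)) * H ^ 3 ≤ 1 * D * H ^ 3 := by gcongr
        _ = _ := by ring
    clear_value T
    have hH1 : H ≤ 1 := by nlinarith
    have hH2 : H ^ 2 ≤ H := by nlinarith
    have hH3 : H ^ 3 ≤ H ^ 2 := by nlinarith [sq_nonneg H]
    have hQT : |Q + T| ≤ 2 * (D * H ^ 2) := by
      refine (abs_add_le _ _).trans ?_
      rw [abs_of_nonneg hT0]; nlinarith
    have hS : |L + (Q + T)| ≤ 3 * (D * H) := by
      refine (abs_add_le _ _).trans ?_
      nlinarith
    have hS1 : |L + (Q + T)| ≤ 1 := by linarith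
    have hE := (abs_le.mp (abs_exp_sub_quadratic_le hS1)).2
    have hcube : |L + (Q + T)| ^ 3 ≤ 27 * (D ^ 3 * H ^ 3) := by
      calc |L + (Q + T)| ^ 3 ≤ (3 * (D * H)) ^ 3 := by gcongr
        _ = _ := by ring
    have hLQ : L * (Q + T) ≤ 2 * (D ^ 2 * H ^ 3) := by
      calc L * (Q + T) ≤ |L * (Q + T)| := le_abs_self _
        _ = |L| * |Q + T| := abs_mul _ _
        _ ≤ (D * H) * (2 * (D * H ^ 2)) := mul_le_mul hLb hQT (abs_nonneg _) (by positivity)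
        _ = _ := by ring
    have hQT2 : (Q + T) ^ 2 ≤ 4 * (D ^ 2 * H ^ 3) := by
      calc (Q + T) ^ 2 = |Q + T| ^ 2 := (sq_abs _).symm
        _ ≤ (2 * (D * H ^ 2)) ^ 2 := by gcongr
        _ = 4 * (D ^ 2 * (H ^ 3 * H)) := by ring
        _ ≤ 4 * (D ^ 2 * (H ^ 3 * 1)) := by gcongr
        _ = _ := by ring
    have hDD : D ^ 2 ≤ D ^ 3 := pow_le_pow_right₀ (by linarith) (by norm_num)
    have hDD1 : D ≤ D ^ 3 := le_self_pow₀ (by linarith) (by norm_num)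
    have hH30 : 0 ≤ H ^ 3 := by positivity
    have e1 : D ^ 2 * H ^ 3 ≤ D ^ 3 * H ^ 3 := mul_le_mul_of_nonneg_right hDD hH30
    have e2 : D * H ^ 3 ≤ D ^ 3 * H ^ 3 := mul_le_mul_of_nonneg_right hDD1 hH30
    have e3 : 0 ≤ M ^ Fintype.card ι * (64 * D ^ 3) * H ^ 3 := by positivity
    have e4 : 0 ≤ D ^ 3 * H ^ 3 := by positivity
    rw [add_assoc] at hprod
    refine hprod.trans ?_
    have e5 : (L + (Q + T)) ^ 2 = L ^ 2 + 2 * (L * (Q + T)) + (Q + T) ^ 2 := by ring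
    rw [e5] at hE
    rw [add_mul]
    linarith
  · push Not at hsmall
    have hprod : ∏ i, u i ^ c ≤ M ^ Fintype.card ι := by
      have h1 : ∀ i ∈ Finset.univ, u i ^ c ≤ M := by
        intro i _
        calc u i ^ c ≤ M ^ c := Real.rpow_le_rpow (hu0 i).le (huM i) hc.le
          _ ≤ M ^ (1 : ℝ) := Real.rpow_le_rpow_of_exponent_le hM hc1
          _ = M := Real.rpow_one M
      refine (Finset.prod_le_prod (fun i _ => (Real.rpow_pos_of_pos (hu0 i) c).le) h1).trans ?_
      simp
    set x := 4 * D * H with hx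
    have hx2 : x ^ 2 ≤ x ^ 3 := by nlinarith [sq_nonneg x]
    have hx1 : x ≤ x ^ 3 := by nlinarith
    have hx0 : 1 ≤ x ^ 3 := by linarith
    have e : 64 * D ^ 3 * H ^ 3 = x ^ 3 := by rw [hx]; ring
    have hL' := (abs_le.mp hLb).1
    have hQ' := (abs_le.mp hQb).1
    have e1 : D * H = x / 4 := by rw [hx]; ring
    have e2 : D * H ^ 2 ≤ x ^ 2 / 16 := by
      have : x ^ 2 / 16 = D * (D * H ^ 2) := by rw [hx]; ring
      rw [this]; nlinarith [(by positivity : 0 ≤ D * H ^ 2)]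
    have e3 : M ^ Fintype.card ι ≤ M ^ Fintype.card ι * x ^ 3 :=
      le_mul_of_one_le_right (by positivity) hx0
    have : (64 * D ^ 3 + M ^ Fintype.card ι * (64 * D ^ 3)) * H ^ 3
        = x ^ 3 + M ^ Fintype.card ι * x ^ 3 := by rw [← e]; ring
    rw [this]
    rw [e1] at hL'
    have := sq_nonneg L
    linarith

end GaussianBL

namespace GaussianBL
open ProbabilityTheory

section Law
variable {E : Type*} [NormedAddCommGroup E] [InnerProductSpace ℝ E]
  [MeasurableSpace E] [BorelSpace E] [SecondCountableTopology E] [CompleteSpace E]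

lemma map_add_eq_of_charFun {μ : Measure E} [IsProbabilityMeasure μ]
    (hμ : ∀ t, charFun μ t = Complex.exp (-(‖t‖ : ℂ) ^ 2 / 2)) (a b s : ℝ)
    (hs : s ^ 2 = a ^ 2 + b ^ 2) :
    (μ.prod μ).map (fun x => a • x.1 + b • x.2) = μ.map (fun x => s • x) := by
  have h1 : Measurable (fun x : E × E => a • x.1 + b • x.2) := by fun_prop
  have h2 : Measurable (fun x : E => s • x) := by fun_prop
  have := Measure.isProbabilityMeasure_map (μ := μ.prod μ) h1.aemeasurable
  have := Measure.isProbabilityMeasure_map (μ := μ) h2.aemeasurable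
  apply Measure.ext_of_charFun
  ext t
  have key : ∀ r : ℝ, ∫ x, Complex.exp ((inner ℝ (r • x) t : ℝ) * Complex.I) ∂μ
      = Complex.exp (-(r ^ 2 * ‖t‖ ^ 2 : ℝ) / 2) := by
    intro r
    have := hμ (r • t)
    rw [charFun_apply] at this
    simp only [inner_smul_left, inner_smul_right] at this ⊢
    rw [show (starRingEnd ℝ) r = r from rfl, this, norm_smul]
    congr 1
    push_cast
    rw [mul_pow, ← Complex.ofReal_pow ‖r‖, Real.norm_eq_abs, sq_abs]
    push_cast; ring
  rw [charFun_apply, charFun_apply, integral_map h1.aemeasurable (by fun_prop),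
    integral_map h2.aemeasurable (by fun_prop), key]
  have : ∀ x : E × E, Complex.exp ((inner ℝ (a • x.1 + b • x.2) t : ℝ) * Complex.I)
      = Complex.exp ((inner ℝ (a • x.1) t : ℝ) * Complex.I) *
        Complex.exp ((inner ℝ (b • x.2) t : ℝ) * Complex.I) := by
    intro x
    rw [← Complex.exp_add, inner_add_left]; congr 1; push_cast; ring
  simp_rw [this]
  rw [integral_prod_mul (fun x => Complex.exp ((inner ℝ (a • x) t : ℝ) * Complex.I))
    (fun x => Complex.exp ((inner ℝ (b • x) t : ℝ) * Complex.I)), key, key, ← Complex.exp_add]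
  congr 1
  rw [hs]; push_cast; ring

lemma integral_integral_add_eq {μ : Measure E} [IsProbabilityMeasure μ]
    (hμ : ∀ t, charFun μ t = Complex.exp (-(‖t‖ : ℂ) ^ 2 / 2)) (a b s : ℝ)
    (hs : s ^ 2 = a ^ 2 + b ^ 2) {g : E → ℝ} (hg : Measurable g) {B : ℝ}
    (hB : ∀ x, |g x| ≤ B) :
    ∫ x, ∫ y, g (a • x + b • y) ∂μ ∂μ = ∫ x, g (s • x) ∂μ := by
  have h1 : Measurable (fun x : E × E => a • x.1 + b • x.2) := by fun_prop
  have h2 : Measurable (fun x : E => s • x) := by fun_prop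
  have e1 : ∫ x, g (s • x) ∂μ = ∫ x : E × E, g (a • x.1 + b • x.2) ∂(μ.prod μ) := by
    rw [← integral_map h2.aemeasurable hg.aestronglyMeasurable,
      ← map_add_eq_of_charFun hμ a b s hs, integral_map h1.aemeasurable hg.aestronglyMeasurable]
  rw [e1, integral_prod]
  exact Integrable.of_bound (hg.comp h1).aestronglyMeasurable B (.of_forall fun x => hB _)

end Law

lemma charFun_gaussianReal_std (t : ℝ) :
    charFun (gaussianReal 0 1) t = Complex.exp (-(‖t‖ : ℂ) ^ 2 / 2) := by
  rw [charFun_gaussianReal]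
  congr 1
  rw [← Complex.ofReal_pow ‖t‖, Real.norm_eq_abs, sq_abs]
  push_cast; ring_nf

section Moments
variable {E : Type*} [NormedAddCommGroup E] [InnerProductSpace ℝ E] [FiniteDimensional ℝ E]
  [MeasurableSpace E] [BorelSpace E]

lemma memLp_inner_stdGaussian (a : E) : MemLp (fun w => inner ℝ a w) 2 (stdGaussian E) :=
  (IsGaussian.memLp_id (stdGaussian E) 2 (by norm_num)).const_inner a

lemma integral_inner_stdGaussian (a : E) : ∫ w, inner ℝ a w ∂stdGaussian E = 0 :=
  integral_strongDual_stdGaussian (innerSL ℝ a)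

lemma integral_inner_sq_stdGaussian (a : E) :
    ∫ w, inner ℝ a w ^ 2 ∂stdGaussian E = ‖a‖ ^ 2 := by
  have h := variance_dual_stdGaussian (innerSL ℝ a)
  rw [variance_of_integral_eq_zero (by fun_prop)
    (integral_strongDual_stdGaussian (innerSL ℝ a)), innerSL_apply_norm] at h
  simpa using h

lemma integrable_norm_cube_stdGaussian :
    Integrable (fun w => ‖w‖ ^ 3) (stdGaussian E) := by
  have := (IsGaussian.memLp_id (stdGaussian E) 3 (by norm_num)).integrable_norm_pow
    (p := 3) (by norm_num)
  simpa using this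

end Moments

/-- Positive functions with uniform relative control of their second order Taylor expansion.
This class is stable under averaging over translates. -/
structure Nice (M : ℝ) (f : ℝ → ℝ) : Prop where
  meas : Measurable f
  pos : ∀ x, 0 < f x
  ratio : ∀ x h, f (x + h) ≤ M * f x
  taylor : ∃ f₁ f₂ : ℝ → ℝ, Measurable f₁ ∧ Measurable f₂ ∧ (∀ x, |f₁ x| ≤ M * f x) ∧
    (∀ x, |f₂ x| ≤ M * f x) ∧
    ∀ x h, |f (x + h) - f x - h * f₁ x - h ^ 2 / 2 * f₂ x| ≤ M * |h| ^ 3 * f x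

/-- Gaussian average of the translates of `f`. -/
noncomputable def heat (r : ℝ) (f : ℝ → ℝ) (x : ℝ) : ℝ := ∫ z, f (x + r * z) ∂gaussianReal 0 1

namespace Nice
variable {M : ℝ} {f : ℝ → ℝ}

lemma one_le (hf : Nice M f) : 1 ≤ M := by
  have h1 := hf.ratio 0 0
  have h2 := hf.pos 0
  simp only [add_zero] at h1
  by_contra! h
  nlinarith

lemma abs_le (hf : Nice M f) (x : ℝ) : |f x| ≤ M * f 0 := by
  rw [abs_of_pos (hf.pos x)]; simpa using hf.ratio 0 x

lemma integrable_comp (hf : Nice M f) {Ω : Type*} [MeasurableSpace Ω] {μ : Measure Ω}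
    [IsFiniteMeasure μ] {g : Ω → ℝ} (hg : Measurable g) : Integrable (fun x => f (g x)) μ :=
  Integrable.of_bound (hf.meas.comp hg).aestronglyMeasurable _ (.of_forall fun _ => hf.abs_le _)

lemma heat (hf : Nice M f) (r : ℝ) : Nice M (heat r f) := by
  have hM := hf.one_le
  have hint : ∀ x, Integrable (fun z => f (x + r * z)) (gaussianReal 0 1) :=
    fun x => hf.integrable_comp (by fun_prop)
  have hmeas : ∀ {k : ℝ → ℝ}, Measurable k → Measurable
      (fun x => ∫ z, k (x + r * z) ∂gaussianReal 0 1) := by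
    intro k hk
    refine StronglyMeasurable.measurable ?_
    refine StronglyMeasurable.integral_prod_right (f := fun x z => k (x + r * z)) ?_
    exact (hk.comp (by fun_prop : Measurable fun p : ℝ × ℝ => p.1 + r * p.2)).stronglyMeasurable
  obtain ⟨f₁, f₂, m1, m2, b1, b2, ht⟩ := hf.taylor
  have hint' : ∀ {k : ℝ → ℝ}, Measurable k → (∀ x, |k x| ≤ M * f x) → ∀ x,
      Integrable (fun z => k (x + r * z)) (gaussianReal 0 1) := by
    intro k hk hb x
    exact ((hint x).const_mul M).mono' (hk.comp (by fun_prop)).aestronglyMeasurable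
      (.of_forall fun z => hb _)
  have hbd : ∀ {k : ℝ → ℝ}, Measurable k → (∀ x, |k x| ≤ M * f x) → ∀ x,
      |∫ z, k (x + r * z) ∂gaussianReal 0 1| ≤ M * GaussianBL.heat r f x := by
    intro k hk hb x
    refine abs_integral_le_integral_abs.trans ?_
    rw [GaussianBL.heat, ← integral_const_mul]
    exact integral_mono (hint' hk hb x).abs ((hint x).const_mul M) fun z => hb _
  refine ⟨hmeas hf.meas, fun x => ?_, fun x h => ?_, fun x => ∫ z, f₁ (x + r * z) ∂gaussianReal 0 1,
    fun x => ∫ z, f₂ (x + r * z) ∂gaussianReal 0 1, hmeas m1, hmeas m2, hbd m1 b1, hbd m2 b2, ?_⟩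
  · have : f x / M ≤ GaussianBL.heat r f x := by
      calc f x / M = ∫ z, f x / M ∂gaussianReal 0 1 := by simp
        _ ≤ _ := integral_mono (integrable_const _) (hint x) fun z => by
          have := hf.ratio (x + r * z) (-(r * z))
          rw [add_neg_cancel_right] at this
          exact (div_le_iff₀' (by linarith)).2 this
    exact lt_of_lt_of_le (div_pos (hf.pos x) (by linarith)) this
  · rw [GaussianBL.heat, GaussianBL.heat, ← integral_const_mul]
    refine integral_mono (hint _) ((hint x).const_mul M) fun z => ?_
    have := hf.ratio (x + r * z) h
    rwa [show x + r * z + h = x + h + r * z by ring] at this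
  · intro x h
    simp only [GaussianBL.heat]
    have i1 := (hint' m1 b1 x).const_mul h
    have i2 := (hint' m2 b2 x).const_mul (h ^ 2 / 2)
    have i0 := hint x
    have i3 := hint (x + h)
    have j1 : Integrable (fun z => f (x + h + r * z) - f (x + r * z)) (gaussianReal 0 1) :=
      i3.sub i0
    have j2 : Integrable (fun z => f (x + h + r * z) - f (x + r * z) - h * f₁ (x + r * z))
      (gaussianReal 0 1) := j1.sub i1
    rw [← integral_const_mul, ← integral_const_mul, ← integral_sub i3 i0,
      ← integral_sub j1 i1, ← integral_sub j2 i2, ← integral_const_mul]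
    refine abs_integral_le_integral_abs.trans ?_
    refine integral_mono (j2.sub i2).abs ((hint x).const_mul _) fun z => ?_
    have := ht (x + r * z) h
    rwa [show x + r * z + h = x + h + r * z by ring] at this

end Nice

lemma heat_heat {M : ℝ} {f : ℝ → ℝ} (hf : Nice M f) (a b s : ℝ) (hs : s ^ 2 = a ^ 2 + b ^ 2)
    (x : ℝ) : heat a (heat b f) x = heat s f x := by
  have := integral_integral_add_eq charFun_gaussianReal_std a b s hs
    (g := fun y => f (x + y)) (hf.meas.comp (by fun_prop)) (fun y => hf.abs_le _)
  simp only [smul_eq_mul, ← add_assoc] at this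
  exact this

end GaussianBL

namespace GaussianBL
open ProbabilityTheory

lemma exp_sub_two_mul_sq_le {x : ℝ} (hx : |x| ≤ 1 / 2) : Real.exp (x - 2 * x ^ 2) ≤ 1 + x := by
  have h := abs_le.mp hx
  have h1 : 0 < 1 + x := by linarith [h.1]
  rw [← Real.le_log_iff_exp_le h1]
  refine le_trans ?_ (Real.one_sub_inv_le_log_of_pos h1)
  have : 1 - (1 + x)⁻¹ = x / (1 + x) := by field_simp; ring
  rw [this, le_div_iff₀ h1]
  nlinarith [mul_nonneg (sq_nonneg x) (by linarith [h.1] : 0 ≤ 1 + 2 * x)]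

/-- Lower bound for the Gaussian average of a nice function at small scale. -/
lemma exists_exp_le_heat (M : ℝ) (hM : 1 ≤ M) : ∃ K r₀ : ℝ, 0 ≤ K ∧ 0 < r₀ ∧ r₀ ≤ 1 ∧
    ∀ (u : ℝ → ℝ) (p q : ℝ), Measurable u → (∀ x, 0 < u x) → (∀ x, u x ≤ M) → |q| ≤ M →
      (∀ h, |u h - 1 - h * p - h ^ 2 / 2 * q| ≤ M * |h| ^ 3) →
      ∀ r, 0 < r → r ≤ r₀ →
        Real.exp (q * r ^ 2 / 2 - K * r ^ 3) ≤ ∫ z, u (r * z) ∂gaussianReal 0 1 := by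
  set m := ∫ z, |z| ^ 3 ∂gaussianReal 0 1 with hm
  have hm0 : 0 ≤ m := integral_nonneg fun z => by positivity
  set W := M * (1 + m) with hW
  have hW1 : 1 ≤ W := by rw [hW]; nlinarith
  refine ⟨M * m + 2 * W ^ 2, 1 / (2 * W), by positivity, by positivity, ?_, ?_⟩
  · rw [div_le_one (by positivity)]; linarith
  intro u p q hu hu0 huM hq ht r hr hr0
  have hrW : W * r ≤ 1 / 2 := by
    rw [le_div_iff₀ (by positivity)] at hr0; linarith
  have hr1 : r ≤ 1 := by nlinarith
  have i1 : Integrable (fun z : ℝ => z) (gaussianReal 0 1) :=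
    (memLp_id_gaussianReal (μ := 0) (v := 1) 1).integrable (by norm_num)
  have i2 : Integrable (fun z : ℝ => z ^ 2) (gaussianReal 0 1) :=
    (memLp_id_gaussianReal (μ := 0) (v := 1) 2).integrable_sq
  have i3 : Integrable (fun z : ℝ => |z| ^ 3) (gaussianReal 0 1) := by
    simpa using (memLp_id_gaussianReal (μ := 0) (v := 1) 3).integrable_norm_pow (p := 3)
      (by norm_num)
  have e1 : ∫ z, z ∂gaussianReal 0 1 = 0 := by simp
  have e2 : ∫ z, z ^ 2 ∂gaussianReal 0 1 = 1 := by
    have := variance_id_gaussianReal (μ := 0) (v := 1)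
    rw [variance_of_integral_eq_zero (by fun_prop) (by simp)] at this
    simpa using this
  have hlow : 1 + (q * r ^ 2 / 2 - M * m * r ^ 3) ≤ ∫ z, u (r * z) ∂gaussianReal 0 1 := by
    have j : Integrable (fun z => 1 + (r * p) * z + (r ^ 2 / 2 * q) * z ^ 2
        - (M * r ^ 3) * |z| ^ 3) (gaussianReal 0 1) :=
      (((integrable_const 1).add (i1.const_mul _)).add (i2.const_mul _)).sub (i3.const_mul _)
    have j' : Integrable (fun z => u (r * z)) (gaussianReal 0 1) :=
      Integrable.of_bound (hu.comp (by fun_prop)).aestronglyMeasurable M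
        (.of_forall fun z => by rw [Real.norm_eq_abs, abs_of_pos (hu0 _)]; exact huM _)
    have e : ∫ z, (1 + (r * p) * z + (r ^ 2 / 2 * q) * z ^ 2
        - (M * r ^ 3) * |z| ^ 3) ∂gaussianReal 0 1 = 1 + (q * r ^ 2 / 2 - M * m * r ^ 3) := by
      have k1 : Integrable (fun z : ℝ => 1 + (r * p) * z) (gaussianReal 0 1) :=
        (integrable_const 1).add (i1.const_mul _)
      have k2 : Integrable (fun z : ℝ => 1 + (r * p) * z + (r ^ 2 / 2 * q) * z ^ 2)
        (gaussianReal 0 1) := k1.add (i2.const_mul _)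
      rw [integral_sub k2 (i3.const_mul _), integral_add k1 (i2.const_mul _),
        integral_add (integrable_const 1) (i1.const_mul _), integral_const_mul,
        integral_const_mul, integral_const_mul, e1, e2, ← hm]
      simp; ring
    rw [← e]
    refine integral_mono j j' fun z => ?_
    have := (abs_le.mp (ht (r * z))).1
    rw [abs_mul, mul_pow, abs_of_pos hr] at this
    simp only
    nlinarith
  refine le_trans ?_ hlow
  have hx : |q * r ^ 2 / 2 - M * m * r ^ 3| ≤ W * r ^ 2 := by
    refine (abs_sub _ _).trans ?_
    rw [abs_div, abs_mul, abs_of_nonneg (sq_nonneg r), abs_of_nonneg (by positivity : 0 ≤ M * m * r ^ 3)]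
    have h1 : |q| * r ^ 2 ≤ M * r ^ 2 := by gcongr
    have h2 : M * m * r ^ 3 ≤ M * m * r ^ 2 := by
      have : r ^ 3 ≤ r ^ 2 := pow_le_pow_of_le_one hr.le hr1 (by norm_num)
      gcongr
    have h3 : 0 ≤ M * r ^ 2 := by positivity
    norm_num
    rw [hW]
    linarith
  refine le_trans ?_ (exp_sub_two_mul_sq_le (hx.trans (by nlinarith)))
  apply Real.exp_le_exp.2
  have hx2 : (q * r ^ 2 / 2 - M * m * r ^ 3) ^ 2 ≤ W ^ 2 * r ^ 3 := by
    calc (q * r ^ 2 / 2 - M * m * r ^ 3) ^ 2 = |q * r ^ 2 / 2 - M * m * r ^ 3| ^ 2 :=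
          (sq_abs _).symm
      _ ≤ (W * r ^ 2) ^ 2 := by gcongr
      _ = W ^ 2 * (r ^ 3 * r) := by ring
      _ ≤ W ^ 2 * (r ^ 3 * 1) := by gcongr
      _ = _ := by ring
  linarith

section
variable {E : Type*} [NormedAddCommGroup E] [InnerProductSpace ℝ E] [FiniteDimensional ℝ E]
  [MeasurableSpace E] [BorelSpace E] {ι : Type*} [Fintype ι]

/-- Infinitesimal Gaussian Brascamp-Lieb inequality with a cubic error. -/
lemma exists_infinitesimal_brascampLieb (v : ι → E) (hv : ∀ i, ‖v i‖ = 1) (c : ℝ) (hc : 0 < c) (hc1 : c ≤ 1)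
    (hG : ∀ t : ι → ℝ, c * ‖∑ i, t i • v i‖ ^ 2 ≤ ∑ i, t i ^ 2) (M : ℝ) (hM : 1 ≤ M) :
    ∃ K r₀ : ℝ, 0 ≤ K ∧ 0 < r₀ ∧ ∀ f : ι → ℝ → ℝ, (∀ i, Nice M (f i)) → ∀ a : ι → ℝ,
      ∀ r, 0 < r → r ≤ r₀ →
      ∫ w, ∏ i, f i (a i + r * inner ℝ (v i) w) ^ c ∂stdGaussian E
        ≤ Real.exp (K * r ^ 3) * ∏ i, heat r (f i) (a i) ^ c := by
  obtain ⟨K₁, r₀, hK1, hr0, hr01, hlow⟩ := exists_exp_le_heat M hM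
  obtain ⟨K₂, hK2, hup⟩ := exists_prod_rpow_le (ι := ι) M hM
  set m := ∫ w, ‖w‖ ^ 3 ∂stdGaussian E with hm
  have hm0 : 0 ≤ m := integral_nonneg fun z => by positivity
  refine ⟨K₂ * m + Fintype.card ι * K₁, r₀, by positivity, hr0, ?_⟩
  intro f hf a r hr hrr
  choose f₁ f₂ _ _ b1 b2 ht using fun i => (hf i).taylor
  set A := fun i => f i (a i) with hA
  have hA0 : ∀ i, 0 < A i := fun i => (hf i).pos _
  set p := fun i => f₁ i (a i) / A i with hp
  set q := fun i => f₂ i (a i) / A i with hq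
  have hpM : ∀ i, |p i| ≤ M := fun i => by
    rw [hp, abs_div, abs_of_pos (hA0 i), div_le_iff₀ (hA0 i)]; exact b1 i _
  have hqM : ∀ i, |q i| ≤ M := fun i => by
    rw [hq, abs_div, abs_of_pos (hA0 i), div_le_iff₀ (hA0 i)]; exact b2 i _
  set u : ι → ℝ → ℝ := fun i h => f i (a i + h) / A i with hu
  have hu0 : ∀ i h, 0 < u i h := fun i h => div_pos ((hf i).pos _) (hA0 i)
  have huM : ∀ i h, u i h ≤ M := fun i h => by
    simp only [hu]; rw [div_le_iff₀ (hA0 i)]; exact (hf i).ratio _ _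
  have hut : ∀ i h, |u i h - 1 - h * p i - h ^ 2 / 2 * q i| ≤ M * |h| ^ 3 := fun i h => by
    have e : u i h - 1 - h * p i - h ^ 2 / 2 * q i
        = (f i (a i + h) - f i (a i) - h * f₁ i (a i) - h ^ 2 / 2 * f₂ i (a i)) / A i := by
      have := (hA0 i).ne'
      have h2 : f i (a i) = A i := rfl
      simp only [hu, hp, hq, h2]
      field_simp
    rw [e, abs_div, abs_of_pos (hA0 i), div_le_iff₀ (hA0 i)]; exact ht i _ _
  have hum : ∀ i, Measurable (u i) := fun i =>
    ((hf i).meas.comp (by fun_prop : Measurable fun h => a i + h)).div_const _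
  have hf_eq : ∀ i h, f i (a i + h) = A i * u i h := fun i h => by
    simp only [hu]; rw [mul_div_cancel₀ _ (hA0 i).ne']
  have hheat : ∀ i, heat r (f i) (a i) = A i * ∫ z, u i (r * z) ∂gaussianReal 0 1 := fun i => by
    simp only [heat, hf_eq, integral_const_mul]
  have hL : ∫ w, ∏ i, f i (a i + r * inner ℝ (v i) w) ^ c ∂stdGaussian E
      = (∏ i, A i ^ c) * ∫ w, ∏ i, u i (r * inner ℝ (v i) w) ^ c ∂stdGaussian E := by
    rw [← integral_const_mul]
    congr 1; ext w
    rw [← Finset.prod_mul_distrib]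
    refine Finset.prod_congr rfl fun i _ => ?_
    rw [hf_eq, Real.mul_rpow (hA0 i).le (hu0 _ _).le]
  have hR : ∏ i, heat r (f i) (a i) ^ c
      = (∏ i, A i ^ c) * ∏ i, (∫ z, u i (r * z) ∂gaussianReal 0 1) ^ c := by
    rw [← Finset.prod_mul_distrib]
    refine Finset.prod_congr rfl fun i _ => ?_
    rw [hheat, Real.mul_rpow (hA0 i).le (integral_nonneg fun z => (hu0 _ _).le)]
  rw [hL, hR, mul_left_comm]
  refine mul_le_mul_of_nonneg_left ?_ (Finset.prod_nonneg fun i _ => (Real.rpow_pos_of_pos (hA0 i) c).le)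
  set P := ∑ i, p i • v i with hP
  have hinner : ∀ w, ∑ i, p i * (r * inner ℝ (v i) w) = r * inner ℝ P w := fun w => by
    rw [hP, sum_inner, Finset.mul_sum]
    refine Finset.sum_congr rfl fun i _ => ?_
    rw [real_inner_smul_left]; ring
  -- upper bound for the left-hand side
  have hupper : ∫ w, ∏ i, u i (r * inner ℝ (v i) w) ^ c ∂stdGaussian E
      ≤ 1 + c * r ^ 2 / 2 * ∑ i, q i + K₂ * m * r ^ 3 := by
    have i1 := (memLp_inner_stdGaussian P).integrable (by norm_num)
    have i2 : ∀ b : E, Integrable (fun w => inner ℝ b w ^ 2) (stdGaussian E) := fun b =>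
      (memLp_inner_stdGaussian b).integrable_sq
    have i3 := integrable_norm_cube_stdGaussian (E := E)
    have k1 : Integrable (fun w => 1 + (c * r) * inner ℝ P w) (stdGaussian E) :=
      (integrable_const 1).add (i1.const_mul _)
    have k2' : ∀ i ∈ Finset.univ, Integrable (fun w => (c * (q i - p i ^ 2) * r ^ 2 / 2)
        * inner ℝ (v i) w ^ 2) (stdGaussian E) := fun i _ => (i2 _).const_mul _
    have k2 : Integrable (fun w => 1 + (c * r) * inner ℝ P w
        + ∑ i, (c * (q i - p i ^ 2) * r ^ 2 / 2) * inner ℝ (v i) w ^ 2) (stdGaussian E) :=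
      k1.add (integrable_finsetSum _ k2')
    have k3 : Integrable (fun w => 1 + (c * r) * inner ℝ P w
        + ∑ i, (c * (q i - p i ^ 2) * r ^ 2 / 2) * inner ℝ (v i) w ^ 2
        + ((c * r) ^ 2 / 2) * inner ℝ P w ^ 2) (stdGaussian E) := k2.add ((i2 P).const_mul _)
    have k4 : Integrable (fun w => 1 + (c * r) * inner ℝ P w
        + ∑ i, (c * (q i - p i ^ 2) * r ^ 2 / 2) * inner ℝ (v i) w ^ 2
        + ((c * r) ^ 2 / 2) * inner ℝ P w ^ 2 + (K₂ * r ^ 3) * ‖w‖ ^ 3) (stdGaussian E) :=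
      k3.add (i3.const_mul _)
    have hmono : ∫ w, ∏ i, u i (r * inner ℝ (v i) w) ^ c ∂stdGaussian E
        ≤ ∫ w, (1 + (c * r) * inner ℝ P w
        + ∑ i, (c * (q i - p i ^ 2) * r ^ 2 / 2) * inner ℝ (v i) w ^ 2
        + ((c * r) ^ 2 / 2) * inner ℝ P w ^ 2 + (K₂ * r ^ 3) * ‖w‖ ^ 3) ∂stdGaussian E := by
      refine integral_mono_of_nonneg (.of_forall fun w => Finset.prod_nonneg fun i _ =>
        (Real.rpow_pos_of_pos (hu0 _ _) c).le) k4 (.of_forall fun w => ?_)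
      have hh : ∀ i, |r * inner ℝ (v i) w| ≤ r * ‖w‖ := fun i => by
        rw [abs_mul, abs_of_pos hr]
        have := abs_real_inner_le_norm (v i) w
        rw [hv, one_mul] at this
        gcongr
      have := hup c hc hc1 p q (fun i => r * inner ℝ (v i) w) (fun i => u i (r * inner ℝ (v i) w))
        (r * ‖w‖) (by positivity) hpM hqM hh (fun i => hu0 _ _) (fun i => huM _ _) fun i => by
          have h1 := (abs_le.mp (hut i (r * inner ℝ (v i) w))).2
          have h2 : M * |r * inner ℝ (v i) w| ^ 3 ≤ M * (r * ‖w‖) ^ 3 := by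
            gcongr; exact hh i
          linarith
      refine this.trans (le_of_eq ?_)
      simp only [hinner]
      rw [Finset.mul_sum]
      have : ∀ i, c * ((q i - p i ^ 2) * (r * inner ℝ (v i) w) ^ 2 / 2)
        = (c * (q i - p i ^ 2) * r ^ 2 / 2) * inner ℝ (v i) w ^ 2 := fun i => by ring
      simp only [this]
      ring
    refine hmono.trans ?_
    rw [integral_add k3 (i3.const_mul _), integral_add k2 ((i2 P).const_mul _),
      integral_add k1 (integrable_finsetSum _ k2'), integral_finsetSum _ k2',
      integral_add (integrable_const 1) (i1.const_mul _)]
    simp only [integral_const_mul, integral_inner_stdGaussian, integral_inner_sq_stdGaussian, hv,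
      ← hm]
    have hPb := hG p
    rw [← hP] at hPb
    have e : ∑ i, c * (q i - p i ^ 2) * r ^ 2 / 2 * (1 : ℝ) ^ 2
        = c * r ^ 2 / 2 * ∑ i, q i - c * r ^ 2 / 2 * ∑ i, p i ^ 2 := by
      rw [Finset.mul_sum, Finset.mul_sum, ← Finset.sum_sub_distrib]
      exact Finset.sum_congr rfl fun i _ => by ring
    rw [e]
    have : c * r ^ 2 / 2 * (c * ‖P‖ ^ 2) ≤ c * r ^ 2 / 2 * ∑ i, p i ^ 2 := by gcongr
    simp
    linarith
  -- lower bound for the right-hand side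
  have hlower : Real.exp (c * r ^ 2 / 2 * ∑ i, q i - Fintype.card ι * K₁ * r ^ 3)
      ≤ ∏ i, (∫ z, u i (r * z) ∂gaussianReal 0 1) ^ c := by
    have h1 : ∀ i ∈ Finset.univ, Real.exp (c * (q i * r ^ 2 / 2 - K₁ * r ^ 3))
        ≤ (∫ z, u i (r * z) ∂gaussianReal 0 1) ^ c := fun i _ => by
      rw [mul_comm c, Real.exp_mul]
      exact Real.rpow_le_rpow (Real.exp_pos _).le (hlow (u i) (p i) (q i) (hum i) (hu0 i) (huM i)
        (hqM i) (hut i) r hr hrr) hc.le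
    refine le_trans ?_ (Finset.prod_le_prod (fun i _ => (Real.exp_pos _).le) h1)
    rw [← Real.exp_sum, Real.exp_le_exp, ← Finset.mul_sum, Finset.sum_sub_distrib,
      Finset.sum_const, Finset.card_univ, nsmul_eq_mul]
    have e : ∑ i, q i * r ^ 2 / 2 = r ^ 2 / 2 * ∑ i, q i := by
      rw [Finset.mul_sum]; exact Finset.sum_congr rfl fun i _ => by ring
    rw [e]
    have : c * (Fintype.card ι * (K₁ * r ^ 3)) ≤ 1 * (Fintype.card ι * (K₁ * r ^ 3)) := by gcongr
    linarith
  calc _ ≤ 1 + c * r ^ 2 / 2 * ∑ i, q i + K₂ * m * r ^ 3 := hupper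
    _ ≤ Real.exp (c * r ^ 2 / 2 * ∑ i, q i + K₂ * m * r ^ 3) := by
      have := Real.add_one_le_exp (c * r ^ 2 / 2 * ∑ i, q i + K₂ * m * r ^ 3)
      linarith
    _ = Real.exp ((K₂ * m + Fintype.card ι * K₁) * r ^ 3)
        * Real.exp (c * r ^ 2 / 2 * ∑ i, q i - Fintype.card ι * K₁ * r ^ 3) := by
      rw [← Real.exp_add]; congr 1; ring
    _ ≤ _ := by gcongr

lemma iterate_brascampLieb_scale (v : ι → E) (c : ℝ) (hc : 0 < c) {M K r : ℝ}
    (hstep : ∀ f : ι → ℝ → ℝ, (∀ i, Nice M (f i)) → ∀ a : ι → ℝ,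
      ∫ w, ∏ i, f i (a i + r * inner ℝ (v i) w) ^ c ∂stdGaussian E
        ≤ Real.exp K * ∏ i, heat r (f i) (a i) ^ c) (N : ℕ) :
    ∀ f : ι → ℝ → ℝ, (∀ i, Nice M (f i)) → ∀ a : ι → ℝ,
      ∫ w, ∏ i, f i (a i + √N * r * inner ℝ (v i) w) ^ c ∂stdGaussian E
        ≤ Real.exp (N * K) * ∏ i, heat (√N * r) (f i) (a i) ^ c := by
  induction N with
  | zero => intro f hf a; simp [heat]
  | succ N ih =>
    intro f hf a
    have hs : (√(N + 1 : ℕ) * r) ^ 2 = (√N * r) ^ 2 + r ^ 2 := by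
      rw [mul_pow, mul_pow, Real.sq_sqrt (by positivity), Real.sq_sqrt (by positivity)]
      push_cast; ring
    have hg : Measurable fun w : E => ∏ i, f i (a i + inner ℝ (v i) w) ^ c :=
      Finset.measurable_fun_prod _ fun i _ =>
        ((hf i).meas.comp (by fun_prop)).pow_const c
    have hb : ∀ w : E, |∏ i, f i (a i + inner ℝ (v i) w) ^ c| ≤ ∏ i, (M * f i 0) ^ c := fun w => by
      rw [Finset.abs_prod]
      refine Finset.prod_le_prod (fun i _ => abs_nonneg _) fun i _ => ?_
      rw [abs_of_pos (Real.rpow_pos_of_pos ((hf i).pos _) c)]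
      refine Real.rpow_le_rpow ((hf i).pos _).le ((le_abs_self _).trans ((hf i).abs_le _)) hc.le
    have e := integral_integral_add_eq (charFun_stdGaussian (E := E)) (√N * r) r
      (√(N + 1 : ℕ) * r) hs hg hb
    simp only [inner_add_right, real_inner_smul_right, ← add_assoc] at e
    rw [← e]
    calc _ ≤ ∫ w, Real.exp K * ∏ i, heat r (f i) (a i + √N * r * inner ℝ (v i) w) ^ c
          ∂stdGaussian E := by
          refine integral_mono_of_nonneg (.of_forall fun w => integral_nonneg fun w' =>
            Finset.prod_nonneg fun i _ => (Real.rpow_pos_of_pos ((hf i).pos _) c).le) ?_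
            (.of_forall fun w => hstep f hf fun i => a i + √N * r * inner ℝ (v i) w)
          refine Integrable.const_mul ?_ _
          refine Integrable.of_bound (C := ∏ i, (M * heat r (f i) 0) ^ c) ?_
            (.of_forall fun w => ?_)
          · exact (Finset.measurable_fun_prod _ fun i _ =>
              (((hf i).heat r).meas.comp (by fun_prop)).pow_const c).aestronglyMeasurable
          · rw [Real.norm_eq_abs, Finset.abs_prod]
            refine Finset.prod_le_prod (fun i _ => abs_nonneg _) fun i _ => ?_
            rw [abs_of_pos (Real.rpow_pos_of_pos (((hf i).heat r).pos _) c)]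
            exact Real.rpow_le_rpow (((hf i).heat r).pos _).le
              ((le_abs_self _).trans (((hf i).heat r).abs_le _)) hc.le
      _ = Real.exp K * ∫ w, ∏ i, heat r (f i) (a i + √N * r * inner ℝ (v i) w) ^ c
          ∂stdGaussian E := integral_const_mul _ _
      _ ≤ Real.exp K * (Real.exp (N * K) *
          ∏ i, heat (√N * r) (heat r (f i)) (a i) ^ c) := by
          gcongr; exact ih _ (fun i => (hf i).heat r) a
      _ = _ := by
          rw [← mul_assoc, ← Real.exp_add]
          congr 2
          · push_cast; ring
          · ext i; rw [heat_heat (hf i) _ _ _ hs]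

/-- The Gaussian Brascamp-Lieb inequality for nice functions. -/
lemma brascampLieb_of_nice (v : ι → E) (hv : ∀ i, ‖v i‖ = 1) (c : ℝ) (hc : 0 < c) (hc1 : c ≤ 1)
    (hG : ∀ t : ι → ℝ, c * ‖∑ i, t i • v i‖ ^ 2 ≤ ∑ i, t i ^ 2) {M : ℝ} (hM : 1 ≤ M)
    (f : ι → ℝ → ℝ) (hf : ∀ i, Nice M (f i)) :
    ∫ w, ∏ i, f i (inner ℝ (v i) w) ^ c ∂stdGaussian E
      ≤ ∏ i, (∫ z, f i z ∂gaussianReal 0 1) ^ c := by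
  obtain ⟨K, r₀, hK, hr0, hstep⟩ := exists_infinitesimal_brascampLieb v hv c hc hc1 hG M hM
  have key : ∀ᶠ N : ℕ in Filter.atTop, ∫ w, ∏ i, f i (inner ℝ (v i) w) ^ c ∂stdGaussian E
      ≤ Real.exp (K * (√N)⁻¹) * ∏ i, (∫ z, f i z ∂gaussianReal 0 1) ^ c := by
    have hlim : Filter.Tendsto (fun N : ℕ => (√(N : ℝ))⁻¹) Filter.atTop (nhds 0) :=
      (Real.tendsto_sqrt_atTop.comp tendsto_natCast_atTop_atTop).inv_tendsto_atTop
    filter_upwards [hlim.eventually (gt_mem_nhds hr0), Filter.eventually_gt_atTop 0] with N hN hN0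
    have hs : 0 < √(N : ℝ) := Real.sqrt_pos.2 (by exact_mod_cast hN0)
    have := iterate_brascampLieb_scale v c hc (fun f hf a => hstep f hf a (√N)⁻¹ (by positivity) hN.le) N f hf 0
    rw [mul_inv_cancel₀ hs.ne'] at this
    simp only [Pi.zero_apply, zero_add, one_mul, heat] at this
    have e : (N : ℝ) * (K * (√N)⁻¹ ^ 3) = K * (√N)⁻¹ := by
      have : (N : ℝ) = √N ^ 2 := (Real.sq_sqrt (by positivity)).symm
      rw [this, Real.sqrt_sq hs.le]; field_simp
    rwa [e] at this
  have hlim2 : Filter.Tendsto (fun N : ℕ => Real.exp (K * (√(N : ℝ))⁻¹)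
      * ∏ i, (∫ z, f i z ∂gaussianReal 0 1) ^ c) Filter.atTop
      (nhds (Real.exp (K * 0) * ∏ i, (∫ z, f i z ∂gaussianReal 0 1) ^ c)) := by
    have hlim : Filter.Tendsto (fun N : ℕ => (√(N : ℝ))⁻¹) Filter.atTop (nhds 0) :=
      (Real.tendsto_sqrt_atTop.comp tendsto_natCast_atTop_atTop).inv_tendsto_atTop
    exact ((Real.continuous_exp.tendsto _).comp (hlim.const_mul K)).mul_const _
  have := ge_of_tendsto hlim2 key
  simpa using this

end

end GaussianBL

namespace GaussianBL
open ProbabilityTheory Filter Topology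
open scoped ENNReal NNReal ContDiff

lemma abs_le_mul_abs_of_hasDerivAt {ψ ψ' : ℝ → ℝ} {C h : ℝ} (h0 : ψ 0 = 0)
    (hd : ∀ t, HasDerivAt ψ (ψ' t) t) (hb : ∀ t, |t| ≤ |h| → |ψ' t| ≤ C) : |ψ h| ≤ C * |h| := by
  have hconv : Convex ℝ (closedBall (0 : ℝ) |h|) := convex_closedBall _ _
  have := hconv.norm_image_sub_le_of_norm_hasDerivWithin_le (f := ψ) (f' := ψ') (C := C)
    (x := 0) (y := h) (fun t _ => (hd t).hasDerivWithinAt)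
    (fun t ht => hb t (by simpa using ht)) (by simp) (by simp)
  simpa [h0] using this

lemma abs_taylor_two_le {G G₁ G₂ G₃ : ℝ → ℝ} {B : ℝ} (h1 : ∀ x, HasDerivAt G (G₁ x) x)
    (h2 : ∀ x, HasDerivAt G₁ (G₂ x) x) (h3 : ∀ x, HasDerivAt G₂ (G₃ x) x) (hB : ∀ x, |G₃ x| ≤ B)
    (x h : ℝ) : |G (x + h) - G x - h * G₁ x - h ^ 2 / 2 * G₂ x| ≤ B * |h| ^ 3 := by
  have hB0 : 0 ≤ B := (abs_nonneg _).trans (hB 0)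
  have s1 : ∀ h, |G₂ (x + h) - G₂ x| ≤ B * |h| := fun h =>
    abs_le_mul_abs_of_hasDerivAt (ψ := fun t => G₂ (x + t) - G₂ x) (ψ' := fun t => G₃ (x + t))
      (by simp) (fun t => ((h3 (x + t)).comp_const_add x t).sub_const _) fun t _ => hB _
  have s2 : ∀ h, |G₁ (x + h) - G₁ x - h * G₂ x| ≤ B * |h| * |h| := fun h =>
    abs_le_mul_abs_of_hasDerivAt (ψ := fun t => G₁ (x + t) - G₁ x - t * G₂ x)
      (ψ' := fun t => G₂ (x + t) - 0 - 1 * G₂ x) (by simp)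
      (fun t => (((h2 (x + t)).comp_const_add x t).sub (hasDerivAt_const t _)).sub
        ((hasDerivAt_id t).mul_const _)) fun t ht => by
          have := s1 t
          rw [sub_zero, one_mul]; exact this.trans (by gcongr)
  have s3 := abs_le_mul_abs_of_hasDerivAt (h := h)
      (ψ := fun t => G (x + t) - G x - t * G₁ x - t ^ 2 / 2 * G₂ x)
      (ψ' := fun t => G₁ (x + t) - 0 - 1 * G₁ x - t * G₂ x) (C := B * |h| * |h|) (by simp)
      (fun t => ((((h1 (x + t)).comp_const_add x t).sub (hasDerivAt_const t _)).sub
        ((hasDerivAt_id t).mul_const _)).sub (by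
          have := (((hasDerivAt_id t).pow 2).div_const 2).mul_const (G₂ x)
          refine this.congr_deriv ?_
          simp)) fun t ht => by
          have := s2 t
          rw [sub_zero, one_mul]; exact this.trans (by gcongr)
  exact s3.trans (le_of_eq (by ring))

lemma exists_nice_sq_add {g : ℝ → ℝ} (hg : ContDiff ℝ ∞ g) (hc : HasCompactSupport g) {δ : ℝ}
    (hδ : 0 < δ) : ∃ M, 1 ≤ M ∧ Nice M (fun x => g x ^ 2 + δ) := by
  set G := fun x => g x ^ 2 with hG
  have hG0 : ContDiff ℝ ∞ G := hg.pow 2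
  have hGc : HasCompactSupport G := by
    refine hc.mono fun x hx => ?_
    simp only [hG, Function.mem_support] at hx ⊢
    exact fun h => hx (by simp [h])
  have hG1 : ContDiff ℝ ∞ (deriv G) := (contDiff_infty_iff_deriv.1 hG0).2
  have hG2 : ContDiff ℝ ∞ (deriv (deriv G)) := (contDiff_infty_iff_deriv.1 hG1).2
  have hG3 : ContDiff ℝ ∞ (deriv (deriv (deriv G))) := (contDiff_infty_iff_deriv.1 hG2).2
  have hd : ∀ {k : ℝ → ℝ}, ContDiff ℝ ∞ k → ∀ x, HasDerivAt k (deriv k x) x := fun hk x =>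
    (hk.differentiable (by simp) x).hasDerivAt
  obtain ⟨B₀, hB0⟩ := hGc.exists_bound_of_continuous hG0.continuous
  obtain ⟨B₁, hB1⟩ := hGc.deriv.exists_bound_of_continuous hG1.continuous
  obtain ⟨B₂, hB2⟩ := hGc.deriv.deriv.exists_bound_of_continuous hG2.continuous
  obtain ⟨B₃, hB3⟩ := hGc.deriv.deriv.deriv.exists_bound_of_continuous hG3.continuous
  have p0 := (norm_nonneg _).trans (hB0 0)
  have p1 := (norm_nonneg _).trans (hB1 0)
  have p2 := (norm_nonneg _).trans (hB2 0)
  have p3 := (norm_nonneg _).trans (hB3 0)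
  set S := B₀ + B₁ + B₂ + B₃ with hS
  have hle : ∀ y x, y ≤ δ + S → y ≤ (1 + S / δ) * (G x + δ) := fun y x hy => by
    have : 0 ≤ G x := sq_nonneg _
    have h2 : (1 + S / δ) * δ = δ + S := by field_simp
    have h3 : 0 ≤ S / δ := by positivity
    nlinarith
  refine ⟨1 + S / δ, by have : 0 ≤ S / δ := by positivity
                        linarith, ?_⟩
  refine ⟨(hG0.continuous.add continuous_const).measurable, fun x => by positivity, fun x h => ?_,
    deriv G, deriv (deriv G), hG1.continuous.measurable, hG2.continuous.measurable,
    fun x => hle _ x ?_, fun x => hle _ x ?_, fun x h => ?_⟩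
  · apply hle _ x
    have := (le_abs_self _).trans (hB0 (x + h))
    simp only [hG] at this
    linarith
  · have := hB1 x
    rw [Real.norm_eq_abs] at this; linarith
  · have := hB2 x
    rw [Real.norm_eq_abs] at this; linarith
  · have := abs_taylor_two_le (hd hG0) (hd hG1) (hd hG2) hB3 x h
    have h2 := hle S x (by linarith)
    simp only [add_sub_add_right_eq_sub]
    have h3 : B₃ * |h| ^ 3 ≤ S * |h| ^ 3 := by gcongr; linarith
    have h4 : S * |h| ^ 3 ≤ (1 + S / δ) * (G x + δ) * |h| ^ 3 := by gcongr
    calc _ ≤ _ := this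
      _ ≤ (1 + S / δ) * (G x + δ) * |h| ^ 3 := h3.trans h4
      _ = _ := by simp only [hG]; ring

section
variable {E : Type*} [NormedAddCommGroup E] [InnerProductSpace ℝ E] [FiniteDimensional ℝ E]
  [MeasurableSpace E] [BorelSpace E] {ι : Type*} [Fintype ι]

lemma map_inner_stdGaussian {v : E} (hv : ‖v‖ = 1) :
    (stdGaussian E).map (fun w => inner ℝ v w) = gaussianReal 0 1 := by
  have hm : Measurable fun w : E => inner ℝ v w := by fun_prop
  have := Measure.isProbabilityMeasure_map (μ := stdGaussian E) hm.aemeasurable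
  apply Measure.ext_of_charFun
  ext t
  rw [charFun_gaussianReal_std, charFun_apply, integral_map hm.aemeasurable (by fun_prop)]
  have h := charFun_stdGaussian (t • v)
  rw [norm_smul, hv, mul_one, charFun_apply] at h
  rw [← h]
  congr 1; ext w
  simp [inner_smul_right, real_inner_comm]

lemma lintegral_brascampLieb_of_nice (v : ι → E) (hv : ∀ i, ‖v i‖ = 1) (c : ℝ) (hc : 0 < c)
    (hc1 : c ≤ 1) (hG : ∀ t : ι → ℝ, c * ‖∑ i, t i • v i‖ ^ 2 ≤ ∑ i, t i ^ 2) {M : ℝ}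
    (hM : 1 ≤ M) (f : ι → ℝ → ℝ) (hf : ∀ i, Nice M (f i)) :
    ∫⁻ w, ∏ i, ENNReal.ofReal (f i (inner ℝ (v i) w)) ^ c ∂stdGaussian E
      ≤ ∏ i, (∫⁻ z, ENNReal.ofReal (f i z) ∂gaussianReal 0 1) ^ c := by
  have h := ENNReal.ofReal_le_ofReal (brascampLieb_of_nice v hv c hc hc1 hG hM f hf)
  have hpos : ∀ w : E, ∀ i, 0 ≤ f i (inner ℝ (v i) w) ^ c := fun w i =>
    (Real.rpow_pos_of_pos ((hf i).pos _) c).le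
  rw [ofReal_integral_eq_lintegral_ofReal, ENNReal.ofReal_prod_of_nonneg] at h
  · have e1 : ∀ w, ∏ i, ENNReal.ofReal (f i (inner ℝ (v i) w)) ^ c
        = ENNReal.ofReal (∏ i, f i (inner ℝ (v i) w) ^ c) := fun w => by
      rw [ENNReal.ofReal_prod_of_nonneg fun i _ => hpos _ i]
      exact Finset.prod_congr rfl fun i _ => ENNReal.ofReal_rpow_of_pos ((hf i).pos _)
    have e2 : ∀ i, (∫⁻ z, ENNReal.ofReal (f i z) ∂gaussianReal 0 1) ^ c
        = ENNReal.ofReal ((∫ z, f i z ∂gaussianReal 0 1) ^ c) := fun i => by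
      rw [← ENNReal.ofReal_rpow_of_nonneg (integral_nonneg fun z => ((hf i).pos z).le) hc.le,
        ofReal_integral_eq_lintegral_ofReal ((hf i).integrable_comp (g := fun x => x) measurable_id)
          (.of_forall fun z => ((hf i).pos z).le)]
    simp only [e1, e2]
    exact h
  · intro i _
    exact Real.rpow_nonneg (integral_nonneg fun z => ((hf i).pos z).le) c
  · refine Integrable.of_bound (C := ∏ i, (M * f i 0) ^ c) ?_ (.of_forall fun w => ?_)
    · exact (Finset.measurable_fun_prod _ fun i _ =>
        ((hf i).meas.comp (by fun_prop)).pow_const c).aestronglyMeasurable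
    · rw [Real.norm_eq_abs, Finset.abs_prod]
      refine Finset.prod_le_prod (fun i _ => abs_nonneg _) fun i _ => ?_
      rw [abs_of_pos (Real.rpow_pos_of_pos ((hf i).pos _) c)]
      exact Real.rpow_le_rpow ((hf i).pos _).le ((le_abs_self _).trans ((hf i).abs_le _)) hc.le
  · exact .of_forall fun w => Finset.prod_nonneg fun i _ => hpos w i

lemma Nice.mono {M M' : ℝ} (h : M ≤ M') {f : ℝ → ℝ} (hf : Nice M f) : Nice M' f := by
  obtain ⟨f₁, f₂, m1, m2, b1, b2, ht⟩ := hf.taylor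
  have hp := fun x => (hf.pos x).le
  refine ⟨hf.meas, hf.pos, fun x h => (hf.ratio x h).trans ?_, f₁, f₂, m1, m2,
    fun x => (b1 x).trans ?_, fun x => (b2 x).trans ?_, fun x h => (ht x h).trans ?_⟩ <;>
  · have := hp x; gcongr

lemma lintegral_enorm_sq {Ω : Type*} [MeasurableSpace Ω] {μ : Measure Ω} (g : Ω → ℝ) :
    ∫⁻ x, ENNReal.ofReal (g x ^ 2) ∂μ = eLpNorm g 2 μ ^ 2 := by
  have := eLpNorm_nnreal_pow_eq_lintegral (f := g) (μ := μ) (p := 2) (by norm_num)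
  simp only [NNReal.coe_ofNat, ENNReal.coe_ofNat, ENNReal.rpow_ofNat] at this
  rw [this]
  refine lintegral_congr fun x => ?_
  rw [← ofReal_norm, ← ENNReal.ofReal_pow (norm_nonneg _), Real.norm_eq_abs, sq_abs]

/-- The Gaussian Brascamp-Lieb inequality for functions of one-dimensional marginals. -/
theorem lintegral_brascampLieb_one (v : ι → E) (hv : ∀ i, ‖v i‖ = 1) (c : ℝ) (hc : 0 < c)
    (hc1 : c ≤ 1) (hG : ∀ t : ι → ℝ, c * ‖∑ i, t i • v i‖ ^ 2 ≤ ∑ i, t i ^ 2)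
    (f : ι → ℝ → ℝ≥0∞) (hf : ∀ i, Measurable (f i)) {B : ℝ≥0∞} (hB : B ≠ ⊤)
    (hfB : ∀ i x, f i x ≤ B) :
    ∫⁻ w, ∏ i, f i (inner ℝ (v i) w) ^ c ∂stdGaussian E
      ≤ ∏ i, (∫⁻ z, f i z ∂gaussianReal 0 1) ^ c := by
  set s : ℝ → ι → ℝ := fun x i => √(f i x).toReal with hs
  have hsm : Measurable s := measurable_pi_lambda _ fun i => (hf i).ennreal_toReal.sqrt
  have hsL : MemLp s 2 (gaussianReal 0 1) := by
    refine MemLp.of_bound hsm.aestronglyMeasurable (√B.toReal) (.of_forall fun x => ?_)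
    rw [pi_norm_le_iff_of_nonneg (Real.sqrt_nonneg _)]
    intro i
    rw [hs, Real.norm_eq_abs, abs_of_nonneg (Real.sqrt_nonneg _)]
    exact Real.sqrt_le_sqrt (ENNReal.toReal_mono hB (hfB i x))
  set ε : ℕ → ℝ := fun k => 1 / ((k : ℝ) + 1) with hε
  have hε0 : ∀ k, 0 < ε k := fun k => by positivity
  have hεlim : Tendsto ε atTop (𝓝 0) := tendsto_one_div_add_atTop_nhds_zero_nat
  choose g hgc hgs hgn using fun k => hsL.exist_eLpNorm_sub_le (by norm_num) (by norm_num) (hε0 k)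
  have hεlim' : Tendsto (fun k => ENNReal.ofReal (ε k)) atTop (𝓝 0) := by
    simpa using ENNReal.tendsto_ofReal hεlim
  have hgm : ∀ k, AEStronglyMeasurable (g k) (gaussianReal 0 1) := fun k =>
    (hgs k).continuous.aestronglyMeasurable
  have htend : Tendsto (fun k => eLpNorm (g k - s) 2 (gaussianReal 0 1)) atTop (𝓝 0) := by
    refine tendsto_of_tendsto_of_tendsto_of_le_of_le tendsto_const_nhds hεlim'
      (fun _ => bot_le) fun k => ?_
    simp only
    rw [eLpNorm_sub_comm]; exact hgn k
  obtain ⟨ns, hns, hae⟩ := (tendstoInMeasure_of_tendsto_eLpNorm (by norm_num) hgm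
    hsm.aestronglyMeasurable htend).exists_seq_tendsto_ae
  have hgi : ∀ k i, ContDiff ℝ ∞ (fun x => g k x i) := fun k i => contDiff_pi.1 (hgs k) i
  have hgci : ∀ k i, HasCompactSupport (fun x => g k x i) := fun k i =>
    (hgc k).comp_left (g := fun y : ι → ℝ => y i) rfl
  set F : ℕ → ι → ℝ → ℝ := fun k i x => g (ns k) x i ^ 2 + ε (ns k) with hF
  have hFB : ∀ k, ∫⁻ w, ∏ i, ENNReal.ofReal (F k i (inner ℝ (v i) w)) ^ c ∂stdGaussian E
      ≤ ∏ i, (∫⁻ z, ENNReal.ofReal (F k i z) ∂gaussianReal 0 1) ^ c := fun k => by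
    choose M hM1 hM using fun i => exists_nice_sq_add (hgi (ns k) i) (hgci (ns k) i) (hε0 (ns k))
    have hsup : ∃ M₀, 1 ≤ M₀ ∧ ∀ i, M i ≤ M₀ :=
      ⟨1 + ∑ i, M i, by
        have := Finset.sum_nonneg fun i (_ : i ∈ Finset.univ) => zero_le_one.trans (hM1 i)
        linarith, fun i => by
        have := Finset.single_le_sum (fun i _ => zero_le_one.trans (hM1 i)) (Finset.mem_univ i)
        linarith⟩
    obtain ⟨M₀, h1, h2⟩ := hsup
    exact lintegral_brascampLieb_of_nice v hv c hc hc1 hG h1 (F k) fun i => (hM i).mono (h2 i)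
  have hFint : ∀ i, Tendsto (fun k => ((eLpNorm (fun x => s x i) 2 (gaussianReal 0 1)
      + ENNReal.ofReal (ε (ns k))) ^ 2 + ENNReal.ofReal (ε (ns k))) ^ c) atTop
      (𝓝 ((∫⁻ z, f i z ∂gaussianReal 0 1) ^ c)) := fun i => by
    have e : ∫⁻ z, f i z ∂gaussianReal 0 1 = eLpNorm (fun x => s x i) 2 (gaussianReal 0 1) ^ 2 := by
      rw [← lintegral_enorm_sq]
      refine lintegral_congr fun x => ?_
      rw [hs, Real.sq_sqrt ENNReal.toReal_nonneg, ENNReal.ofReal_toReal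
        (ne_top_of_le_ne_top hB (hfB i x))]
    rw [e]
    have h1 := hεlim'.comp hns.tendsto_atTop
    have h2 := (((ENNReal.continuous_pow 2).tendsto _).comp ((tendsto_const_nhds
      (x := eLpNorm (fun x => s x i) 2 (gaussianReal 0 1))).add h1)).add h1
    have h3 := ((ENNReal.continuous_rpow_const (y := c)).tendsto _).comp h2
    simpa [Function.comp_def] using h3
  have hFle : ∀ k i, (∫⁻ z, ENNReal.ofReal (F k i z) ∂gaussianReal 0 1) ≤
      (eLpNorm (fun x => s x i) 2 (gaussianReal 0 1)
      + ENNReal.ofReal (ε (ns k))) ^ 2 + ENNReal.ofReal (ε (ns k)) := fun k i => by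
    have e : ∫⁻ z, ENNReal.ofReal (F k i z) ∂gaussianReal 0 1
        = eLpNorm (fun x => g (ns k) x i) 2 (gaussianReal 0 1) ^ 2 + ENNReal.ofReal (ε (ns k)) := by
      simp only [hF]
      simp_rw [ENNReal.ofReal_add (sq_nonneg _) (hε0 _).le]
      rw [lintegral_add_right _ measurable_const, lintegral_enorm_sq]
      simp
    rw [e]
    gcongr
    have h1 : (fun x => g (ns k) x i) = (fun x => s x i) - fun x => (s - g (ns k)) x i := by
      ext x; simp
    rw [h1]
    refine (eLpNorm_sub_le ?_ ?_ (by norm_num)).trans ?_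
    · exact ((measurable_pi_apply i).comp hsm).aestronglyMeasurable
    · exact ((measurable_pi_apply i).comp
        (hsm.sub (hgs (ns k)).continuous.measurable)).aestronglyMeasurable
    · gcongr
      exact (eLpNorm_mono fun x => norm_le_pi_norm _ i).trans (hgn (ns k))
  have hpt : ∀ᵐ w ∂stdGaussian E, Tendsto (fun k => ∏ i, ENNReal.ofReal
      (F k i (inner ℝ (v i) w)) ^ c) atTop (𝓝 (∏ i, f i (inner ℝ (v i) w) ^ c)) := by
    have h1 : ∀ i, ∀ᵐ w ∂stdGaussian E, Tendsto (fun k => g (ns k) (inner ℝ (v i) w)) atTop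
        (𝓝 (s (inner ℝ (v i) w))) := fun i => by
      have h2 := hae
      rw [← map_inner_stdGaussian (hv i)] at h2
      exact ae_of_ae_map (by fun_prop) h2
    filter_upwards [ae_all_iff.2 h1] with w hw
    refine ENNReal.tendsto_finsetProd_of_ne_top _ (fun i _ => ?_) fun i _ =>
      ENNReal.rpow_ne_top_of_nonneg hc.le (ne_top_of_le_ne_top hB (hfB i _))
    have h3 : Tendsto (fun k => F k i (inner ℝ (v i) w)) atTop
        (𝓝 (s (inner ℝ (v i) w) i ^ 2 + 0)) :=
      (((tendsto_pi_nhds.1 (hw i)) i).pow 2).add (hεlim.comp hns.tendsto_atTop)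
    have h4 := ((ENNReal.continuous_rpow_const (y := c)).tendsto _).comp
      (ENNReal.tendsto_ofReal h3)
    rw [add_zero, hs, Real.sq_sqrt ENNReal.toReal_nonneg, ENNReal.ofReal_toReal
        (ne_top_of_le_ne_top hB (hfB i _))] at h4
    exact h4
  have hFm : ∀ k, Measurable fun w : E => ∏ i, ENNReal.ofReal (F k i (inner ℝ (v i) w)) ^ c :=
    fun k => Finset.measurable_fun_prod _ fun i _ => by
      have : Measurable (F k i) := ((hgi (ns k) i).continuous.measurable.pow_const 2).add_const _
      exact (this.comp (by fun_prop)).ennreal_ofReal.pow_const c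
  have hlim : Tendsto (fun k => ∏ i, ((eLpNorm (fun x => s x i) 2 (gaussianReal 0 1)
      + ENNReal.ofReal (ε (ns k))) ^ 2 + ENNReal.ofReal (ε (ns k))) ^ c) atTop
      (𝓝 (∏ i, (∫⁻ z, f i z ∂gaussianReal 0 1) ^ c)) := by
    refine ENNReal.tendsto_finsetProd_of_ne_top _ (fun i _ => hFint i) fun i _ => ?_
    refine ENNReal.rpow_ne_top_of_nonneg hc.le (ne_top_of_le_ne_top hB ?_)
    calc ∫⁻ z, f i z ∂gaussianReal 0 1 ≤ ∫⁻ _, B ∂gaussianReal 0 1 := lintegral_mono fun x => hfB i x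
      _ = B := by simp
  calc ∫⁻ w, ∏ i, f i (inner ℝ (v i) w) ^ c ∂stdGaussian E
      = ∫⁻ w, liminf (fun k => ∏ i, ENNReal.ofReal (F k i (inner ℝ (v i) w)) ^ c) atTop
        ∂stdGaussian E := lintegral_congr_ae (hpt.mono fun w hw => hw.liminf_eq.symm)
    _ ≤ liminf (fun k => ∫⁻ w, ∏ i, ENNReal.ofReal (F k i (inner ℝ (v i) w)) ^ c
        ∂stdGaussian E) atTop := lintegral_liminf_le hFm
    _ ≤ liminf (fun k => ∏ i, ((eLpNorm (fun x => s x i) 2 (gaussianReal 0 1)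
      + ENNReal.ofReal (ε (ns k))) ^ 2 + ENNReal.ofReal (ε (ns k))) ^ c) atTop := by
        refine liminf_le_liminf (.of_forall fun k => (hFB k).trans ?_)
        exact Finset.prod_le_prod' fun i _ => ENNReal.rpow_le_rpow (hFle k i) hc.le
    _ = _ := hlim.liminf_eq

end
end GaussianBL

namespace GaussianBL
open ProbabilityTheory Filter Topology
open scoped ENNReal NNReal ContDiff

/-- The standard Gaussian measure on `Fin n → ℝ`. -/
noncomputable abbrev gaussPi (n : ℕ) : Measure (Fin n → ℝ) := Measure.pi fun _ => gaussianReal 0 1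

section
variable {E : Type*} [NormedAddCommGroup E] [InnerProductSpace ℝ E] [FiniteDimensional ℝ E]
  [MeasurableSpace E] [BorelSpace E] {ι : Type*} [Fintype ι]

lemma lintegral_pi_succ {α : Type*} [MeasurableSpace α] (μ : Measure α) [SigmaFinite μ] (n : ℕ)
    {F : (Fin (n + 1) → α) → ℝ≥0∞} (hF : Measurable F) :
    ∫⁻ x, F x ∂(Measure.pi fun _ : Fin (n + 1) => μ)
      = ∫⁻ y, ∫⁻ x, F (Fin.cons y x) ∂(Measure.pi fun _ : Fin n => μ) ∂μ := by
  have h := (measurePreserving_piFinSuccAbove (fun _ : Fin (n + 1) => μ) 0).symm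
  rw [← h.lintegral_comp hF, lintegral_prod]
  · simp [MeasurableEquiv.piFinSuccAbove_symm_apply, Fin.insertNthEquiv]
  · exact (hF.comp h.measurable).aemeasurable

/-- The Gaussian Brascamp-Lieb inequality, tensorized. -/
theorem lintegral_brascampLieb (v : ι → E) (hv : ∀ i, ‖v i‖ = 1) (c : ℝ) (hc : 0 < c)
    (hc1 : c ≤ 1) (hG : ∀ t : ι → ℝ, c * ‖∑ i, t i • v i‖ ^ 2 ≤ ∑ i, t i ^ 2) (n : ℕ)
    (f : ι → (Fin n → ℝ) → ℝ≥0∞) (hf : ∀ i, Measurable (f i)) {B : ℝ≥0∞} (hB : B ≠ ⊤)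
    (hfB : ∀ i x, f i x ≤ B) :
    ∫⁻ w, ∏ i, f i (fun l => inner ℝ (v i) (w l)) ^ c ∂(Measure.pi fun _ : Fin n => stdGaussian E)
      ≤ ∏ i, (∫⁻ z, f i z ∂gaussPi n) ^ c := by
  induction n with
  | zero =>
    have : ∀ (i : ι) (x y : Fin 0 → ℝ), f i x = f i y := fun i x y => by rw [Subsingleton.elim x y]
    rw [Measure.pi_of_empty, lintegral_dirac]
    refine Finset.prod_le_prod' fun i _ => ?_
    rw [gaussPi, Measure.pi_of_empty, lintegral_dirac]
    exact le_of_eq (by rw [this])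
  | succ n ih =>
    have hcons : ∀ (i : ι) (y : E) (w : Fin n → E),
        (fun l => inner ℝ (v i) ((Fin.cons y w : Fin (n + 1) → E) l))
        = (Fin.cons (inner ℝ (v i) y) fun l => inner ℝ (v i) (w l) : Fin (n + 1) → ℝ) := by
      intro i y w
      ext l
      refine Fin.cases ?_ (fun l => ?_) l <;> simp
    have hmc : Measurable fun p : ℝ × (Fin n → ℝ) => (Fin.cons p.1 p.2 : Fin (n + 1) → ℝ) :=
      measurable_pi_lambda _ fun l => by
        refine Fin.cases ?_ (fun l => ?_) l
        · simpa using measurable_fst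
        · simpa [Function.comp_def] using (measurable_pi_apply l).comp (measurable_snd (α := ℝ))
    have hfc : ∀ i, Measurable fun p : ℝ × (Fin n → ℝ) => f i (Fin.cons p.1 p.2) := fun i =>
      (hf i).comp hmc
    rw [lintegral_pi_succ]
    · simp only [hcons]
      calc _ ≤ ∫⁻ y, ∏ i, (∫⁻ z, f i (Fin.cons (inner ℝ (v i) y) z) ∂gaussPi n) ^ c
            ∂stdGaussian E := lintegral_mono fun y =>
              ih (fun i z => f i (Fin.cons (inner ℝ (v i) y) z))
                (fun i => (hfc i).comp measurable_prodMk_left) fun i x => hfB _ _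
        _ ≤ ∏ i, (∫⁻ y, ∫⁻ z, f i (Fin.cons y z) ∂gaussPi n ∂gaussianReal 0 1) ^ c := by
            refine lintegral_brascampLieb_one v hv c hc hc1 hG
              (fun i y => ∫⁻ z, f i (Fin.cons y z) ∂gaussPi n)
              (fun i => (hfc i).lintegral_prod_right') hB fun i y => ?_
            calc _ ≤ ∫⁻ _, B ∂gaussPi n := lintegral_mono fun z => hfB _ _
              _ = B := by simp
        _ = _ := by
            refine Finset.prod_congr rfl fun i _ => ?_
            rw [gaussPi, lintegral_pi_succ _ _ (hf i)]
    · exact Finset.measurable_fun_prod _ fun i _ =>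
        ((hf i).comp (measurable_pi_lambda _ fun l => by fun_prop)).pow_const c

end
end GaussianBL

namespace GaussianBL
open ProbabilityTheory Filter Topology
open scoped ENNReal NNReal

section
variable {J Ω Ω' : Type*} [Fintype J] [MeasurableSpace Ω] [MeasurableSpace Ω'] {n : ℕ}

/-- `X` is, under `P`, a family of standard Gaussian vectors in `ℝⁿ` scaled and correlated
according to the matrix `R`, independently in each coordinate of `ℝⁿ`. -/
def HasGram (P : Measure Ω) (X : Ω → J → Fin n → ℝ) (R : J → J → ℝ) : Prop :=
  Measurable X ∧ ∀ c : J → Fin n → ℝ,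
    ∫ ω, Complex.exp (((∑ j, ∑ l, c j l * X ω j l : ℝ) : ℂ) * Complex.I) ∂P
      = Complex.exp ((-(∑ l, ∑ j, ∑ k, c j l * c k l * R j k) / 2 : ℝ) : ℂ)

lemma HasGram.map_eq {P : Measure Ω} {P' : Measure Ω'} [IsFiniteMeasure P] [IsFiniteMeasure P']
    {X : Ω → J → Fin n → ℝ} {X' : Ω' → J → Fin n → ℝ} {R : J → J → ℝ}
    (h : HasGram P X R) (h' : HasGram P' X' R) : P.map X = P'.map X' := by
  classical
  refine Measure.ext_of_charFunDual ?_
  ext L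
  have hL : ∀ x : J → Fin n → ℝ,
      L x = ∑ j, ∑ l, L (Pi.single j (Pi.single l 1)) * x j l := by
    intro x
    have hx : x = ∑ j, ∑ l, x j l • (Pi.single j (Pi.single l 1) : J → Fin n → ℝ) := by
      ext j l
      simp [Finset.sum_apply, Pi.single_apply, Finset.sum_ite_eq, apply_ite, ite_apply]
    conv_lhs => rw [hx]
    simp [map_sum, mul_comm]
  rw [charFunDual_apply, charFunDual_apply, integral_map h.1.aemeasurable (by fun_prop),
    integral_map h'.1.aemeasurable (by fun_prop)]
  refine Eq.trans ?_ ((h.2 fun j l => L (Pi.single j (Pi.single l 1))).trans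
    ((h'.2 fun j l => L (Pi.single j (Pi.single l 1))).symm.trans ?_)) <;>
  · congr with ω
    rw [hL]

lemma HasGram.integral_eq {P : Measure Ω} {P' : Measure Ω'} [IsFiniteMeasure P]
    [IsFiniteMeasure P'] {X : Ω → J → Fin n → ℝ} {X' : Ω' → J → Fin n → ℝ} {R : J → J → ℝ}
    (h : HasGram P X R) (h' : HasGram P' X' R) {F : (J → Fin n → ℝ) → ℝ} (hF : Measurable F) :
    ∫ ω, F (X ω) ∂P = ∫ ω, F (X' ω) ∂P' := by
  rw [← integral_map h.1.aemeasurable hF.aestronglyMeasurable, h.map_eq h',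
    integral_map h'.1.aemeasurable hF.aestronglyMeasurable]

lemma HasGram.lintegral_eq {P : Measure Ω} {P' : Measure Ω'} [IsFiniteMeasure P]
    [IsFiniteMeasure P'] {X : Ω → J → Fin n → ℝ} {X' : Ω' → J → Fin n → ℝ} {R : J → J → ℝ}
    (h : HasGram P X R) (h' : HasGram P' X' R) {F : (J → Fin n → ℝ) → ℝ≥0∞} (hF : Measurable F) :
    ∫⁻ ω, F (X ω) ∂P = ∫⁻ ω, F (X' ω) ∂P' := by
  rw [← lintegral_map hF h.1, h.map_eq h', lintegral_map hF h'.1]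

lemma HasGram.congr {P : Measure Ω} {X : Ω → J → Fin n → ℝ} {R R' : J → J → ℝ}
    (h : HasGram P X R) (hR : ∀ j k, R j k = R' j k) : HasGram P X R' := by
  obtain rfl : R = R' := by ext; exact hR _ _
  exact h

lemma HasGram.add_smul {P : Measure Ω} {P' : Measure Ω'} [SFinite P]
    [SFinite P'] {X : Ω → J → Fin n → ℝ} {Y : Ω' → J → Fin n → ℝ} {R R' : J → J → ℝ}
    (h : HasGram P X R) (h' : HasGram P' Y R') (a b : ℝ) :
    HasGram (P.prod P') (fun ω => a • X ω.1 + b • Y ω.2) fun j k => a ^ 2 * R j k + b ^ 2 * R' j k := by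
  have hX := h.1
  have hY := h'.1
  refine ⟨by fun_prop, fun c => ?_⟩
  have key : ∀ ω : Ω × Ω', Complex.exp
      (((∑ j, ∑ l, c j l * (a • X ω.1 + b • Y ω.2) j l : ℝ) : ℂ) * Complex.I)
      = Complex.exp (((∑ j, ∑ l, (a • c) j l * X ω.1 j l : ℝ) : ℂ) * Complex.I)
      * Complex.exp (((∑ j, ∑ l, (b • c) j l * Y ω.2 j l : ℝ) : ℂ) * Complex.I) := by
    intro ω
    rw [← Complex.exp_add, ← add_mul, ← Complex.ofReal_add, ← Finset.sum_add_distrib]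
    congr 3
    refine Finset.sum_congr rfl fun j _ => ?_
    rw [← Finset.sum_add_distrib]
    refine Finset.sum_congr rfl fun l _ => ?_
    simp only [Pi.add_apply, Pi.smul_apply, smul_eq_mul]
    ring
  simp_rw [key]
  rw [integral_prod_mul (fun ω => Complex.exp (((∑ j, ∑ l, (a • c) j l * X ω j l : ℝ) : ℂ) * Complex.I))
    fun ω => Complex.exp (((∑ j, ∑ l, (b • c) j l * Y ω j l : ℝ) : ℂ) * Complex.I),
    h.2, h'.2, ← Complex.exp_add, ← Complex.ofReal_add]
  congr 2
  rw [← add_div, ← neg_add]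
  simp_rw [← Finset.sum_add_distrib]
  congr 2
  refine Finset.sum_congr rfl fun l _ => Finset.sum_congr rfl fun j _ =>
    Finset.sum_congr rfl fun k _ => ?_
  simp only [Pi.smul_apply, smul_eq_mul]
  ring

lemma hasGram_inner {E : Type*} [NormedAddCommGroup E] [InnerProductSpace ℝ E]
    [FiniteDimensional ℝ E] [MeasurableSpace E] [BorelSpace E] (v : J → E) (n : ℕ) :
    HasGram (Measure.pi fun _ : Fin n => stdGaussian E)
      (fun Γ j l => inner ℝ (v j) (Γ l)) fun j k => inner ℝ (v j) (v k) := by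
  refine ⟨by fun_prop, fun c => ?_⟩
  have key : ∀ Γ : Fin n → E, Complex.exp
      (((∑ j, ∑ l, c j l * inner ℝ (v j) (Γ l) : ℝ) : ℂ) * Complex.I)
      = ∏ l, Complex.exp ((inner ℝ (Γ l) (∑ j, c j l • v j) : ℝ) * Complex.I) := by
    intro Γ
    rw [← Complex.exp_sum, ← Finset.sum_mul, ← Complex.ofReal_sum, Finset.sum_comm]
    simp [inner_sum, real_inner_smul_right, real_inner_comm]
  simp_rw [key]
  rw [integral_fintype_prod_eq_prod
    (f := fun l x => Complex.exp ((inner ℝ x (∑ j, c j l • v j) : ℝ) * Complex.I))]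
  simp_rw [← charFun_apply, charFun_stdGaussian]
  rw [← Complex.exp_sum]
  congr 1
  push_cast
  rw [← Finset.sum_div, ← Finset.sum_neg_distrib]
  congr 1
  refine Finset.sum_congr rfl fun l _ => ?_
  have : ‖∑ j, c j l • v j‖ ^ 2 = ∑ j, ∑ k, c j l * c k l * inner ℝ (v j) (v k) := by
    rw [← real_inner_self_eq_norm_sq, sum_inner]
    refine Finset.sum_congr rfl fun j _ => ?_
    rw [inner_sum]
    refine Finset.sum_congr rfl fun k _ => ?_
    rw [real_inner_smul_left, real_inner_smul_right, mul_assoc]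
  exact_mod_cast congrArg Neg.neg this

lemma charFun_exp_gaussPi (c : Fin n → ℝ) :
    ∫ x, Complex.exp (((∑ l, c l * x l : ℝ) : ℂ) * Complex.I) ∂gaussPi n
      = Complex.exp ((-(∑ l, c l * c l) / 2 : ℝ) : ℂ) := by
  have key : ∀ x : Fin n → ℝ, Complex.exp (((∑ l, c l * x l : ℝ) : ℂ) * Complex.I)
      = ∏ l, Complex.exp ((c l : ℂ) * (x l : ℂ) * Complex.I) := by
    intro x
    rw [← Complex.exp_sum, ← Finset.sum_mul]
    push_cast
    rfl
  simp_rw [key]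
  rw [gaussPi, integral_fintype_prod_eq_prod
    (f := fun l (x : ℝ) => Complex.exp ((c l : ℂ) * (x : ℂ) * Complex.I))]
  simp_rw [← charFun_apply_real, charFun_gaussianReal]
  rw [← Complex.exp_sum]
  congr 1
  push_cast
  rw [← Finset.sum_neg_distrib, Finset.sum_div]
  refine Finset.sum_congr rfl fun l _ => ?_
  simp
  ring

lemma hasGram_const (n : ℕ) :
    HasGram (gaussPi n) (fun x (_ : J) => x) fun _ _ => 1 := by
  refine ⟨by fun_prop, fun c => ?_⟩
  have := charFun_exp_gaussPi fun l => ∑ j, c j l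
  convert this using 3 with x
  · congr 3
    rw [Finset.sum_comm]
    simp_rw [Finset.sum_mul]
  · congr 2
    refine Finset.sum_congr rfl fun l _ => ?_
    simp [Finset.sum_mul_sum]

lemma hasGram_pi [DecidableEq J] (n : ℕ) :
    HasGram (Measure.pi fun _ : J => gaussPi n) (fun x => x) fun j k => if j = k then 1 else 0 := by
  refine ⟨measurable_id, fun c => ?_⟩
  have key : ∀ x : J → Fin n → ℝ, Complex.exp (((∑ j, ∑ l, c j l * x j l : ℝ) : ℂ) * Complex.I)
      = ∏ j, Complex.exp (((∑ l, c j l * x j l : ℝ) : ℂ) * Complex.I) := by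
    intro x
    rw [← Complex.exp_sum, ← Finset.sum_mul, ← Complex.ofReal_sum]
  simp_rw [key]
  rw [integral_fintype_prod_eq_prod
    (f := fun j (x : Fin n → ℝ) => Complex.exp (((∑ l, c j l * x l : ℝ) : ℂ) * Complex.I))]
  simp_rw [charFun_exp_gaussPi]
  rw [← Complex.exp_sum, ← Complex.ofReal_sum, ← Finset.sum_div, Finset.sum_neg_distrib,
    Finset.sum_comm]
  simp

end
end GaussianBL

namespace GaussianBL
open ProbabilityTheory Filter Topology
open scoped ENNReal NNReal

section
variable {J Ω Ω' : Type*} [Fintype J] [MeasurableSpace Ω] [MeasurableSpace Ω'] {n : ℕ}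

/-- Gaussian averaging of `g` around `√s • x`. -/
noncomputable def smooth (s : ℝ) (g : (Fin n → ℝ) → ℝ) (x : Fin n → ℝ) : ℝ :=
  ∫ z, g (√(1 - s) • z + √s • x) ∂gaussPi n

lemma measurable_smooth (s : ℝ) {g : (Fin n → ℝ) → ℝ} (hg : Measurable g) :
    Measurable (smooth s g) := by
  have : StronglyMeasurable fun p : (Fin n → ℝ) × (Fin n → ℝ) => g (√(1 - s) • p.2 + √s • p.1) :=
    (hg.comp (by fun_prop)).stronglyMeasurable
  exact this.integral_prod_right'.measurable

lemma abs_smooth_le (s : ℝ) {g : (Fin n → ℝ) → ℝ} {K : ℝ} (hK : ∀ x, |g x| ≤ K) (x : Fin n → ℝ) :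
    |smooth s g x| ≤ K := by
  rw [smooth]
  simpa using norm_integral_le_of_norm_le_const (μ := gaussPi n)
    (f := fun z => g (√(1 - s) • z + √s • x)) (C := K) (.of_forall fun z => hK _)

lemma integral_prod_eq_integral_prod_smooth [DecidableEq J] {P : Measure Ω} {P' : Measure Ω'}
    [IsProbabilityMeasure P] [IsProbabilityMeasure P']
    {X : Ω → J → Fin n → ℝ} {Y : Ω' → J → Fin n → ℝ} {R : J → J → ℝ} {s : ℝ} (hs0 : 0 ≤ s)
    (hs1 : s ≤ 1)
    (hX : HasGram P X fun j k => (1 - s) * (if j = k then 1 else 0) + s * R j k)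
    (hY : HasGram P' Y R) {g : (Fin n → ℝ) → ℝ} (hg : Measurable g) {K : ℝ}
    (hK : ∀ x, |g x| ≤ K) :
    ∫ ω, ∏ j, g (X ω j) ∂P = ∫ ω, ∏ j, smooth s g (Y ω j) ∂P' := by
  have hYm := hY.1
  have h1 := ((hasGram_pi (J := J) n).add_smul hY √(1 - s) √s).congr
    (R' := fun j k => (1 - s) * (if j = k then 1 else 0) + s * R j k) fun j k => by
      rw [Real.sq_sqrt (by linarith), Real.sq_sqrt hs0]
  have hF : Measurable fun x : J → Fin n → ℝ => ∏ j, g (x j) :=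
    Finset.measurable_fun_prod _ fun j _ => hg.comp (measurable_pi_apply j)
  rw [hX.integral_eq h1 hF, integral_prod_symm]
  · refine integral_congr_ae (.of_forall fun ω => ?_)
    exact integral_fintype_prod_eq_prod
      (f := fun j (z : Fin n → ℝ) => g (√(1 - s) • z + √s • Y ω j))
  · refine Integrable.of_bound (C := K ^ Fintype.card J) (hF.comp h1.1).aestronglyMeasurable
      (.of_forall fun ω => ?_)
    rw [Real.norm_eq_abs, Finset.abs_prod]
    calc _ ≤ ∏ _j : J, K := Finset.prod_le_prod (fun _ _ => abs_nonneg _) fun _ _ => hK _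
      _ = _ := by simp

lemma lintegral_inner_eq {E : Type*} [NormedAddCommGroup E] [InnerProductSpace ℝ E]
    [FiniteDimensional ℝ E] [MeasurableSpace E] [BorelSpace E] {v : E} (hv : ‖v‖ = 1)
    {F : (Fin n → ℝ) → ℝ≥0∞} (hF : Measurable F) :
    ∫⁻ Γ, F (fun l => inner ℝ v (Γ l)) ∂(Measure.pi fun _ : Fin n => stdGaussian E)
      = ∫⁻ x, F x ∂gaussPi n := by
  have h1 := hasGram_inner (fun _ : Unit => v) n
  have h2 := (hasGram_const (J := Unit) n).congr (R' := fun _ _ => inner ℝ v v) fun _ _ => by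
    rw [real_inner_self_eq_norm_sq, hv, one_pow]
  exact h1.lintegral_eq h2 (F := fun x => F (x ())) (hF.comp (measurable_pi_apply _))

/-- The centered normalized indicator of a set, with respect to the Gaussian measure. -/
noncomputable def centeredInd (A : Set (Fin n → ℝ)) (x : Fin n → ℝ) : ℝ :=
  A.indicator (fun _ => 1) x / (gaussPi n).real A - 1

lemma measurable_centeredInd {A : Set (Fin n → ℝ)} (hA : MeasurableSet A) :
    Measurable (centeredInd A) :=
  ((measurable_const.indicator hA).div_const _).sub_const 1

lemma abs_centeredInd_le {A : Set (Fin n → ℝ)} (h0 : 0 < (gaussPi n).real A) (x : Fin n → ℝ) :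
    |centeredInd A x| ≤ ((gaussPi n).real A)⁻¹ := by
  have h1 : (gaussPi n).real A ≤ 1 := measureReal_le_one
  have h2 := (one_le_inv₀ h0).2 h1
  unfold centeredInd
  by_cases hx : x ∈ A
  · simp only [hx, Set.indicator_of_mem, one_div]
    rw [abs_of_nonneg (by linarith)]
    linarith
  · simpa [hx] using h2

/-- Vectors of the plane at angle `arccos s`. -/
noncomputable def planePair (s : ℝ) : Fin 2 → EuclideanSpace ℝ (Fin 2) :=
  ![!₂[1, 0], !₂[s, √(1 - s ^ 2)]]

lemma inner_planePair {s : ℝ} (h0 : 0 ≤ s) (h1 : s ≤ 1) (j k : Fin 2) :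
    inner ℝ (planePair s j) (planePair s k) = if j = k then 1 else s := by
  have h : 0 ≤ 1 - s ^ 2 := by nlinarith
  fin_cases j <;> fin_cases k <;>
    simp [planePair, EuclideanSpace.inner_eq_star_dotProduct, dotProduct, Fin.sum_univ_two,
      -inner_self_eq_norm_sq_to_K]
  rw [Real.mul_self_sqrt h]
  ring

lemma norm_planePair {s : ℝ} (h0 : 0 ≤ s) (h1 : s ≤ 1) (j : Fin 2) : ‖planePair s j‖ = 1 := by
  have := inner_planePair h0 h1 j j
  rwa [real_inner_self_eq_norm_sq, if_pos rfl,
    pow_eq_one_iff_of_nonneg (norm_nonneg _) two_ne_zero] at this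

lemma measure_inter_planePair_le {A : Set (Fin n → ℝ)} (hA : MeasurableSet A) {s : ℝ}
    (h0 : 0 ≤ s) (h1 : s ≤ 1) :
    ∫⁻ Γ, ∏ j, A.indicator 1 (fun l => inner ℝ (planePair s j) (Γ l))
      ∂(Measure.pi fun _ : Fin n => stdGaussian (EuclideanSpace ℝ (Fin 2)))
      ≤ (gaussPi n A) ^ (2 / (1 + s)) := by
  have hG : ∀ t : Fin 2 → ℝ, (1 + s)⁻¹ * ‖∑ i, t i • planePair s i‖ ^ 2 ≤ ∑ i, t i ^ 2 := by
    intro t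
    rw [inv_mul_le_iff₀ (by linarith), ← real_inner_self_eq_norm_sq]
    simp only [Fin.sum_univ_two, inner_add_left, inner_add_right, real_inner_smul_left,
      real_inner_smul_right, inner_planePair h0 h1]
    simp
    nlinarith [mul_nonneg h0 (sq_nonneg (t 0 - t 1))]
  have h := lintegral_brascampLieb (planePair s)
    (norm_planePair h0 h1) (1 + s)⁻¹ (by positivity) (inv_le_one_of_one_le₀ (by linarith)) hG n
    (fun _ => A.indicator 1) (fun _ => measurable_one.indicator hA) (B := 1) (by simp)
    fun _ x => Set.indicator_le_self' (fun _ _ => by simp) x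
  have hpos : 0 < (1 + s)⁻¹ := by positivity
  calc _ = ∫⁻ Γ, ∏ j, A.indicator 1 (fun l => inner ℝ (planePair s j) (Γ l)) ^ (1 + s)⁻¹
        ∂(Measure.pi fun _ : Fin n => stdGaussian (EuclideanSpace ℝ (Fin 2))) := by
        refine lintegral_congr fun Γ => Finset.prod_congr rfl fun j _ => ?_
        by_cases hx : (fun l => inner ℝ (planePair s j) (Γ l)) ∈ A <;> simp [hx, hpos]
    _ ≤ _ := h
    _ = _ := by
      rw [lintegral_indicator_one hA, Fin.prod_univ_two, ← ENNReal.rpow_add_of_nonneg _ _ hpos.le hpos.le]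
      congr 1
      field_simp
      norm_num

lemma integral_smooth_sq_le {A : Set (Fin n → ℝ)} (hA : MeasurableSet A)
    {a : ℝ} (ha : Real.exp (-a) ≤ (gaussPi n).real A) {s : ℝ} (h0 : 0 ≤ s) (h1 : s ≤ 1) :
    ∫ x, smooth s (centeredInd A) x ^ 2 ∂gaussPi n ≤ Real.exp (2 * a * s) - 1 := by
  set μ := (gaussPi n).real A with hμ
  have hμ0 : 0 < μ := (Real.exp_pos _).trans_le ha
  have hμ1 : μ ≤ 1 := measureReal_le_one
  set P := Measure.pi fun _ : Fin n => stdGaussian (EuclideanSpace ℝ (Fin 2)) with hP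
  set X : (Fin n → EuclideanSpace ℝ (Fin 2)) → Fin 2 → Fin n → ℝ :=
    fun Γ j l => inner ℝ (planePair s j) (Γ l) with hXdef
  have hX : HasGram P X fun j k => (1 - s) * (if j = k then 1 else 0) + s * 1 :=
    (hasGram_inner (planePair s) n).congr fun j k => by
      rw [inner_planePair h0 h1]
      split_ifs <;> ring
  have hXm := hX.1
  have key := integral_prod_eq_integral_prod_smooth h0 h1 hX (hasGram_const (J := Fin 2) n)
    (measurable_centeredInd hA) (abs_centeredInd_le hμ0)
  have hsq : ∫ x, smooth s (centeredInd A) x ^ 2 ∂gaussPi n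
      = ∫ Γ, ∏ j, centeredInd A (X Γ j) ∂P := by
    rw [key]
    simp [sq]
  have hunit : ∀ j, ‖planePair s j‖ = 1 := norm_planePair h0 h1
  have hXj : ∀ j, Measurable fun Γ => X Γ j := fun j => (measurable_pi_apply j).comp hXm
  have hone : ∀ j, ∫ Γ, A.indicator (fun _ => (1 : ℝ)) (X Γ j) ∂P = μ := by
    intro j
    rw [integral_eq_lintegral_of_nonneg_ae (.of_forall fun Γ => Set.indicator_nonneg (by simp) _)
      ((measurable_const.indicator hA).comp (hXj j)).aestronglyMeasurable]
    have := lintegral_inner_eq (hunit j) (n := n)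
      (F := fun x => ENNReal.ofReal (A.indicator (fun _ => (1 : ℝ)) x))
      (measurable_const.indicator hA).ennreal_ofReal
    rw [hP, this, hμ, Measure.real]
    congr 1
    rw [← lintegral_indicator_one hA]
    refine lintegral_congr fun x => ?_
    by_cases hx : x ∈ A <;> simp [hx]
  have hint : ∀ j, Integrable (fun Γ => A.indicator (fun _ => (1 : ℝ)) (X Γ j)) P := fun j =>
    Integrable.of_bound (C := 1) ((measurable_const.indicator hA).comp (hXj j)).aestronglyMeasurable
      (.of_forall fun Γ => by by_cases hx : X Γ j ∈ A <;> simp [hx])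
  have hint2 : Integrable (fun Γ => A.indicator (fun _ => (1 : ℝ)) (X Γ 0)
      * A.indicator (fun _ => (1 : ℝ)) (X Γ 1)) P :=
    Integrable.of_bound (C := 1) (((measurable_const.indicator hA).comp (hXj 0)).mul
      ((measurable_const.indicator hA).comp (hXj 1))).aestronglyMeasurable
      (.of_forall fun Γ => by
        by_cases hx : X Γ 0 ∈ A <;> by_cases hy : X Γ 1 ∈ A <;> simp [hx, hy])
  have hpair : ∫ Γ, A.indicator (fun _ => (1 : ℝ)) (X Γ 0) * A.indicator (fun _ => (1 : ℝ)) (X Γ 1) ∂P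
      ≤ μ ^ (2 / (1 + s)) := by
    rw [integral_eq_lintegral_of_nonneg_ae (.of_forall fun Γ => mul_nonneg
      (Set.indicator_nonneg (by simp) _) (Set.indicator_nonneg (by simp) _))
      hint2.aestronglyMeasurable, hμ, Measure.real, ENNReal.toReal_rpow]
    refine ENNReal.toReal_mono (by simp [show (0:ℝ) ≤ 2 / (1 + s) by positivity]) ?_
    refine le_trans (le_of_eq ?_) (measure_inter_planePair_le hA h0 h1)
    refine lintegral_congr fun Γ => ?_
    rw [Fin.prod_univ_two]
    by_cases hx : X Γ 0 ∈ A <;> by_cases hy : X Γ 1 ∈ A <;> simp [X] at hx hy <;>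
      simp [X, hx, hy]
  have hexpand : ∫ Γ, ∏ j, centeredInd A (X Γ j) ∂P
      = (∫ Γ, A.indicator (fun _ => (1 : ℝ)) (X Γ 0) * A.indicator (fun _ => (1 : ℝ)) (X Γ 1) ∂P)
        / μ ^ 2 - 1 := by
    have : ∀ Γ, ∏ j, centeredInd A (X Γ j)
        = A.indicator (fun _ => (1 : ℝ)) (X Γ 0) * A.indicator (fun _ => (1 : ℝ)) (X Γ 1) / μ ^ 2
          - A.indicator (fun _ => (1 : ℝ)) (X Γ 0) / μ - A.indicator (fun _ => (1 : ℝ)) (X Γ 1) / μ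
          + 1 := by
      intro Γ
      rw [Fin.prod_univ_two, centeredInd, centeredInd, ← hμ]
      field_simp
      ring
    simp_rw [this]
    rw [integral_add, integral_sub, integral_sub, integral_div, integral_div, integral_div,
      hone, hone]
    · simp
      field_simp
      ring
    · exact hint2.div_const _
    · exact (hint 0).div_const _
    · exact (hint2.div_const _).sub ((hint 0).div_const _)
    · exact (hint 1).div_const _
    · exact ((hint2.div_const _).sub ((hint 0).div_const _)).sub ((hint 1).div_const _)
    · exact integrable_const _
  rw [hsq, hexpand]
  gcongr
  calc _ ≤ μ ^ (2 / (1 + s)) / μ ^ 2 := by gcongr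
    _ = μ ^ (-(2 * s / (1 + s))) := by
      rw [← Real.rpow_natCast μ 2, ← Real.rpow_sub hμ0]
      congr 1
      field_simp
      push_cast
      ring
    _ ≤ μ ^ (-(2 * s)) := by
      refine Real.rpow_le_rpow_of_exponent_ge hμ0 hμ1 (neg_le_neg ?_)
      exact div_le_self (by positivity) (by linarith)
    _ ≤ Real.exp (-a) ^ (-(2 * s)) :=
      Real.rpow_le_rpow_of_nonpos (Real.exp_pos _) ha (by linarith)
    _ = _ := by
      rw [← Real.exp_mul]
      congr 1
      ring

lemma exists_gram_eq [DecidableEq J] {R : Matrix J J ℝ} (hR : R.PosSemidef) :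
    ∃ (m : ℕ) (w : J → EuclideanSpace ℝ (Fin m)), ∀ j k, inner ℝ (w j) (w k) = R j k := by
  obtain ⟨m, v, rfl⟩ := Matrix.posSemidef_iff_eq_sum_vecMulVec.1 hR
  refine ⟨m, fun j => WithLp.toLp 2 fun i => v i j, fun j k => ?_⟩
  simp [EuclideanSpace.inner_eq_star_dotProduct, dotProduct, Matrix.sum_apply,
    Matrix.vecMulVec_apply, mul_comm]

/-- Decoupled bound on mixed moments of the centered indicator along almost orthogonal
directions. -/
theorem abs_integral_prod_centeredInd_le {E : Type*} [NormedAddCommGroup E]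
    [InnerProductSpace ℝ E] [FiniteDimensional ℝ E] [MeasurableSpace E] [BorelSpace E]
    {A : Set (Fin n → ℝ)} (hA : MeasurableSet A)
    {a : ℝ} (ha : Real.exp (-a) ≤ (gaussPi n).real A) {v : J → E} (hv : ∀ j, ‖v j‖ = 1)
    {s : ℝ} (h0 : 0 < s) (h1 : s ≤ 1)
    (hE : ∀ t : J → ℝ, |‖∑ j, t j • v j‖ ^ 2 - ∑ j, t j ^ 2| ≤ s * ∑ j, t j ^ 2) :
    |∫ Γ, ∏ j, centeredInd A (fun l => inner ℝ (v j) (Γ l))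
      ∂(Measure.pi fun _ : Fin n => stdGaussian E)|
      ≤ (Real.exp (2 * a * s) - 1) ^ ((Fintype.card J : ℝ) / 2) := by
  classical
  have hμ0 : 0 < (gaussPi n).real A := (Real.exp_pos _).trans_le ha
  have ha0 : 0 ≤ a := by
    have := ha.trans measureReal_le_one
    rw [Real.exp_le_one_iff] at this
    linarith
  set R : Matrix J J ℝ := Matrix.of fun j k =>
    (if j = k then 1 else 0) + s⁻¹ * (inner ℝ (v j) (v k) - if j = k then 1 else 0) with hR
  have hquad : ∀ t : J → ℝ, ∑ j, ∑ k, t j * t k * R j k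
      = ∑ j, t j ^ 2 + s⁻¹ * (‖∑ j, t j • v j‖ ^ 2 - ∑ j, t j ^ 2) := by
    intro t
    have e1 : ‖∑ j, t j • v j‖ ^ 2 = ∑ j, ∑ k, t j * t k * inner ℝ (v j) (v k) := by
      rw [← real_inner_self_eq_norm_sq, sum_inner]
      refine Finset.sum_congr rfl fun j _ => ?_
      rw [inner_sum]
      refine Finset.sum_congr rfl fun k _ => ?_
      rw [real_inner_smul_left, real_inner_smul_right, mul_assoc]
    have e2 : ∑ j, t j ^ 2 = ∑ j, ∑ k, t j * t k * (if j = k then 1 else 0) := by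
      simp [sq]
    rw [e1, e2, ← Finset.sum_sub_distrib, Finset.mul_sum, ← Finset.sum_add_distrib]
    refine Finset.sum_congr rfl fun j _ => ?_
    rw [← Finset.sum_sub_distrib, Finset.mul_sum, ← Finset.sum_add_distrib]
    refine Finset.sum_congr rfl fun k _ => ?_
    simp only [hR, Matrix.of_apply]
    ring
  have hle : ∀ t : J → ℝ, |s⁻¹ * (‖∑ j, t j • v j‖ ^ 2 - ∑ j, t j ^ 2)| ≤ ∑ j, t j ^ 2 := by
    intro t
    rw [abs_mul, abs_of_pos (inv_pos.2 h0), inv_mul_le_iff₀ h0]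
    exact hE t
  have hpsd : R.PosSemidef := by
    refine Matrix.PosSemidef.of_dotProduct_mulVec_nonneg ?_ fun t => ?_
    · ext j k
      simp [hR, real_inner_comm, eq_comm]
    · have : star t ⬝ᵥ R.mulVec t = ∑ j, ∑ k, t j * t k * R j k := by
        simp only [dotProduct, Matrix.mulVec, Finset.mul_sum, star_trivial]
        refine Finset.sum_congr rfl fun j _ => Finset.sum_congr rfl fun k _ => by ring
      rw [this, hquad]
      linarith [(abs_le.1 (hle t)).1]
  obtain ⟨m, w, hw⟩ := exists_gram_eq hpsd
  have hwn : ∀ j, ‖w j‖ = 1 := fun j => by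
    have := hw j j
    rw [real_inner_self_eq_norm_sq] at this
    rw [← pow_eq_one_iff_of_nonneg (norm_nonneg _) two_ne_zero, this]
    simp [hR, hv j]
  have hwG : ∀ t : J → ℝ, (1 / 2 : ℝ) * ‖∑ j, t j • w j‖ ^ 2 ≤ ∑ j, t j ^ 2 := by
    intro t
    have e1 : ‖∑ j, t j • w j‖ ^ 2 = ∑ j, ∑ k, t j * t k * R j k := by
      rw [← real_inner_self_eq_norm_sq, sum_inner]
      refine Finset.sum_congr rfl fun j _ => ?_
      rw [inner_sum]
      refine Finset.sum_congr rfl fun k _ => ?_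
      rw [real_inner_smul_left, real_inner_smul_right, mul_assoc, hw]
    rw [e1, hquad]
    linarith [(abs_le.1 (hle t)).2]
  set h := smooth s (centeredInd A) with hh
  have hhm : Measurable h := measurable_smooth s (measurable_centeredInd hA)
  have hhb : ∀ x, |h x| ≤ ((gaussPi n).real A)⁻¹ := abs_smooth_le s (abs_centeredInd_le hμ0)
  have hX : HasGram (Measure.pi fun _ : Fin n => stdGaussian E)
      (fun Γ j l => inner ℝ (v j) (Γ l))
      fun j k => (1 - s) * (if j = k then 1 else 0) + s * inner ℝ (w j) (w k) :=
    (hasGram_inner v n).congr fun j k => by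
      rw [hw]
      simp only [hR, Matrix.of_apply]
      field_simp
      ring
  have key := integral_prod_eq_integral_prod_smooth h0.le h1 hX (hasGram_inner w n)
    (measurable_centeredInd hA) (abs_centeredInd_le hμ0)
  rw [key]
  set b := Real.exp (2 * a * s) - 1 with hb
  have hb0 : 0 ≤ b := by
    have : 1 ≤ Real.exp (2 * a * s) := Real.one_le_exp (by positivity)
    linarith
  have hsqint : ∫⁻ x, ENNReal.ofReal (h x ^ 2) ∂gaussPi n ≤ ENNReal.ofReal b := by
    rw [← ofReal_integral_eq_lintegral_ofReal _ (.of_forall fun x => sq_nonneg _)]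
    · exact ENNReal.ofReal_le_ofReal (integral_smooth_sq_le hA ha h0.le h1)
    · refine Integrable.of_bound (C := ((gaussPi n).real A)⁻¹ ^ 2)
        (hhm.pow_const 2).aestronglyMeasurable (.of_forall fun x => ?_)
      rw [Real.norm_eq_abs, abs_pow]
      exact pow_le_pow_left₀ (abs_nonneg _) (hhb x) 2
  have hBL := lintegral_brascampLieb w hwn (1 / 2) (by norm_num) (by norm_num) hwG n
    (fun _ x => ENNReal.ofReal (h x ^ 2)) (fun _ => (hhm.pow_const 2).ennreal_ofReal)
    (B := ENNReal.ofReal (((gaussPi n).real A)⁻¹ ^ 2)) ENNReal.ofReal_ne_top fun _ x =>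
      ENNReal.ofReal_le_ofReal (by
        rw [← sq_abs]
        exact pow_le_pow_left₀ (abs_nonneg _) (hhb x) 2)
  rw [← Real.norm_eq_abs]
  refine (norm_integral_le_lintegral_norm _).trans
    (ENNReal.toReal_le_of_le_ofReal (Real.rpow_nonneg hb0 _) ?_)
  calc _ = ∫⁻ Γ, ∏ j, ENNReal.ofReal (h (fun l => inner ℝ (w j) (Γ l)) ^ 2) ^ (1 / 2 : ℝ)
        ∂(Measure.pi fun _ : Fin n => stdGaussian (EuclideanSpace ℝ (Fin m))) := by
        refine lintegral_congr fun Γ => ?_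
        rw [Real.norm_eq_abs, Finset.abs_prod, ENNReal.ofReal_prod_of_nonneg fun _ _ => abs_nonneg _]
        refine Finset.prod_congr rfl fun j _ => ?_
        rw [ENNReal.ofReal_rpow_of_nonneg (sq_nonneg _) (by norm_num), ← Real.sqrt_eq_rpow,
          Real.sqrt_sq_eq_abs]
    _ ≤ ∏ _j : J, (∫⁻ x, ENNReal.ofReal (h x ^ 2) ∂gaussPi n) ^ (1 / 2 : ℝ) := hBL
    _ ≤ ∏ _j : J, (ENNReal.ofReal b) ^ (1 / 2 : ℝ) := by gcongr
    _ = _ := by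
      rw [Finset.prod_const, Finset.card_univ, ← ENNReal.rpow_natCast, ← ENNReal.rpow_mul,
        ENNReal.ofReal_rpow_of_nonneg hb0 (by positivity)]
      congr 2
      ring

end
end GaussianBL

namespace GaussianBL
open ProbabilityTheory Filter Topology
open scoped ENNReal NNReal

/-- The sign attached to a boolean. -/
def boolSign (b : Bool) : ℝ := if b then 1 else -1

lemma boolSign_sq (b : Bool) : boolSign b * boolSign b = 1 := by
  cases b <;> simp [boolSign]

section
variable {J : Type*} [Fintype J]

lemma sum_exp_boolSign [DecidableEq J] (w : J → ℝ) (r : ℝ) :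
    ∑ b : J → Bool, Real.exp (r * ∑ j, w j * boolSign (b j))
      = 2 ^ Fintype.card J * ∏ j, Real.cosh (r * w j) := by
  have h : ∀ b : J → Bool, Real.exp (r * ∑ j, w j * boolSign (b j))
      = ∏ j, Real.exp (r * w j * boolSign (b j)) := by
    intro b
    rw [← Real.exp_sum, Finset.mul_sum]
    simp [mul_assoc]
  simp_rw [h]
  rw [← Fintype.prod_sum (f := fun j b => Real.exp (r * w j * boolSign b)), ← Finset.card_univ, ← Finset.prod_const,
    ← Finset.prod_mul_distrib]
  refine Finset.prod_congr rfl fun j _ => ?_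
  simp [boolSign, Real.cosh_eq]
  ring

lemma integral_exp_sq_div_four : ∫ x, Real.exp (x ^ 2 / 4) ∂gaussianReal 0 1 = √2 := by
  rw [integral_gaussianReal_eq_integral_smul one_ne_zero]
  simp only [gaussianPDFReal, smul_eq_mul, NNReal.coe_one, mul_one, sub_zero]
  have : ∀ x : ℝ, (√(2 * Real.pi))⁻¹ * Real.exp (-x ^ 2 / 2) * Real.exp (x ^ 2 / 4)
      = (√(2 * Real.pi))⁻¹ * Real.exp (-(1 / 4) * x ^ 2) := by
    intro x
    rw [mul_assoc, ← Real.exp_add]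
    ring_nf
  simp_rw [this]
  rw [integral_const_mul, integral_gaussian, ← Real.sqrt_inv, ← Real.sqrt_mul (by positivity)]
  congr 1
  field_simp
  norm_num

lemma integrable_exp_sq_div_four :
    Integrable (fun x => Real.exp (x ^ 2 / 4)) (gaussianReal 0 1) := by
  refine Integrable.of_integral_ne_zero ?_
  rw [integral_exp_sq_div_four]
  positivity

/-- A subgaussian exponential square moment for Rademacher sums. -/
lemma sum_exp_sq_le [DecidableEq J] (w : J → ℝ) (hw : ∑ j, w j ^ 2 ≤ 4) :
    ∑ b : J → Bool, Real.exp ((∑ j, w j * boolSign (b j)) ^ 2 / 16)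
      ≤ 2 ^ Fintype.card J * √2 := by
  have h8 : (√8 : ℝ) ^ 2 = 8 := Real.sq_sqrt (by norm_num)
  have hlin : ∀ x : ℝ, Real.exp (x ^ 2 / 16) = ∫ g, Real.exp (x / √8 * g) ∂gaussianReal 0 1 := by
    intro x
    have := congrFun (mgf_id_gaussianReal (μ := 0) (v := 1)) (x / √8)
    rw [mgf] at this
    simp only [id] at this
    rw [this]
    congr 1
    rw [div_pow, h8]
    simp
    ring
  simp_rw [hlin]
  rw [← integral_finsetSum _ fun b _ => integrable_exp_mul_gaussianReal _,
    ← integral_exp_sq_div_four, ← integral_const_mul]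
  refine integral_mono (integrable_finsetSum _ fun b _ => integrable_exp_mul_gaussianReal _)
    (integrable_exp_sq_div_four.const_mul _) fun g => ?_
  have : ∀ b : J → Bool, (∑ j, w j * boolSign (b j)) / √8 * g
      = g / √8 * ∑ j, w j * boolSign (b j) := fun b => by ring
  simp_rw [this]
  rw [sum_exp_boolSign]
  gcongr
  calc ∏ j, Real.cosh (g / √8 * w j) ≤ ∏ j, Real.exp ((g / √8 * w j) ^ 2 / 2) :=
        Finset.prod_le_prod (fun j _ => (Real.cosh_pos _).le) fun j _ => Real.cosh_le_exp_half_sq _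
    _ = Real.exp (g ^ 2 / 16 * ∑ j, w j ^ 2) := by
        rw [← Real.exp_sum, Finset.mul_sum]
        congr 1
        refine Finset.sum_congr rfl fun j _ => ?_
        rw [mul_pow, div_pow, h8]
        ring
    _ ≤ _ := by
        gcongr
        nlinarith [sq_nonneg g]

lemma exp_le_quadratic (y : ℝ) : Real.exp y ≤ 1 + y + y ^ 2 * Real.exp |y| := by
  have h := Complex.norm_exp_sub_sum_le_norm_mul_exp (y : ℂ) 2
  have e : Complex.exp y - ∑ m ∈ Finset.range 2, (y : ℂ) ^ m / m.factorial
      = ((Real.exp y - (1 + y) : ℝ) : ℂ) := by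
    simp [Finset.sum_range_succ]
  rw [e, Complex.norm_real, Complex.norm_real, Real.norm_eq_abs, Real.norm_eq_abs, sq_abs] at h
  linarith [(abs_le.1 h).2]

lemma sum_boolSign_mul [DecidableEq J] (i j : J) :
    ∑ b : J → Bool, boolSign (b i) * boolSign (b j)
      = if i = j then 2 ^ Fintype.card J else 0 := by
  split_ifs with h
  · subst h
    simp [boolSign_sq]
  · have : ∀ b : J → Bool, boolSign (b i) * boolSign (b j)
        = ∏ k, (if k = i then boolSign (b k) else 1) * (if k = j then boolSign (b k) else 1) := by
      intro b
      rw [Finset.prod_mul_distrib]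
      simp
    simp_rw [this]
    rw [← Fintype.prod_sum (f := fun k b =>
      (if k = i then boolSign b else 1) * (if k = j then boolSign b else 1))]
    refine Finset.prod_eq_zero (Finset.mem_univ i) ?_
    simp [h, boolSign]

lemma sum_sq_boolSign [DecidableEq J] (w : J → ℝ) :
    ∑ b : J → Bool, (∑ j, w j * boolSign (b j)) ^ 2 = 2 ^ Fintype.card J * ∑ j, w j ^ 2 := by
  have : ∀ b : J → Bool, (∑ j, w j * boolSign (b j)) ^ 2
      = ∑ i, ∑ j, w i * w j * (boolSign (b i) * boolSign (b j)) := by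
    intro b
    rw [sq, Finset.sum_mul_sum]
    exact Finset.sum_congr rfl fun i _ => Finset.sum_congr rfl fun j _ => by ring
  simp_rw [this]
  rw [Finset.sum_comm, Finset.mul_sum]
  refine Finset.sum_congr rfl fun i _ => ?_
  rw [Finset.sum_comm]
  simp_rw [← Finset.mul_sum, sum_boolSign_mul]
  simp
  ring

lemma sum_exp_centered_sq_le [DecidableEq J] (w : J → ℝ) (hw : ∑ j, w j ^ 2 ≤ 4) {θ : ℝ}
    (hθ : |θ| ≤ 1 / 32) :
    ∑ b : J → Bool, Real.exp (θ * ((∑ j, w j * boolSign (b j)) ^ 2 - ∑ j, w j ^ 2))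
      ≤ 2 ^ Fintype.card J * Real.exp (4096 * θ ^ 2) := by
  set σ := ∑ j, w j ^ 2 with hσ
  have hσ0 : 0 ≤ σ := Finset.sum_nonneg fun j _ => sq_nonneg _
  have hpt : ∀ x : ℝ, Real.exp (θ * (x ^ 2 - σ))
      ≤ 1 + θ * (x ^ 2 - σ) + 2048 * θ ^ 2 * Real.exp (1 / 4) * Real.exp (x ^ 2 / 16) := by
    intro x
    refine (exp_le_quadratic _).trans (add_le_add_right ?_ _)
    have h1 : |x ^ 2 - σ| ≤ x ^ 2 + 4 := abs_le.2 ⟨by nlinarith, by nlinarith⟩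
    have hz : 0 ≤ (x ^ 2 + 4) / 32 := by positivity
    have h2 : |θ * (x ^ 2 - σ)| ≤ (x ^ 2 + 4) / 32 := by
      rw [abs_mul]
      calc _ ≤ 1 / 32 * (x ^ 2 + 4) := by gcongr
        _ = _ := by ring
    have h3 : (θ * (x ^ 2 - σ)) ^ 2 ≤ θ ^ 2 * (2048 * Real.exp ((x ^ 2 + 4) / 32)) := by
      rw [mul_pow, ← sq_abs (x ^ 2 - σ)]
      gcongr
      calc |x ^ 2 - σ| ^ 2 ≤ (x ^ 2 + 4) ^ 2 := by gcongr
        _ = 2048 * (((x ^ 2 + 4) / 32) ^ 2 / 2) := by ring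
        _ ≤ _ := by
          gcongr
          linarith [Real.quadratic_le_exp_of_nonneg hz]
    calc _ ≤ θ ^ 2 * (2048 * Real.exp ((x ^ 2 + 4) / 32)) * Real.exp ((x ^ 2 + 4) / 32) := by gcongr
      _ = 2048 * θ ^ 2 * (Real.exp ((x ^ 2 + 4) / 32) * Real.exp ((x ^ 2 + 4) / 32)) := by ring
      _ = _ := by
        rw [← Real.exp_add, mul_assoc _ (Real.exp (1 / 4)), ← Real.exp_add]
        ring_nf
  have hc : Real.exp (1 / 4) * √2 ≤ 2 := by
    have h1 : Real.exp (1 / 4) ≤ √2 := by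
      refine Real.le_sqrt_of_sq_le ?_
      have h2 : (Real.exp (1 / 4) ^ 2) ^ 2 = Real.exp 1 := by
        rw [← pow_mul, ← Real.exp_nat_mul]
        norm_num
      nlinarith [Real.exp_one_lt_d9, sq_nonneg (Real.exp (1 / 4))]
    calc _ ≤ √2 * √2 := by gcongr
      _ = 2 := Real.mul_self_sqrt (by norm_num)
  have h2q : (0 : ℝ) < 2 ^ Fintype.card J := by positivity
  calc _ ≤ ∑ b : J → Bool, (1 + θ * ((∑ j, w j * boolSign (b j)) ^ 2 - σ)
          + 2048 * θ ^ 2 * Real.exp (1 / 4) * Real.exp ((∑ j, w j * boolSign (b j)) ^ 2 / 16)) :=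
        Finset.sum_le_sum fun b _ => hpt _
    _ = 2 ^ Fintype.card J + 2048 * θ ^ 2 * Real.exp (1 / 4)
          * ∑ b : J → Bool, Real.exp ((∑ j, w j * boolSign (b j)) ^ 2 / 16) := by
        rw [Finset.sum_add_distrib, Finset.sum_add_distrib, ← Finset.mul_sum, ← Finset.mul_sum,
          Finset.sum_sub_distrib, sum_sq_boolSign, ← hσ]
        simp
    _ ≤ 2 ^ Fintype.card J + 2048 * θ ^ 2 * Real.exp (1 / 4) * (2 ^ Fintype.card J * √2) := by
        gcongr
        exact sum_exp_sq_le w hw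
    _ = 2 ^ Fintype.card J * (1 + 2048 * θ ^ 2 * (Real.exp (1 / 4) * √2)) := by ring
    _ ≤ 2 ^ Fintype.card J * (1 + 2048 * θ ^ 2 * 2) := by gcongr
    _ ≤ _ := by
        gcongr
        linarith [Real.add_one_le_exp (4096 * θ ^ 2)]

/-- The quadratic form of the off-diagonal part of the Gram matrix of normalized sign vectors. -/
noncomputable def signForm {d : ℕ} (b : Fin d → J → Bool) (w : EuclideanSpace ℝ J) : ℝ :=
  (d : ℝ)⁻¹ * ∑ k, ((∑ j, w j * boolSign (b k j)) ^ 2 - ∑ j, w j ^ 2)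

lemma sum_exp_signForm_le [DecidableEq J] {d : ℕ} (w : EuclideanSpace ℝ J) (hw : ‖w‖ ≤ 2) {τ : ℝ}
    (hτ : 32 * |τ| ≤ d) :
    ∑ b : Fin d → J → Bool, Real.exp (τ * signForm b w)
      ≤ (2 ^ Fintype.card J) ^ d * Real.exp (4096 * τ ^ 2 / d) := by
  rcases Nat.eq_zero_or_pos d with rfl | hd
  · simp [signForm]
  have hd' : (0 : ℝ) < d := by exact_mod_cast hd
  have hw4 : ∑ j, w j ^ 2 ≤ 4 := by
    have := EuclideanSpace.real_norm_sq_eq w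
    nlinarith [norm_nonneg w]
  have h : ∀ b : Fin d → J → Bool, Real.exp (τ * signForm b w)
      = ∏ k, Real.exp (τ / d * ((∑ j, w j * boolSign (b k j)) ^ 2 - ∑ j, w j ^ 2)) := by
    intro b
    rw [← Real.exp_sum, ← Finset.mul_sum, signForm]
    congr 1
    ring
  simp_rw [h]
  rw [← Fintype.prod_sum (f := fun (_ : Fin d) (b : J → Bool) =>
    Real.exp (τ / d * ((∑ j, w j * boolSign (b j)) ^ 2 - ∑ j, w j ^ 2)))]
  have hb := sum_exp_centered_sq_le (fun j => w j) hw4 (θ := τ / d) (by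
    rw [abs_div, Nat.abs_cast, div_le_iff₀ hd']
    linarith)
  calc _ ≤ ∏ _k : Fin d, (2 ^ Fintype.card J * Real.exp (4096 * (τ / d) ^ 2)) :=
        Finset.prod_le_prod (fun k _ => Finset.sum_nonneg fun b _ => (Real.exp_pos _).le) fun k _ => hb
    _ = _ := by
      rw [Finset.prod_const, Finset.card_univ, Fintype.card_fin, mul_pow, ← Real.exp_nat_mul]
      congr 2
      field_simp

end
end GaussianBL

namespace GaussianBL
open ProbabilityTheory Filter Topology
open scoped ENNReal NNReal

section
variable {J : Type*} [Fintype J]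

lemma two_mul_exp_half_le (p r : ℝ) : 2 * Real.exp ((p + r) / 2) ≤ Real.exp p + Real.exp r := by
  have h1 : Real.exp p = Real.exp (p / 2) ^ 2 := by rw [← Real.exp_nat_mul]; ring_nf
  have h2 : Real.exp r = Real.exp (r / 2) ^ 2 := by rw [← Real.exp_nat_mul]; ring_nf
  rw [h1, h2, add_div, Real.exp_add]
  nlinarith [sq_nonneg (Real.exp (p / 2) - Real.exp (r / 2))]

lemma exists_quadratic_sup [Nonempty J] {D : EuclideanSpace ℝ J → ℝ} (hc : Continuous D)
    (hs : ∀ (t : ℝ) w, D (t • w) = t ^ 2 * D w)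
    (hp : ∀ v u, D (v + u) + D (v - u) = 2 * D v + 2 * D u) :
    ∃ S : ℝ, 0 ≤ S ∧ (∀ w, |D w| ≤ S * ‖w‖ ^ 2) ∧ ∀ τ : ℝ, 0 ≤ τ →
      ENNReal.ofReal (Real.exp (3 / 4 * τ * S)) * volume (ball (0 : EuclideanSpace ℝ J) (1 / 2))
        ≤ ∫⁻ w in ball (0 : EuclideanSpace ℝ J) 2,
          ENNReal.ofReal (Real.exp (τ * D w) + Real.exp (-τ * D w)) := by
  obtain ⟨v, hv, hmax⟩ := (isCompact_sphere (0 : EuclideanSpace ℝ J) 1).exists_isMaxOn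
    (NormedSpace.sphere_nonempty.2 zero_le_one) (f := fun w => |D w|) hc.abs.continuousOn
  have hv1 : ‖v‖ = 1 := by simpa using hv
  have hD0 : D 0 = 0 := by simpa using hs 0 0
  have hbound : ∀ w, |D w| ≤ |D v| * ‖w‖ ^ 2 := by
    intro w
    rcases eq_or_ne w 0 with rfl | hw
    · simp [hD0]
    · have hn : ‖w‖ ≠ 0 := norm_ne_zero_iff.2 hw
      have h1 : ‖w‖⁻¹ • w ∈ sphere (0 : EuclideanSpace ℝ J) 1 := by
        simp [norm_smul, hn]
      have h2 : |D (‖w‖⁻¹ • w)| ≤ |D v| := hmax h1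
      have h3 : D w = ‖w‖ ^ 2 * D (‖w‖⁻¹ • w) := by
        rw [hs]
        field_simp
      rw [h3, abs_mul, abs_of_nonneg (sq_nonneg _), mul_comm]
      gcongr
  refine ⟨|D v|, abs_nonneg _, hbound, fun τ hτ => ?_⟩
  set G : EuclideanSpace ℝ J → ℝ≥0∞ := fun w =>
    ENNReal.ofReal (Real.exp (τ * D w) + Real.exp (-τ * D w)) with hG
  have hGm : Measurable G := by
    have := hc.measurable
    fun_prop
  set e := ENNReal.ofReal (Real.exp (3 / 4 * τ * |D v|)) with he
  have hpt : ∀ u ∈ ball (0 : EuclideanSpace ℝ J) (1 / 2), 2 * e ≤ G (v + u) + G (v - u) := by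
    intro u hu
    have hu' : ‖u‖ ≤ 1 / 2 := by simpa using (mem_ball_zero_iff.1 hu).le
    have hDu : |D u| ≤ |D v| * (1 / 4) := (hbound u).trans (by
      gcongr
      nlinarith [norm_nonneg u])
    have h34 : 3 / 4 * τ * |D v| ≤ |τ * (D v + D u)| := by
      rw [abs_mul, abs_of_nonneg hτ]
      have : |D v| - |D u| ≤ |D v + D u| := by
        simpa using abs_sub_abs_le_abs_sub (D v) (-D u)
      nlinarith
    have e1 := two_mul_exp_half_le (τ * D (v + u)) (τ * D (v - u))
    have e2 := two_mul_exp_half_le (-τ * D (v + u)) (-τ * D (v - u))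
    rw [← mul_add, hp, show τ * (2 * D v + 2 * D u) / 2 = τ * (D v + D u) by ring] at e1
    rw [← mul_add, hp, show -τ * (2 * D v + 2 * D u) / 2 = -(τ * (D v + D u)) by ring] at e2
    have h5 : Real.exp |τ * (D v + D u)|
        ≤ Real.exp (τ * (D v + D u)) + Real.exp (-(τ * (D v + D u))) := by
      rcases abs_cases (τ * (D v + D u)) with h | h <;> rw [h.1]
      · linarith [Real.exp_pos (-(τ * (D v + D u)))]
      · linarith [Real.exp_pos (τ * (D v + D u))]
    have h6 : Real.exp (3 / 4 * τ * |D v|) ≤ Real.exp |τ * (D v + D u)| := Real.exp_le_exp.2 h34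
    have h7 : 2 * e = ENNReal.ofReal (2 * Real.exp (3 / 4 * τ * |D v|)) := by
      rw [ENNReal.ofReal_mul zero_le_two, he]
      simp
    rw [h7, hG, ← ENNReal.ofReal_add (by positivity) (by positivity)]
    exact ENNReal.ofReal_le_ofReal (by linarith)
  have hsub : ball v (1 / 2) ⊆ ball (0 : EuclideanSpace ℝ J) 2 := by
    refine ball_subset_ball' ?_
    rw [dist_zero_right, hv1]
    norm_num
  have hadd : ∫⁻ u in ball (0 : EuclideanSpace ℝ J) (1 / 2), G (v + u) = ∫⁻ w in ball v (1 / 2), G w := by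
    have := (measurePreserving_add_left volume v).setLIntegral_comp_preimage
      (measurableSet_ball (x := v) (ε := 1 / 2)) hGm
    rw [← this]
    congr 2
    ext u
    simp [mem_ball, dist_eq_norm]
  have hsubr : ∫⁻ u in ball (0 : EuclideanSpace ℝ J) (1 / 2), G (v - u) = ∫⁻ w in ball v (1 / 2), G w := by
    have := (Measure.measurePreserving_sub_left volume v).setLIntegral_comp_preimage
      (measurableSet_ball (x := v) (ε := 1 / 2)) hGm
    rw [← this]
    congr 2
    ext u
    simp [mem_ball, dist_eq_norm]
  have h2 : 2 * (e * volume (ball (0 : EuclideanSpace ℝ J) (1 / 2)))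
      ≤ 2 * ∫⁻ w in ball (0 : EuclideanSpace ℝ J) 2, G w := by
    calc _ = ∫⁻ _ in ball (0 : EuclideanSpace ℝ J) (1 / 2), 2 * e := by
          rw [setLIntegral_const, mul_assoc]
      _ ≤ ∫⁻ u in ball (0 : EuclideanSpace ℝ J) (1 / 2), (G (v + u) + G (v - u)) :=
          setLIntegral_mono (by fun_prop) hpt
      _ = 2 * ∫⁻ w in ball v (1 / 2), G w := by
          rw [lintegral_add_left (by fun_prop), hadd, hsubr, two_mul]
      _ ≤ _ := by
          gcongr
  exact (ENNReal.mul_le_mul_iff_right two_ne_zero (by simp)).1 h2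

lemma continuous_signForm {d : ℕ} (b : Fin d → J → Bool) : Continuous (signForm b) := by
  unfold signForm
  fun_prop

lemma signForm_smul {d : ℕ} (b : Fin d → J → Bool) (t : ℝ) (w : EuclideanSpace ℝ J) :
    signForm b (t • w) = t ^ 2 * signForm b w := by
  have h : ∀ k, (∑ j, t * w j * boolSign (b k j)) ^ 2 - ∑ j, (t * w j) ^ 2
      = t ^ 2 * ((∑ j, w j * boolSign (b k j)) ^ 2 - ∑ j, w j ^ 2) := by
    intro k
    have h1 : ∑ j, t * w j * boolSign (b k j) = t * ∑ j, w j * boolSign (b k j) := by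
      simp [Finset.mul_sum, mul_assoc]
    have h2 : ∑ j, (t * w j) ^ 2 = t ^ 2 * ∑ j, w j ^ 2 := by
      simp [Finset.mul_sum, mul_pow]
    rw [h1, h2]
    ring
  simp only [signForm, PiLp.smul_apply, smul_eq_mul]
  simp_rw [h, ← Finset.mul_sum]
  ring

lemma signForm_parallelogram {d : ℕ} (b : Fin d → J → Bool) (v u : EuclideanSpace ℝ J) :
    signForm b (v + u) + signForm b (v - u) = 2 * signForm b v + 2 * signForm b u := by
  simp only [signForm, PiLp.add_apply, PiLp.sub_apply]
  rw [← mul_add, mul_left_comm 2, mul_left_comm 2, ← mul_add, ← Finset.sum_add_distrib]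
  congr 1
  rw [Finset.mul_sum, Finset.mul_sum, ← Finset.sum_add_distrib]
  refine Finset.sum_congr rfl fun k _ => ?_
  have h1 : ∑ j, (v j + u j) ^ 2 + ∑ j, (v j - u j) ^ 2 = 2 * ∑ j, v j ^ 2 + 2 * ∑ j, u j ^ 2 := by
    simp_rw [Finset.mul_sum, ← Finset.sum_add_distrib]
    exact Finset.sum_congr rfl fun j _ => by ring
  simp_rw [add_mul, sub_mul, Finset.sum_add_distrib, Finset.sum_sub_distrib]
  linarith

/-- Exponential moments of the operator norm of the off-diagonal Gram matrix of random sign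
vectors. -/
theorem exists_signForm_sup [DecidableEq J] [Nonempty J] (d : ℕ) {τ : ℝ} (hτ0 : 0 ≤ τ)
    (hτ : 32 * τ ≤ d) :
    ∃ S : (Fin d → J → Bool) → ℝ, (∀ b, 0 ≤ S b) ∧ (∀ b w, |signForm b w| ≤ S b * ‖w‖ ^ 2) ∧
      ∑ b, Real.exp (3 / 4 * τ * S b)
        ≤ (2 ^ Fintype.card J) ^ d * (2 * 4 ^ Fintype.card J * Real.exp (4096 * τ ^ 2 / d)) := by
  choose S hS0 hS hSint using fun b : Fin d → J → Bool =>
    exists_quadratic_sup (continuous_signForm b) (signForm_smul b) (signForm_parallelogram b)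
  refine ⟨S, hS0, hS, ?_⟩
  set V := volume (ball (0 : EuclideanSpace ℝ J) (1 / 2)) with hV
  have hV0 : V ≠ 0 := (measure_ball_pos volume _ (by norm_num)).ne'
  have hVt : V ≠ ⊤ := measure_ball_lt_top.ne
  have hV2 : volume (ball (0 : EuclideanSpace ℝ J) 2) = 4 ^ Fintype.card J * V := by
    have := Measure.addHaar_ball_mul_of_pos (volume : Measure (EuclideanSpace ℝ J)) 0
      (r := 4) (by norm_num) (1 / 2)
    rw [show (4 : ℝ) * (1 / 2) = 2 by norm_num] at this
    rw [this, finrank_euclideanSpace, ENNReal.ofReal_pow (by norm_num)]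
    simp [hV]
  set M := (2 ^ Fintype.card J) ^ d * Real.exp (4096 * τ ^ 2 / d) with hM
  have habs : |τ| = τ := abs_of_nonneg hτ0
  have hpt : ∀ w ∈ ball (0 : EuclideanSpace ℝ J) 2,
      ∑ b : Fin d → J → Bool, ENNReal.ofReal (Real.exp (τ * signForm b w)
        + Real.exp (-τ * signForm b w)) ≤ ENNReal.ofReal (2 * M) := by
    intro w hw
    have hw2 : ‖w‖ ≤ 2 := (mem_ball_zero_iff.1 hw).le
    rw [← ENNReal.ofReal_sum_of_nonneg fun b _ => by positivity, Finset.sum_add_distrib, two_mul]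
    refine ENNReal.ofReal_le_ofReal (add_le_add (sum_exp_signForm_le w hw2 (by rwa [habs])) ?_)
    have := sum_exp_signForm_le (d := d) w hw2 (τ := -τ) (by rwa [abs_neg, habs])
    rwa [neg_sq] at this
  have hmain : ENNReal.ofReal (∑ b, Real.exp (3 / 4 * τ * S b)) * V
      ≤ ENNReal.ofReal (2 * M * 4 ^ Fintype.card J) * V := by
    calc _ = ∑ b, ENNReal.ofReal (Real.exp (3 / 4 * τ * S b)) * V := by
          rw [ENNReal.ofReal_sum_of_nonneg fun b _ => by positivity, Finset.sum_mul]
      _ ≤ ∑ b, ∫⁻ w in ball (0 : EuclideanSpace ℝ J) 2,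
          ENNReal.ofReal (Real.exp (τ * signForm b w) + Real.exp (-τ * signForm b w)) :=
          Finset.sum_le_sum fun b _ => hSint b τ hτ0
      _ = ∫⁻ w in ball (0 : EuclideanSpace ℝ J) 2, ∑ b,
          ENNReal.ofReal (Real.exp (τ * signForm b w) + Real.exp (-τ * signForm b w)) := by
          refine (lintegral_finsetSum _ fun b _ => ?_).symm
          have := (continuous_signForm b).measurable
          fun_prop
      _ ≤ ∫⁻ _ in ball (0 : EuclideanSpace ℝ J) 2, ENNReal.ofReal (2 * M) :=
          setLIntegral_mono measurable_const hpt
      _ = _ := by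
          rw [setLIntegral_const, hV2, ENNReal.ofReal_mul (by positivity) (q := 4 ^ _),
            ENNReal.ofReal_pow (by norm_num), mul_assoc]
          simp
  have := (ENNReal.ofReal_le_ofReal_iff (by positivity)).1
    ((ENNReal.mul_le_mul_iff_left hV0 hVt).1 hmain)
  refine this.trans (le_of_eq ?_)
  rw [hM]
  ring

end
end GaussianBL

namespace GaussianBL
open ProbabilityTheory Filter Topology
open scoped ENNReal NNReal

section
variable {n d : ℕ}

/-- The unit vectors whose coordinates are all `±1 / √d`. -/
noncomputable def signVec (b : Fin d → Bool) : EuclideanSpace ℝ (Fin d) :=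
  WithLp.toLp 2 fun k => (√(d : ℝ))⁻¹ * boolSign (b k)

lemma norm_sum_smul_signVec_sq {J : Type*} [Fintype J] (hd : 0 < d) (p : J → Fin d → Bool)
    (t : J → ℝ) :
    ‖∑ j, t j • signVec (p j)‖ ^ 2 - ∑ j, t j ^ 2
      = signForm (fun k j => p j k) (WithLp.toLp 2 t) := by
  have hd' : (0 : ℝ) < d := by exact_mod_cast hd
  have h : ∀ k, (∑ j, t j * ((√(d : ℝ))⁻¹ * boolSign (p j k))) ^ 2
      = (d : ℝ)⁻¹ * (∑ j, t j * boolSign (p j k)) ^ 2 := by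
    intro k
    simp_rw [mul_left_comm (t _), ← Finset.mul_sum, mul_pow, inv_pow, Real.sq_sqrt hd'.le]
  rw [EuclideanSpace.real_norm_sq_eq]
  simp only [signVec, signForm, WithLp.ofLp_sum, WithLp.ofLp_smul, Finset.sum_apply, Pi.smul_apply,
    smul_eq_mul, h, ← Finset.mul_sum, Finset.sum_sub_distrib, Finset.sum_const, Finset.card_univ,
    Fintype.card_fin, nsmul_eq_mul]
  field_simp

lemma norm_signVec (hd : 0 < d) (b : Fin d → Bool) : ‖signVec b‖ = 1 := by
  have h := norm_sum_smul_signVec_sq (J := Unit) hd (fun _ => b) fun _ => 1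
  simp [signForm, sq (boolSign _), boolSign_sq] at h
  rw [← pow_eq_one_iff_of_nonneg (norm_nonneg _) two_ne_zero]
  linarith

/-- The average of an indicator over the images of the sign vectors. -/
noncomputable def signAvg (A : Set (Fin n → ℝ)) (Γ : Fin n → EuclideanSpace ℝ (Fin d)) : ℝ :=
  (2 ^ d)⁻¹ * ∑ b : Fin d → Bool, A.indicator (fun _ => 1) fun l => inner ℝ (signVec b) (Γ l)

lemma exp_sub_one_rpow_le {a ε S : ℝ} (ha : 1 ≤ a) (hε0 : 0 < ε) (hε1 : ε ≤ 1) (hS : 0 ≤ S) :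
    Real.exp (2 * a * (S + ε / (4 * a))) - 1 ≤ ε * Real.exp (4 * a * S / ε) := by
  set y := 2 * a * S / ε + 1 / 2 with hy
  have hy0 : 0 ≤ y := by positivity
  have hx : 2 * a * (S + ε / (4 * a)) = ε * y := by
    rw [hy]
    field_simp
    ring
  have h1 : Real.exp (ε * y) - 1 ≤ ε * y * Real.exp (ε * y) := by
    have h := Real.add_one_le_exp (-(ε * y))
    have h2 : Real.exp (-(ε * y)) * Real.exp (ε * y) = 1 := by rw [← Real.exp_add]; simp
    nlinarith [Real.exp_pos (ε * y)]
  have h2 : Real.exp (ε * y) ≤ Real.exp y := Real.exp_le_exp.2 (by nlinarith)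
  have h3 : y ≤ Real.exp (y - 1) := by linarith [Real.add_one_le_exp (y - 1)]
  calc _ ≤ ε * y * Real.exp (ε * y) := hx ▸ h1
    _ ≤ ε * Real.exp (y - 1) * Real.exp y := by gcongr
    _ = _ := by
      rw [mul_assoc, ← Real.exp_add, hy]
      congr 2
      field_simp
      ring

lemma exp_two_mul_le {a ε S : ℝ} (ha : 1 ≤ a) (hε0 : 0 < ε) (hε1 : ε ≤ 1) (hS : 3 / 4 ≤ S) :
    Real.exp (2 * a) ≤ ε * Real.exp (4 * a * S / ε) := by
  have h1 : ε⁻¹ ≤ Real.exp (ε⁻¹ - 1) := by linarith [Real.add_one_le_exp (ε⁻¹ - 1)]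
  have h2 : 1 ≤ ε⁻¹ := (one_le_inv₀ hε0).2 hε1
  have h3 : 4 * a * S / ε = 4 * a * S * ε⁻¹ := div_eq_mul_inv _ _
  have h4 : 2 * a ≤ 4 * a * S / ε - (ε⁻¹ - 1) := by
    rw [h3]
    have : 3 * a ≤ 4 * a * S := by nlinarith
    have : 3 * a * ε⁻¹ ≤ 4 * a * S * ε⁻¹ := by gcongr
    nlinarith
  calc _ ≤ Real.exp (4 * a * S / ε - (ε⁻¹ - 1)) := Real.exp_le_exp.2 h4
    _ = (Real.exp (ε⁻¹ - 1))⁻¹ * Real.exp (4 * a * S / ε) := by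
      rw [sub_eq_add_neg, Real.exp_add, Real.exp_neg, mul_comm]
    _ ≤ _ := by
      gcongr
      rw [inv_le_comm₀ (Real.exp_pos _) hε0]
      exact h1

lemma abs_integral_prod_signVec_le {A : Set (Fin n → ℝ)} (hA : MeasurableSet A) {a ε S : ℝ}
    (ha : 1 ≤ a) (hA' : Real.exp (-a) ≤ (gaussPi n).real A) (hε0 : 0 < ε) (hε1 : ε ≤ 1)
    (hd : 0 < d) {q : ℕ} (p : Fin q → Fin d → Bool) (hS : 0 ≤ S)
    (hSp : ∀ w, |signForm (fun k j => p j k) w| ≤ S * ‖w‖ ^ 2) :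
    |∫ Γ, ∏ j, centeredInd A (fun l => inner ℝ (signVec (p j)) (Γ l))
        ∂(Measure.pi fun _ : Fin n => stdGaussian (EuclideanSpace ℝ (Fin d)))|
      ≤ ε ^ ((q : ℝ) / 2) * Real.exp (2 * a * q / ε * S) := by
  have hR : ε ^ ((q : ℝ) / 2) * Real.exp (2 * a * q / ε * S)
      = (ε * Real.exp (4 * a * S / ε)) ^ ((q : ℝ) / 2) := by
    rw [Real.mul_rpow hε0.le (Real.exp_pos _).le, ← Real.exp_mul]
    congr 2
    ring
  rw [hR]
  have hsmall : 0 < ε / (4 * a) := by positivity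
  rcases le_or_gt (S + ε / (4 * a)) 1 with h | h
  · have := abs_integral_prod_centeredInd_le hA hA' (v := fun j => signVec (p j))
      (fun j => norm_signVec hd _) (s := S + ε / (4 * a)) (by linarith) h fun t => by
        rw [norm_sum_smul_signVec_sq hd]
        refine (hSp _).trans ?_
        rw [EuclideanSpace.real_norm_sq_eq]
        gcongr
        linarith
    rw [Fintype.card_fin] at this
    refine this.trans (Real.rpow_le_rpow ?_ (exp_sub_one_rpow_le ha hε0 hε1 hS) (by positivity))
    rw [sub_nonneg]
    exact Real.one_le_exp (by positivity)
  · have h34 : 3 / 4 ≤ S := by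
      have : ε / (4 * a) ≤ 1 / 4 := by
        rw [div_le_div_iff₀ (by linarith) (by norm_num)]
        linarith
      linarith
    have h0 : 0 < (gaussPi n).real A := (Real.exp_pos _).trans_le hA'
    have hb : ∀ x, |centeredInd A x| ≤ Real.exp a := fun x =>
      (abs_centeredInd_le h0 x).trans (by
        rw [inv_le_comm₀ h0 (Real.exp_pos _), ← Real.exp_neg]
        exact hA')
    calc _ ≤ Real.exp a ^ q := by
          have := norm_integral_le_of_norm_le_const
            (μ := Measure.pi fun _ : Fin n => stdGaussian (EuclideanSpace ℝ (Fin d)))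
            (f := fun Γ => ∏ j, centeredInd A (fun l => inner ℝ (signVec (p j)) (Γ l)))
            (C := Real.exp a ^ q) (.of_forall fun Γ => by
              rw [Real.norm_eq_abs, Finset.abs_prod]
              calc _ ≤ ∏ _j : Fin q, Real.exp a :=
                    Finset.prod_le_prod (fun _ _ => abs_nonneg _) fun _ _ => hb _
                _ = _ := by simp)
          simpa using this
      _ = Real.exp (2 * a) ^ ((q : ℝ) / 2) := by
          rw [← Real.exp_mul, ← Real.exp_nat_mul]
          congr 1
          ring
      _ ≤ _ := Real.rpow_le_rpow (Real.exp_pos _).le (exp_two_mul_le ha hε0 hε1 h34) (by positivity)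

/-- High moments of the average of a set over a random Gaussian copy of the sign vectors. -/
theorem integral_signAvg_sub_one_pow_le {A : Set (Fin n → ℝ)} (hA : MeasurableSet A) {a ε : ℝ}
    (ha : 1 ≤ a) (hA' : Real.exp (-a) ≤ (gaussPi n).real A) (hε0 : 0 < ε) (hε1 : ε ≤ 1)
    {q : ℕ} (hq : 0 < q) (hd : 4096 * (8 / 3 * a * q / ε) ^ 2 ≤ q * d) :
    ∫ Γ, (signAvg A Γ / (gaussPi n).real A - 1) ^ q
        ∂(Measure.pi fun _ : Fin n => stdGaussian (EuclideanSpace ℝ (Fin d)))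
      ≤ 2 * (4 * Real.exp 1) ^ q * ε ^ ((q : ℝ) / 2) := by
  set μ := (gaussPi n).real A with hμ
  have hμ0 : 0 < μ := (Real.exp_pos _).trans_le hA'
  set P := Measure.pi fun _ : Fin n => stdGaussian (EuclideanSpace ℝ (Fin d)) with hP
  set τ := 8 / 3 * a * q / ε with hτ
  have hq' : (0 : ℝ) < q := by exact_mod_cast hq
  have hτ0 : 0 < τ := by positivity
  have hτq : q ≤ τ := by
    rw [hτ, le_div_iff₀ hε0]
    nlinarith [mul_le_mul hε1 ha zero_le_one zero_le_one]
  have hd0 : (0 : ℝ) < d := by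
    by_contra! h
    nlinarith [mul_nonneg hq'.le (neg_nonneg.2 h), sq_pos_of_pos hτ0]
  have hdn : 0 < d := by exact_mod_cast hd0
  have h32 : 32 * τ ≤ d := by
    have : q * (32 * τ) ≤ q * d := by nlinarith
    exact le_of_mul_le_mul_left this hq'
  have : Nonempty (Fin q) := ⟨⟨0, hq⟩⟩
  obtain ⟨S, hS0, hS, hSum⟩ := exists_signForm_sup (J := Fin q) d hτ0.le h32
  have hg : ∀ b : Fin d → Bool, Measurable fun Γ : Fin n → EuclideanSpace ℝ (Fin d) =>
      centeredInd A fun l => inner ℝ (signVec b) (Γ l) := fun b =>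
    (measurable_centeredInd hA).comp (by fun_prop)
  have hexp : ∀ Γ : Fin n → EuclideanSpace ℝ (Fin d), (signAvg A Γ / μ - 1) ^ q
      = ((2 ^ d) ^ q)⁻¹ * ∑ p : Fin q → Fin d → Bool,
        ∏ j, centeredInd A (fun l => inner ℝ (signVec (p j)) (Γ l)) := by
    intro Γ
    rw [← Fintype.sum_pow (fun b => centeredInd A fun l => inner ℝ (signVec b) (Γ l)), ← inv_pow, ← mul_pow]
    congr 1
    simp only [centeredInd, Finset.sum_sub_distrib, signAvg, ← Finset.sum_div, ← hμ]
    simp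
    field_simp
  have hint : ∀ p : Fin q → Fin d → Bool, Integrable (fun Γ : Fin n → EuclideanSpace ℝ (Fin d) =>
      ∏ j, centeredInd A (fun l => inner ℝ (signVec (p j)) (Γ l))) P := fun p =>
    Integrable.of_bound (C := μ⁻¹ ^ q)
      (Finset.measurable_fun_prod _ fun j _ => hg (p j)).aestronglyMeasurable
      (.of_forall fun Γ => by
        rw [Real.norm_eq_abs, Finset.abs_prod]
        calc _ ≤ ∏ _j : Fin q, μ⁻¹ :=
              Finset.prod_le_prod (fun _ _ => abs_nonneg _) fun _ _ => abs_centeredInd_le hμ0 _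
          _ = _ := by simp)
  simp_rw [hexp]
  rw [integral_const_mul, integral_finsetSum _ fun p _ => hint p]
  have hsum2 : ∑ p : Fin q → Fin d → Bool, Real.exp (2 * a * q / ε * S fun k j => p j k)
      = ∑ b, Real.exp (3 / 4 * τ * S b) := by
    refine Fintype.sum_equiv (Equiv.piComm fun _ _ => Bool) _ _ fun p => ?_
    rw [hτ]
    congr 2
    ring
  calc _ ≤ ((2 ^ d) ^ q)⁻¹ * ∑ p : Fin q → Fin d → Bool,
        ε ^ ((q : ℝ) / 2) * Real.exp (2 * a * q / ε * S fun k j => p j k) := by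
        gcongr with p
        exact (le_abs_self _).trans
          (abs_integral_prod_signVec_le hA ha hA' hε0 hε1 hdn p (hS0 _) (hS _))
    _ ≤ ((2 ^ d) ^ q)⁻¹ * (ε ^ ((q : ℝ) / 2) *
        ((2 ^ q) ^ d * (2 * 4 ^ q * Real.exp q))) := by
        rw [← Finset.mul_sum, hsum2]
        rw [Fintype.card_fin] at hSum
        gcongr
        refine hSum.trans ?_
        gcongr
        rwa [div_le_iff₀ hd0]
    _ = _ := by
        rw [← pow_mul, ← pow_mul, mul_comm q d, mul_pow, ← Real.exp_nat_mul, mul_one]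
        field_simp

end
end GaussianBL

namespace GaussianBL
open ProbabilityTheory Filter Topology
open scoped ENNReal NNReal

section
variable {n : ℕ}

instance : CompactSpace (Matrix.unitaryGroup (Fin n) ℝ) := by
  refine (isCompact_iff_compactSpace (s := {U | U ∈ Matrix.unitaryGroup (Fin n) ℝ})).1 ?_
  have hK : IsCompact (Set.univ.pi fun _ : Fin n => Set.univ.pi fun _ : Fin n =>
      Set.Icc (-1 : ℝ) 1) :=
    isCompact_univ_pi fun _ => isCompact_univ_pi fun _ => isCompact_Icc
  refine hK.of_isClosed_subset (isClosed_unitary (R := Matrix (Fin n) (Fin n) ℝ)) ?_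
  intro U hU i _ j _
  exact abs_le.1 (entry_norm_bound_of_unitary hU i j)

instance : SecondCountableTopology (Matrix.unitaryGroup (Fin n) ℝ) :=
  haveI : SecondCountableTopology (Matrix (Fin n) (Fin n) ℝ) :=
    inferInstanceAs (SecondCountableTopology (Fin n → Fin n → ℝ))
  TopologicalSpace.Subtype.secondCountableTopology
    {U | U ∈ Matrix.unitaryGroup (Fin n) ℝ}

instance : MeasurableSpace (Matrix.unitaryGroup (Fin n) ℝ) := borel _

instance : BorelSpace (Matrix.unitaryGroup (Fin n) ℝ) := ⟨rfl⟩

/-- A right-invariant probability measure on the orthogonal group. -/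
noncomputable def orthoHaar (n : ℕ) : Measure (Matrix.unitaryGroup (Fin n) ℝ) :=
  (Measure.haarMeasure ⊤).inv

instance : IsProbabilityMeasure (orthoHaar n) := by
  constructor
  rw [orthoHaar, Measure.inv_apply, Set.inv_univ]
  exact Measure.haarMeasure_self

instance : (orthoHaar n).IsMulRightInvariant := by
  unfold orthoHaar
  infer_instance

/-- The action of the orthogonal group on Euclidean space. -/
noncomputable def orthoIso (U : Matrix.unitaryGroup (Fin n) ℝ) :
    EuclideanSpace ℝ (Fin n) →ₗᵢ[ℝ] EuclideanSpace ℝ (Fin n) where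
  toLinearMap := Matrix.toEuclideanLin U.1
  norm_map' x := by
    have hU : U.1.transpose * U.1 = 1 := by
      have := Matrix.mem_unitaryGroup_iff'.1 U.2
      rwa [Matrix.star_eq_conjTranspose, Matrix.conjTranspose_eq_transpose_of_trivial] at this
    rw [← sq_eq_sq₀ (norm_nonneg _) (norm_nonneg _), ← real_inner_self_eq_norm_sq,
      ← real_inner_self_eq_norm_sq]
    simp only [EuclideanSpace.inner_eq_star_dotProduct, star_trivial, Matrix.ofLp_toLpLin,
      Matrix.toLin'_apply]
    rw [Matrix.dotProduct_mulVec, Matrix.vecMul_mulVec, hU, Matrix.vecMul_one]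

lemma orthoIso_ofLp (U : Matrix.unitaryGroup (Fin n) ℝ) (x : EuclideanSpace ℝ (Fin n)) :
    (orthoIso U x).ofLp = U.1.mulVec x.ofLp := rfl

lemma orthoIso_mul (U V : Matrix.unitaryGroup (Fin n) ℝ) (x : EuclideanSpace ℝ (Fin n)) :
    orthoIso (U * V) x = orthoIso U (orthoIso V x) := by
  apply WithLp.ofLp_injective
  simp [orthoIso_ofLp]

lemma exists_orthoIso_eq (V : EuclideanSpace ℝ (Fin n) ≃ₗᵢ[ℝ] EuclideanSpace ℝ (Fin n)) :
    ∃ U : Matrix.unitaryGroup (Fin n) ℝ, ∀ x, orthoIso U x = V x := by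
  let b := EuclideanSpace.basisFun (Fin n) ℝ
  refine ⟨⟨_, V.toMatrix_mem_unitaryGroup b b⟩, fun x => ?_⟩
  apply WithLp.ofLp_injective
  have := LinearMap.toMatrix_mulVec_repr b.toBasis b.toBasis V.toLinearEquiv.toLinearMap x
  rw [orthoIso_ofLp]
  have hx : ⇑(b.toBasis.repr x) = x.ofLp := by ext i; simp [b]
  rw [hx] at this
  refine this.trans ?_
  ext i
  simp [b]

lemma measurable_orthoIso :
    Measurable fun p : Matrix.unitaryGroup (Fin n) ℝ × EuclideanSpace ℝ (Fin n) =>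
      orthoIso p.1 p.2 := by
  have h : Continuous fun p : Matrix.unitaryGroup (Fin n) ℝ × EuclideanSpace ℝ (Fin n) =>
      orthoIso p.1 p.2 := by
    refine (PiLp.continuous_toLp 2 _).comp (continuous_pi fun i => ?_)
    change Continuous fun p : Matrix.unitaryGroup (Fin n) ℝ × EuclideanSpace ℝ (Fin n) =>
      ∑ j, p.1.1 i j * p.2 j
    refine continuous_finsetSum _ fun j _ => ?_
    have : Continuous fun U : Matrix.unitaryGroup (Fin n) ℝ => U.1 i j :=
      continuous_subtype_val.matrix_elem i j
    exact (this.comp continuous_fst).mul (by fun_prop)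
  exact h.measurable

lemma _root_.Measurable.orthoIso {Ω : Type*} [MeasurableSpace Ω]
    {f : Ω → Matrix.unitaryGroup (Fin n) ℝ} {g : Ω → EuclideanSpace ℝ (Fin n)} (hf : Measurable f)
    (hg : Measurable g) : Measurable fun ω => GaussianBL.orthoIso (f ω) (g ω) :=
  Measurable.comp (g := fun p : Matrix.unitaryGroup (Fin n) ℝ × EuclideanSpace ℝ (Fin n) =>
    GaussianBL.orthoIso p.1 p.2) (f := fun ω => (f ω, g ω)) measurable_orthoIso (hf.prodMk hg)

attribute [irreducible] orthoIso

lemma exists_orthoIso_comp_eq {d : ℕ}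
    (e e' : EuclideanSpace ℝ (Fin d) →ₗᵢ[ℝ] EuclideanSpace ℝ (Fin n)) :
    ∃ U : Matrix.unitaryGroup (Fin n) ℝ, ∀ x, orthoIso U (e x) = e' x := by
  let L := e'.comp e.equivRange.symm.toLinearIsometry
  obtain ⟨U, hU⟩ := exists_orthoIso_eq (L.extend.toLinearIsometryEquiv rfl)
  refine ⟨U, fun x => ?_⟩
  rw [hU]
  have := L.extend_apply (e.equivRange x)
  simpa [L] using this

lemma exists_linearIsometry {d : ℕ} (h : d ≤ n) :
    Nonempty (EuclideanSpace ℝ (Fin d) →ₗᵢ[ℝ] EuclideanSpace ℝ (Fin n)) := by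
  let b := EuclideanSpace.basisFun (Fin d) ℝ
  let b' := EuclideanSpace.basisFun (Fin n) ℝ
  refine ⟨(b.toBasis.constr ℝ (b' ∘ Fin.castLE h)).isometryOfOrthonormal (v := b.toBasis)
    (by simp) ?_⟩
  have : ⇑(b.toBasis.constr ℝ (b' ∘ Fin.castLE h)) ∘ ⇑b.toBasis = b' ∘ Fin.castLE h := by
    ext1 i
    simp only [Function.comp, Module.Basis.constr_basis]
  rw [this]
  exact b'.orthonormal.comp _ (Fin.castLE_injective h)

/-- A linear map of small rank factors through a given linear isometry, up to rotation. -/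
lemma exists_orthoIso_factor {d : ℕ}
    (e : EuclideanSpace ℝ (Fin d) →ₗᵢ[ℝ] EuclideanSpace ℝ (Fin n))
    (M : EuclideanSpace ℝ (Fin d) →ₗ[ℝ] EuclideanSpace ℝ (Fin n)) :
    ∃ (U : Matrix.unitaryGroup (Fin n) ℝ) (L : EuclideanSpace ℝ (Fin d) → EuclideanSpace ℝ (Fin d)),
      ∀ x, M x = orthoIso U (e (L x)) := by
  have hr : Module.finrank ℝ (LinearMap.range M) ≤ d := by
    simpa using LinearMap.finrank_range_le M
  obtain ⟨i⟩ := exists_linearIsometry hr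
  let f : LinearMap.range M →ₗᵢ[ℝ] EuclideanSpace ℝ (Fin d) :=
    i.comp (stdOrthonormalBasis ℝ (LinearMap.range M)).repr.toLinearIsometry
  let V := (e.comp f).extend.toLinearIsometryEquiv rfl
  obtain ⟨U, hU⟩ := exists_orthoIso_eq V.symm
  refine ⟨U, fun x => f ⟨M x, x, rfl⟩, fun x => ?_⟩
  rw [hU, LinearIsometryEquiv.eq_symm_apply]
  exact (e.comp f).extend_apply ⟨M x, x, rfl⟩

end
end GaussianBL

namespace GaussianBL
open ProbabilityTheory Filter Topology
open scoped ENNReal NNReal Pointwise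

section
variable {n k : ℕ}

lemma orthoHaar_orthoIso_eq {x y : EuclideanSpace ℝ (Fin k)} (hx : x ≠ 0) (hy : y ≠ 0)
    {C : Set (EuclideanSpace ℝ (Fin k))} (hC : ∀ t : ℝ, 0 < t → ∀ x, t • x ∈ C ↔ x ∈ C) :
    orthoHaar k {R | orthoIso R x ∈ C} = orthoHaar k {R | orthoIso R y ∈ C} := by
  have hx' := norm_pos_iff.2 hx
  have hy' := norm_pos_iff.2 hy
  set t := ‖x‖ / ‖y‖ with ht
  have ht0 : 0 < t := by positivity
  have hn : ‖t • y‖ = ‖x‖ := by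
    rw [norm_smul, Real.norm_of_nonneg ht0.le, ht, div_mul_cancel₀ _ hy'.ne']
  obtain ⟨V, hV⟩ := exists_orthoIso_eq (ℝ ∙ (t • y - x))ᗮ.reflection
  have h : ∀ R, orthoIso (R * V) y ∈ C ↔ orthoIso R x ∈ C := fun R => by
    rw [← hC t ht0, orthoIso_mul, ← map_smul, ← map_smul, hV, Submodule.reflection_sub hn]
  rw [← measure_preimage_mul_right (orthoHaar k) V {R | orthoIso R y ∈ C}]
  congr 1
  ext R
  exact (h R).symm

lemma measurableSet_orthoIso (x : EuclideanSpace ℝ (Fin k)) {C : Set (EuclideanSpace ℝ (Fin k))}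
    (hC : MeasurableSet C) : MeasurableSet {R | orthoIso R x ∈ C} :=
  measurable_orthoIso.comp (measurable_id.prodMk measurable_const) hC

/-- A random rotation of a nonzero vector meets a cone with the probability given by any
rotation-invariant measure. -/
lemma orthoHaar_orthoIso_mem_cone {P : Measure (EuclideanSpace ℝ (Fin k))} [IsProbabilityMeasure P]
    (hP : ∀ U, P.map (orthoIso U) = P) (h0 : P {0} = 0) {C : Set (EuclideanSpace ℝ (Fin k))}
    (hCm : MeasurableSet C) (hC : ∀ t : ℝ, 0 < t → ∀ x, t • x ∈ C ↔ x ∈ C)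
    {x : EuclideanSpace ℝ (Fin k)} (hx : x ≠ 0) :
    orthoHaar k {R | orthoIso R x ∈ C} = P C := by
  have hm : Measurable fun p : Matrix.unitaryGroup (Fin k) ℝ × EuclideanSpace ℝ (Fin k) =>
      C.indicator (1 : EuclideanSpace ℝ (Fin k) → ℝ≥0∞) (orthoIso p.1 p.2) :=
    (measurable_one.indicator hCm).comp measurable_orthoIso
  calc orthoHaar k {R | orthoIso R x ∈ C}
      = ∫⁻ _, orthoHaar k {R | orthoIso R x ∈ C} ∂P := by simp
    _ = ∫⁻ y, ∫⁻ R, C.indicator 1 (orthoIso R y) ∂orthoHaar k ∂P := by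
      have hae : ∀ᵐ y ∂P, y ≠ 0 := by simpa [ae_iff] using h0
      refine lintegral_congr_ae ?_
      filter_upwards [hae] with y hy
      rw [orthoHaar_orthoIso_eq hx hy hC, ← lintegral_indicator_one (measurableSet_orthoIso y hCm)]
      rfl
    _ = ∫⁻ R, ∫⁻ y, C.indicator 1 (orthoIso R y) ∂P ∂orthoHaar k :=
      lintegral_lintegral_swap (hm.comp measurable_swap).aemeasurable
    _ = ∫⁻ _, P C ∂orthoHaar k := by
      refine lintegral_congr fun R => ?_
      rw [← lintegral_map (measurable_one.indicator hCm) (orthoIso R).continuous.measurable, hP,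
        lintegral_indicator_one hCm]
    _ = _ := by simp

/-- The open cone over a subset of the sphere. -/
def coneSet (A : Set (sphere (0 : EuclideanSpace ℝ (Fin n)) 1)) : Set (EuclideanSpace ℝ (Fin n)) :=
  {x | x ≠ 0 ∧ ‖x‖⁻¹ • x ∈ Subtype.val '' A}

lemma measurableSet_coneSet {A : Set (sphere (0 : EuclideanSpace ℝ (Fin n)) 1)}
    (hA : MeasurableSet A) : MeasurableSet (coneSet A) := by
  have h := MeasurableSet.subtype_image (isClosed_sphere.measurableSet) hA
  have hm : Measurable fun x : EuclideanSpace ℝ (Fin n) => ‖x‖⁻¹ • x := by fun_prop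
  exact (measurableSet_singleton 0).compl.inter (hm h)

lemma smul_mem_coneSet (A : Set (sphere (0 : EuclideanSpace ℝ (Fin n)) 1)) (t : ℝ) (ht : 0 < t)
    (x : EuclideanSpace ℝ (Fin n)) : t • x ∈ coneSet A ↔ x ∈ coneSet A := by
  have h : ‖t • x‖⁻¹ • t • x = ‖x‖⁻¹ • x := by
    rw [norm_smul, Real.norm_of_nonneg ht.le, smul_smul, mul_inv]
    congr 1
    field_simp
  simp only [coneSet, Set.mem_ofPred_eq, h, ne_eq, smul_eq_zero, ht.ne', false_or]

lemma mem_coneSet_sphereMap (e : EuclideanSpace ℝ (Fin k) →ₗᵢ[ℝ] EuclideanSpace ℝ (Fin n))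
    (A : Set (sphere (0 : EuclideanSpace ℝ (Fin n)) 1)) (x : EuclideanSpace ℝ (Fin k)) :
    x ∈ coneSet {ω | sphereMap e ω ∈ A} ↔ e x ∈ coneSet A := by
  simp only [coneSet, Set.mem_ofPred_eq, Set.mem_image, Subtype.exists, exists_and_right,
    exists_eq_right, sphereMap, map_smul, e.norm_map]
  refine and_congr (not_congr (map_eq_zero_iff e e.injective).symm)
    ⟨fun ⟨h, h'⟩ => ⟨?_, h'⟩, fun ⟨h, h'⟩ => ⟨?_, h'⟩⟩
  all_goals
    rw [mem_sphere_zero_iff_norm] at h ⊢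
    simpa [norm_smul] using h

lemma coneSet_inter_ball (S : Set (sphere (0 : EuclideanSpace ℝ (Fin k)) 1)) :
    coneSet S ∩ ball 0 1 = Set.Ioo (0 : ℝ) 1 • Subtype.val '' S := by
  ext x
  simp only [coneSet, Set.mem_inter_iff, Set.mem_ofPred_eq, mem_ball_zero_iff, Set.mem_smul]
  constructor
  · rintro ⟨⟨hx, hS⟩, h1⟩
    have hx' := norm_pos_iff.2 hx
    exact ⟨‖x‖, ⟨hx', h1⟩, _, hS, by rw [smul_smul, mul_inv_cancel₀ hx'.ne', one_smul]⟩
  · rintro ⟨t, ⟨ht0, ht1⟩, y, ⟨z, hz, rfl⟩, rfl⟩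
    have hz1 : ‖(z : EuclideanSpace ℝ (Fin k))‖ = 1 := mem_sphere_zero_iff_norm.1 z.2
    have hz0 : (z : EuclideanSpace ℝ (Fin k)) ≠ 0 := norm_ne_zero_iff.1 (by simp [hz1])
    have hn : ‖t • (z : EuclideanSpace ℝ (Fin k))‖ = t := by
      rw [norm_smul, hz1, mul_one, Real.norm_of_nonneg ht0.le]
    refine ⟨⟨smul_ne_zero ht0.ne' hz0, ?_⟩, by rwa [hn]⟩
    rw [hn, smul_smul, inv_mul_cancel₀ ht0.ne', one_smul]
    exact ⟨z, hz, rfl⟩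

lemma uSphere_apply (hk : 0 < k) {S : Set (sphere (0 : EuclideanSpace ℝ (Fin k)) 1)}
    (hS : MeasurableSet S) :
    uSphere k S = (volume (ball (0 : EuclideanSpace ℝ (Fin k)) 1))⁻¹
      * volume (coneSet S ∩ ball 0 1) := by
  have hk' : (k : ℝ≥0∞) ≠ 0 := by simpa using hk.ne'
  have : Nontrivial (EuclideanSpace ℝ (Fin k)) :=
    Module.nontrivial_of_finrank_pos (R := ℝ) (by simpa using hk)
  rw [uSphere, Measure.smul_apply, smul_eq_mul, Measure.toSphere_apply_univ,
    Measure.toSphere_apply' _ hS, ← coneSet_inter_ball, finrank_euclideanSpace, Fintype.card_fin,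
    ENNReal.mul_inv (.inl hk') (.inl (by simp))]
  rw [mul_mul_mul_comm, ENNReal.inv_mul_cancel hk' (by simp), one_mul]

lemma uSphere_eq_orthoHaar (hk : 0 < k) {S : Set (sphere (0 : EuclideanSpace ℝ (Fin k)) 1)}
    (hS : MeasurableSet S) {x : EuclideanSpace ℝ (Fin k)} (hx : x ≠ 0) :
    uSphere k S = orthoHaar k {R | orthoIso R x ∈ coneSet S} := by
  set V := volume (ball (0 : EuclideanSpace ℝ (Fin k)) 1) with hV
  have hV0 : V ≠ 0 := (measure_ball_pos volume _ one_pos).ne'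
  have hVt : V ≠ ⊤ := measure_ball_lt_top.ne
  have : Nontrivial (EuclideanSpace ℝ (Fin k)) :=
    Module.nontrivial_of_finrank_pos (R := ℝ) (by simpa using hk)
  let P := V⁻¹ • (volume : Measure (EuclideanSpace ℝ (Fin k))).restrict (ball 0 1)
  have hP : IsProbabilityMeasure P := ⟨by
    simp only [P, Measure.smul_apply, Measure.restrict_apply_univ, smul_eq_mul]
    exact ENNReal.inv_mul_cancel hV0 hVt⟩
  have hinv : ∀ U, P.map (orthoIso U) = P := by
    intro U
    let e := (orthoIso U).toLinearIsometryEquiv rfl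
    have h := e.measurePreserving.restrict_preimage (s := ball 0 1) measurableSet_ball
    have h1 : e ⁻¹' ball 0 1 = ball 0 1 := by
      ext x
      simp
    rw [h1] at h
    change Measure.map e (V⁻¹ • _) = V⁻¹ • _
    rw [Measure.map_smul, h.map_eq]
  have hzero : P {0} = 0 := by
    simp only [P, Measure.smul_apply, smul_eq_mul]
    rw [Measure.restrict_apply (measurableSet_singleton 0),
      measure_mono_null Set.inter_subset_left (by simp), mul_zero]
  rw [orthoHaar_orthoIso_mem_cone hinv hzero (measurableSet_coneSet hS)
    (smul_mem_coneSet S) hx, uSphere_apply hk hS]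
  simp only [P, Measure.smul_apply, smul_eq_mul]
  rw [Measure.restrict_apply (measurableSet_coneSet hS)]

lemma gaussPi_singleton_zero (hk : 0 < k) : gaussPi k {0} = 0 := by
  have := nullSingletonClass_gaussianReal (μ := 0) (v := 1) one_ne_zero
  rw [Measure.pi_singleton]
  exact Finset.prod_eq_zero (Finset.mem_univ ⟨0, hk⟩) (measure_singleton _)

lemma stdGaussian_coneSet (hk : 0 < k) {S : Set (sphere (0 : EuclideanSpace ℝ (Fin k)) 1)}
    (hS : MeasurableSet S) : stdGaussian (EuclideanSpace ℝ (Fin k)) (coneSet S) = uSphere k S := by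
  have : Nontrivial (EuclideanSpace ℝ (Fin k)) :=
    Module.nontrivial_of_finrank_pos (R := ℝ) (by simpa using hk)
  have : Nonempty (Fin k) := ⟨⟨0, hk⟩⟩
  obtain ⟨x, hx⟩ := exists_ne (0 : EuclideanSpace ℝ (Fin k))
  rw [uSphere_eq_orthoHaar hk hS hx]
  refine (orthoHaar_orthoIso_mem_cone (fun U => ?_) ?_ (measurableSet_coneSet hS)
    (smul_mem_coneSet S) hx).symm
  · exact stdGaussian_map ((orthoIso U).toLinearIsometryEquiv rfl)
  · rw [← map_pi_eq_stdGaussian, Measure.map_apply (by fun_prop) (measurableSet_singleton 0)]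
    refine measure_mono_null ?_ (gaussPi_singleton_zero hk)
    intro y hy
    exact congrArg WithLp.ofLp hy

end
end GaussianBL

namespace GaussianBL
open ProbabilityTheory Filter Topology
open scoped ENNReal NNReal

section
variable {n d : ℕ}

/-- The proportion of a linear section of the sphere lying in `A`. -/
noncomputable def sectionMeas (A : Set (sphere (0 : EuclideanSpace ℝ (Fin n)) 1))
    (e : EuclideanSpace ℝ (Fin d) →ₗᵢ[ℝ] EuclideanSpace ℝ (Fin n)) : ℝ :=
  (uSphere d {ω | sphereMap e ω ∈ A}).toReal

/-- The indicator of a cone. -/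
noncomputable def coneInd (A : Set (sphere (0 : EuclideanSpace ℝ (Fin n)) 1))
    (x : EuclideanSpace ℝ (Fin n)) : ℝ :=
  (coneSet A).indicator (fun _ => 1) x

variable {A : Set (sphere (0 : EuclideanSpace ℝ (Fin n)) 1)}

lemma measurable_coneInd (hA : MeasurableSet A) : Measurable (coneInd A) :=
  measurable_const.indicator (measurableSet_coneSet hA)

lemma coneInd_nonneg (x : EuclideanSpace ℝ (Fin n)) : 0 ≤ coneInd A x :=
  Set.indicator_nonneg (fun _ _ => zero_le_one) _

lemma coneInd_le_one (x : EuclideanSpace ℝ (Fin n)) : coneInd A x ≤ 1 :=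
  Set.indicator_le_self' (fun _ _ => zero_le_one) _

lemma sectionMeas_eq_integral (hd : 0 < d) (hA : MeasurableSet A)
    (e : EuclideanSpace ℝ (Fin d) →ₗᵢ[ℝ] EuclideanSpace ℝ (Fin n))
    {y : EuclideanSpace ℝ (Fin d)} (hy : y ≠ 0) :
    sectionMeas A e = ∫ R, coneInd A (e (orthoIso R y)) ∂orthoHaar d := by
  have hs : MeasurableSet {ω | sphereMap e ω ∈ A} := by
    have : Continuous (sphereMap e) :=
      Continuous.subtype_mk (e.continuous.comp continuous_subtype_val) _
    exact this.measurable hA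
  rw [sectionMeas, uSphere_eq_orthoHaar hd hs hy]
  simp only [mem_coneSet_sphereMap]
  have hm : MeasurableSet {R | e (orthoIso R y) ∈ coneSet A} :=
    measurableSet_orthoIso y (e.continuous.measurable (measurableSet_coneSet hA))
  rw [← measureReal_def, ← integral_indicator_one hm]
  rfl

lemma sectionMeas_nonneg (e : EuclideanSpace ℝ (Fin d) →ₗᵢ[ℝ] EuclideanSpace ℝ (Fin n)) :
    0 ≤ sectionMeas A e :=
  ENNReal.toReal_nonneg

lemma exists_ne_zero_of_pos (hd : 0 < d) : ∃ y : EuclideanSpace ℝ (Fin d), y ≠ 0 := by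
  have : Nontrivial (EuclideanSpace ℝ (Fin d)) :=
    Module.nontrivial_of_finrank_pos (R := ℝ) (by simpa using hd)
  exact exists_ne 0

lemma integrable_coneInd_comp {Ω : Type*} [MeasurableSpace Ω] {P : Measure Ω} [IsFiniteMeasure P]
    (hA : MeasurableSet A) {f : Ω → EuclideanSpace ℝ (Fin n)} (hf : Measurable f) :
    Integrable (fun ω => coneInd A (f ω)) P :=
  Integrable.of_bound (C := 1) ((measurable_coneInd hA).comp hf).aestronglyMeasurable
    (.of_forall fun ω => by
      rw [Real.norm_of_nonneg (coneInd_nonneg _)]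
      exact coneInd_le_one _)

lemma measurable_orthoIso_left (y : EuclideanSpace ℝ (Fin d)) :
    Measurable fun R => orthoIso R y :=
  measurable_id.orthoIso measurable_const

lemma sectionMeas_le_one (hd : 0 < d) (hA : MeasurableSet A)
    (e : EuclideanSpace ℝ (Fin d) →ₗᵢ[ℝ] EuclideanSpace ℝ (Fin n)) : sectionMeas A e ≤ 1 := by
  obtain ⟨y, hy⟩ := exists_ne_zero_of_pos hd
  rw [sectionMeas_eq_integral hd hA e hy]
  calc _ ≤ ∫ _, (1 : ℝ) ∂orthoHaar d := integral_mono
        (integrable_coneInd_comp hA (e.continuous.measurable.comp (measurable_orthoIso_left y)))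
        (integrable_const _) fun R => coneInd_le_one _
    _ = 1 := by simp

lemma measurable_orthoIso_comp_orthoIso
    (e : EuclideanSpace ℝ (Fin d) →ₗᵢ[ℝ] EuclideanSpace ℝ (Fin n)) (y : EuclideanSpace ℝ (Fin d)) :
    Measurable fun p : Matrix.unitaryGroup (Fin n) ℝ × Matrix.unitaryGroup (Fin d) ℝ =>
      orthoIso p.1 (e (orthoIso p.2 y)) :=
  measurable_fst.orthoIso (e.continuous.measurable.comp (measurable_snd.orthoIso measurable_const))

lemma measurable_sectionMeas (hd : 0 < d) (hA : MeasurableSet A)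
    (e : EuclideanSpace ℝ (Fin d) →ₗᵢ[ℝ] EuclideanSpace ℝ (Fin n)) :
    Measurable fun U => sectionMeas A ((orthoIso U).comp e) := by
  obtain ⟨y, hy⟩ := exists_ne_zero_of_pos hd
  simp_rw [sectionMeas_eq_integral hd hA _ hy, LinearIsometry.coe_comp, Function.comp_apply]
  have : StronglyMeasurable fun p : Matrix.unitaryGroup (Fin n) ℝ × Matrix.unitaryGroup (Fin d) ℝ =>
      coneInd A (orthoIso p.1 (e (orthoIso p.2 y))) :=
    ((measurable_coneInd hA).comp (measurable_orthoIso_comp_orthoIso e y)).stronglyMeasurable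
  exact this.integral_prod_right'.measurable

lemma exists_bound_of_continuous {φ : ℝ → ℝ} (hφ : Continuous φ) :
    ∃ K, ∀ x, 0 ≤ x → x ≤ 1 → |φ x| ≤ K := by
  obtain ⟨K, hK⟩ := isCompact_Icc.exists_bound_of_continuousOn (s := Set.Icc (0 : ℝ) 1)
    hφ.continuousOn
  exact ⟨K, fun x h0 h1 => hK x ⟨h0, h1⟩⟩

/-- Averaging over the rotations of the subspace only decreases a convex function of the number
of vectors in a random rotation of a configuration that meet a cone. -/
lemma integral_sectionMeas_le {ι : Type*} [Fintype ι] (hd : 0 < d)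
    (hA : MeasurableSet A) (e : EuclideanSpace ℝ (Fin d) →ₗᵢ[ℝ] EuclideanSpace ℝ (Fin n))
    (M : EuclideanSpace ℝ (Fin d) →ₗ[ℝ] EuclideanSpace ℝ (Fin n))
    (x : ι → EuclideanSpace ℝ (Fin d)) (hx : ∀ i, M (x i) ≠ 0) {c : ℝ} (hc0 : 0 ≤ c)
    (hc : c * Fintype.card ι = 1) {φ : ℝ → ℝ} (hφ : ConvexOn ℝ Set.univ φ) (hφc : Continuous φ) :
    ∫ U, φ (sectionMeas A ((orthoIso U).comp e)) ∂orthoHaar n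
      ≤ ∫ U, φ (c * ∑ i, coneInd A (orthoIso U (M (x i)))) ∂orthoHaar n := by
  obtain ⟨V, L, hL⟩ := exists_orthoIso_factor e M
  have hL0 : ∀ i, L (x i) ≠ 0 := fun i h => hx i (by rw [hL, h]; simp)
  obtain ⟨K, hK⟩ := exists_bound_of_continuous hφc
  have hK' : ∀ y : ι → EuclideanSpace ℝ (Fin n), |φ (c * ∑ i, coneInd A (y i))| ≤ K := by
    refine fun y => hK _ (mul_nonneg hc0 (Finset.sum_nonneg fun i _ => coneInd_nonneg _)) ?_
    calc _ ≤ c * ∑ _i : ι, (1 : ℝ) := by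
          gcongr
          exact coneInd_le_one _
      _ = 1 := by simpa using hc
  set g := fun U => φ (c * ∑ i, coneInd A (orthoIso U (e (L (x i))))) with hg
  have hVg : ∫ U, φ (c * ∑ i, coneInd A (orthoIso U (M (x i)))) ∂orthoHaar n
      = ∫ U, g U ∂orthoHaar n := by
    rw [← integral_mul_right_eq_self g V]
    simp only [hg, hL, orthoIso_mul]
  set G := fun p : Matrix.unitaryGroup (Fin n) ℝ × Matrix.unitaryGroup (Fin d) ℝ =>
    c * ∑ i, coneInd A (orthoIso p.1 (e (orthoIso p.2 (L (x i))))) with hGdef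
  have hGm : Measurable G := by
    refine measurable_const.mul (Finset.measurable_fun_sum _ fun i _ => ?_)
    exact (measurable_coneInd hA).comp (measurable_orthoIso_comp_orthoIso e _)
  have hGint : Integrable (fun p => φ (G p)) ((orthoHaar n).prod (orthoHaar d)) :=
    Integrable.of_bound (C := K) (hφc.measurable.comp hGm).aestronglyMeasurable
      (.of_forall fun p => hK' _)
  have hR : ∀ R : Matrix.unitaryGroup (Fin d) ℝ,
      ∫ U, φ (G (U, R)) ∂orthoHaar n = ∫ U, g U ∂orthoHaar n := by
    intro R
    obtain ⟨W, hW⟩ := exists_orthoIso_comp_eq e (e.comp (orthoIso R))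
    rw [← integral_mul_right_eq_self g W]
    simp only [hg, hGdef, orthoIso_mul, hW, LinearIsometry.coe_comp, Function.comp_apply]
  have hGU : ∀ U, ∫ R, G (U, R) ∂orthoHaar d = sectionMeas A ((orthoIso U).comp e) := by
    intro U
    have hf : ∀ i, Measurable fun R => orthoIso U (e (orthoIso R (L (x i)))) := fun i =>
      measurable_const.orthoIso
        (e.continuous.measurable.comp (measurable_id.orthoIso measurable_const))
    simp only [hGdef]
    rw [integral_const_mul, integral_finsetSum _ fun i _ => integrable_coneInd_comp hA (hf i)]
    have : ∀ i, ∫ R, coneInd A (orthoIso U (e (orthoIso R (L (x i))))) ∂orthoHaar d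
        = sectionMeas A ((orthoIso U).comp e) := fun i => by
      rw [sectionMeas_eq_integral hd hA ((orthoIso U).comp e) (hL0 i)]
      simp only [LinearIsometry.coe_comp, Function.comp_apply]
    simp only [this, Finset.sum_const, Finset.card_univ, nsmul_eq_mul]
    rw [← mul_assoc, hc, one_mul]
  calc _ ≤ ∫ U, ∫ R, φ (G (U, R)) ∂orthoHaar d ∂orthoHaar n := by
        refine integral_mono ?_ hGint.integral_prod_left fun U => ?_
        · exact Integrable.of_bound (C := K)
            (hφc.measurable.comp (measurable_sectionMeas hd hA e)).aestronglyMeasurable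
            (.of_forall fun U => hK _ (sectionMeas_nonneg _) (sectionMeas_le_one hd hA _))
        · simp only
          rw [← hGU]
          have hGU' : Measurable fun R => G (U, R) := hGm.comp (measurable_const.prodMk measurable_id)
          refine hφ.map_integral_le hφc.continuousOn isClosed_univ (by simp) ?_ ?_
          · refine (integrable_finsetSum _ fun i _ => ?_).const_mul c
            exact integrable_coneInd_comp hA (measurable_const.orthoIso
              (e.continuous.measurable.comp (measurable_id.orthoIso measurable_const)))
          · exact Integrable.of_bound (C := K) (hφc.measurable.comp hGU').aestronglyMeasurable
              (.of_forall fun R => hK' _)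
    _ = ∫ R, ∫ U, φ (G (U, R)) ∂orthoHaar n ∂orthoHaar d := integral_integral_swap hGint
    _ = _ := by
        simp only [hR, hVg]
        simp

end
end GaussianBL

namespace GaussianBL
open ProbabilityTheory Filter Topology
open scoped ENNReal NNReal

section
variable {n d : ℕ}

lemma coe_mul_transpose (U : Matrix.unitaryGroup (Fin n) ℝ) : U.1 * U.1.transpose = 1 := by
  have := Matrix.mem_unitaryGroup_iff.1 U.2
  rwa [Matrix.star_eq_conjTranspose, Matrix.conjTranspose_eq_transpose_of_trivial] at this

lemma transpose_mul_coe (U : Matrix.unitaryGroup (Fin n) ℝ) : U.1.transpose * U.1 = 1 := by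
  have := Matrix.mem_unitaryGroup_iff'.1 U.2
  rwa [Matrix.star_eq_conjTranspose, Matrix.conjTranspose_eq_transpose_of_trivial] at this

/-- The action of the orthogonal group on the Grassmannian. -/
def grassRot (U : Matrix.unitaryGroup (Fin n) ℝ) (Q : Grass n d) : Grass n d :=
  ⟨U.1 * Q.1 * U.1.transpose, by
    obtain ⟨h1, h2, h3⟩ := Q.2
    refine ⟨?_, ?_, ?_⟩
    · rw [Matrix.IsSymm, Matrix.transpose_mul, Matrix.transpose_mul, Matrix.transpose_transpose,
        h1.eq, mul_assoc]
    · calc _ = U.1 * Q.1 * (U.1.transpose * U.1) * Q.1 * U.1.transpose := by noncomm_ring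
        _ = U.1 * (Q.1 * Q.1) * U.1.transpose := by
          rw [transpose_mul_coe]
          noncomm_ring
        _ = _ := by rw [h2]
    · rw [Matrix.trace_mul_comm, ← mul_assoc, transpose_mul_coe, one_mul, h3]⟩

lemma measurable_grassRot :
    Measurable fun p : Matrix.unitaryGroup (Fin n) ℝ × Grass n d => grassRot p.1 p.2 := by
  refine Measurable.subtype_mk (measurable_pi_lambda _ fun i => measurable_pi_lambda _ fun j => ?_)
  simp only [Matrix.mul_apply, Matrix.transpose_apply]
  have hU : ∀ i j, Measurable fun p : Matrix.unitaryGroup (Fin n) ℝ × Grass n d => p.1.1 i j := by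
    intro i j
    have : Continuous fun U : Matrix.unitaryGroup (Fin n) ℝ => U.1 i j :=
      continuous_subtype_val.matrix_elem i j
    exact this.measurable.comp measurable_fst
  have hQ : ∀ i j, Measurable fun p : Matrix.unitaryGroup (Fin n) ℝ × Grass n d => p.2.1 i j := by
    intro i j
    have h : @Measurable (Grass n d) (Fin n → Fin n → ℝ) _ _ fun Q => Q.1 := comap_measurable _
    exact ((measurable_pi_apply j).comp ((measurable_pi_apply i).comp h)).comp measurable_snd
  refine Finset.measurable_fun_sum _ fun k _ => (Finset.measurable_fun_sum _ fun l _ => ?_).mul (hU _ _)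
  exact (hU _ _).mul (hQ _ _)

lemma grassRot_coe (U : Matrix.unitaryGroup (Fin n) ℝ) (Q : Grass n d) :
    (grassRot U Q).1 = U.1 * Q.1 * U.1.transpose := rfl

attribute [irreducible] grassRot

lemma mem_range_orthoIso_comp {Q : Grass n d}
    {e : EuclideanSpace ℝ (Fin d) →ₗᵢ[ℝ] EuclideanSpace ℝ (Fin n)}
    (he : ∀ v : EuclideanSpace ℝ (Fin n), v ∈ LinearMap.range e.toLinearMap ↔ Q.1.mulVec v = v)
    (U : Matrix.unitaryGroup (Fin n) ℝ) (v : EuclideanSpace ℝ (Fin n)) :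
    v ∈ LinearMap.range ((orthoIso U).comp e).toLinearMap ↔ (grassRot U Q).1.mulVec v = v := by
  have hinv : orthoIso U (orthoIso U⁻¹ v) = v := by
    rw [← orthoIso_mul, mul_inv_cancel]
    apply WithLp.ofLp_injective
    simp [orthoIso_ofLp]
  have h1 : v ∈ LinearMap.range ((orthoIso U).comp e).toLinearMap
      ↔ orthoIso U⁻¹ v ∈ LinearMap.range e.toLinearMap := by
    constructor
    · rintro ⟨x, rfl⟩
      refine ⟨x, (orthoIso U).injective ?_⟩
      rw [hinv]
      rfl
    · rintro ⟨x, hx⟩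
      refine ⟨x, ?_⟩
      rw [← hinv, ← hx]
      rfl
  rw [h1, he]
  have h2 : (orthoIso U⁻¹ v).ofLp = U.1.transpose.mulVec v.ofLp := by
    rw [orthoIso_ofLp]
    rfl
  simp only [grassRot_coe, ← Matrix.mulVec_mulVec, h2]
  constructor
  · intro h
    rw [h, Matrix.mulVec_mulVec, coe_mul_transpose, Matrix.one_mulVec]
  · intro h
    have h' := congrArg (U.1.transpose.mulVec ·) h
    simp only [Matrix.mulVec_mulVec, ← mul_assoc, transpose_mul_coe, one_mul] at h'
    rw [Matrix.mulVec_mulVec, h']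

lemma exists_isometry_range_eq (Q : Grass n d) :
    ∃ e : EuclideanSpace ℝ (Fin d) →ₗᵢ[ℝ] EuclideanSpace ℝ (Fin n),
      ∀ v : EuclideanSpace ℝ (Fin n), v ∈ LinearMap.range e.toLinearMap ↔ Q.1.mulVec v = v := by
  obtain ⟨-, h2, h3⟩ := Q.2
  set f : EuclideanSpace ℝ (Fin n) →ₗ[ℝ] EuclideanSpace ℝ (Fin n) := Matrix.toEuclideanLin Q.1
    with hf
  have hfx : ∀ v, (f v).ofLp = Q.1.mulVec v.ofLp := fun v => rfl
  have hff : ∀ v, f (f v) = f v := fun v => by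
    apply WithLp.ofLp_injective
    rw [hfx, hfx, Matrix.mulVec_mulVec, h2]
  have hproj : LinearMap.IsProj (LinearMap.range f) f :=
    ⟨fun v => ⟨v, rfl⟩, by rintro _ ⟨v, rfl⟩; exact hff v⟩
  have htr : LinearMap.trace ℝ _ f = d := by
    rw [hf, Matrix.toEuclideanLin_eq_toLin_orthonormal, Matrix.trace_toLin_eq, h3]
  have hr : Module.finrank ℝ (LinearMap.range f) = d := by
    have := hproj.trace
    rw [htr] at this
    exact_mod_cast this.symm
  let b := (stdOrthonormalBasis ℝ (LinearMap.range f)).reindex (finCongr hr)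
  refine ⟨(LinearMap.range f).subtypeₗᵢ.comp b.repr.symm.toLinearIsometry, fun v => ?_⟩
  constructor
  · rintro ⟨x, rfl⟩
    obtain ⟨y, hy⟩ := (b.repr.symm x).2
    have : f (b.repr.symm x) = b.repr.symm x := hproj.map_id _ (b.repr.symm x).2
    exact congrArg WithLp.ofLp this
  · intro h
    have hv : v ∈ LinearMap.range f := ⟨v, WithLp.ofLp_injective _ h⟩
    refine ⟨b.repr ⟨v, hv⟩, ?_⟩
    change ((b.repr.symm (b.repr ⟨v, hv⟩) : LinearMap.range f) : EuclideanSpace ℝ (Fin n)) = v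
    rw [LinearIsometryEquiv.symm_apply_apply]

/-- Invariant integrals over the Grassmannian are Haar integrals. -/
lemma integral_grass_eq (hd : 0 < d) {A : Set (sphere (0 : EuclideanSpace ℝ (Fin n)) 1)}
    (hA : MeasurableSet A) {ν : Measure (Grass n d)} [IsProbabilityMeasure ν]
    (hν : ∀ U ∈ Matrix.orthogonalGroup (Fin n) ℝ, ∀ T : Grass n d → Grass n d,
      Measurable T → (∀ Q : Grass n d, (T Q).1 = U * Q.1 * U.transpose) → ν.map T = ν)
    {F : Grass n d → ℝ} (hFm : Measurable F)
    (hF : ∀ (Q : Grass n d) (e : EuclideanSpace ℝ (Fin d) →ₗᵢ[ℝ] EuclideanSpace ℝ (Fin n)),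
      (∀ v : EuclideanSpace ℝ (Fin n), v ∈ LinearMap.range e.toLinearMap ↔ Q.1.mulVec v = v) →
      F Q = sectionMeas A e)
    (e : EuclideanSpace ℝ (Fin d) →ₗᵢ[ℝ] EuclideanSpace ℝ (Fin n))
    {φ : ℝ → ℝ} (hφ : Continuous φ) :
    ∫ Q, φ (F Q) ∂ν = ∫ U, φ (sectionMeas A ((orthoIso U).comp e)) ∂orthoHaar n := by
  obtain ⟨K, hK⟩ := exists_bound_of_continuous hφ
  have hFK : ∀ Q, |φ (F Q)| ≤ K := by
    intro Q
    obtain ⟨e, he⟩ := exists_isometry_range_eq Q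
    rw [hF Q e he]
    exact hK _ (sectionMeas_nonneg _) (sectionMeas_le_one hd hA _)
  have hjoint : Measurable fun p : Matrix.unitaryGroup (Fin n) ℝ × Grass n d =>
      φ (F (grassRot p.1 p.2)) :=
    Measurable.comp (g := fun Q => φ (F Q))
      (f := fun p : Matrix.unitaryGroup (Fin n) ℝ × Grass n d => grassRot p.1 p.2)
      (hφ.measurable.comp hFm) measurable_grassRot
  have hinv : ∀ U, ∫ Q, φ (F (grassRot U Q)) ∂ν = ∫ Q, φ (F Q) ∂ν := by
    intro U
    have hm : Measurable fun Q : Grass n d => grassRot U Q :=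
      Measurable.comp (g := fun p : Matrix.unitaryGroup (Fin n) ℝ × Grass n d => grassRot p.1 p.2)
        (f := fun Q => (U, Q)) measurable_grassRot measurable_prodMk_left
    have hU : U.1 ∈ Matrix.orthogonalGroup (Fin n) ℝ :=
      (Matrix.mem_orthogonalGroup_iff (n := Fin n) ℝ).2 (coe_mul_transpose U)
    conv_rhs => rw [← hν U.1 hU _ hm fun Q => grassRot_coe U Q]
    exact (integral_map (f := fun Q => φ (F Q)) hm.aemeasurable
      (hφ.measurable.comp hFm).aestronglyMeasurable).symm
  calc _ = ∫ U, ∫ Q, φ (F (grassRot U Q)) ∂ν ∂orthoHaar n := by simp [hinv]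
    _ = ∫ Q, ∫ U, φ (F (grassRot U Q)) ∂orthoHaar n ∂ν := by
      refine integral_integral_swap (f := fun U Q => φ (F (grassRot U Q))) ?_
      exact Integrable.of_bound (C := K) hjoint.aestronglyMeasurable (.of_forall fun p => hFK _)
    _ = ∫ Q, ∫ U, φ (sectionMeas A ((orthoIso U).comp e)) ∂orthoHaar n ∂ν := by
      refine integral_congr_ae (.of_forall fun Q => ?_)
      obtain ⟨e', he'⟩ := exists_isometry_range_eq Q
      obtain ⟨V, hV⟩ := exists_orthoIso_comp_eq e e'
      simp only
      rw [← integral_mul_right_eq_self (fun U => φ (sectionMeas A ((orthoIso U).comp e))) V]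
      refine integral_congr_ae (.of_forall fun U => ?_)
      simp only
      rw [hF _ _ (mem_range_orthoIso_comp he' U)]
      congr 2
      ext1 x
      simp only [LinearIsometry.coe_comp, Function.comp_apply, orthoIso_mul, hV]
    _ = _ := by simp

end
end GaussianBL

namespace GaussianBL
open ProbabilityTheory Filter Topology
open scoped ENNReal NNReal

section
variable {n d : ℕ}

lemma HasGram.mulVec {Ω J : Type*} [MeasurableSpace Ω] [Fintype J] {P : Measure Ω}
    {X : Ω → J → Fin n → ℝ} {R : J → J → ℝ} (h : HasGram P X R)
    (U : Matrix.unitaryGroup (Fin n) ℝ) :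
    HasGram P (fun ω j => U.1.mulVec (X ω j)) R := by
  have hX := h.1
  refine ⟨?_, fun c => ?_⟩
  · refine measurable_pi_lambda _ fun j => measurable_pi_lambda _ fun l => ?_
    simp only [Matrix.mulVec, dotProduct]
    fun_prop
  · have h1 : ∀ ω, ∑ j, ∑ l, c j l * U.1.mulVec (X ω j) l
        = ∑ j, ∑ l, U.1.transpose.mulVec (c j) l * X ω j l := fun ω =>
      Finset.sum_congr rfl fun j _ => by
        change c j ⬝ᵥ U.1.mulVec (X ω j) = U.1.transpose.mulVec (c j) ⬝ᵥ X ω j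
        rw [Matrix.dotProduct_mulVec, Matrix.mulVec_transpose]
    have h2 : ∑ l, ∑ j, ∑ k, U.1.transpose.mulVec (c j) l * U.1.transpose.mulVec (c k) l * R j k
        = ∑ l, ∑ j, ∑ k, c j l * c k l * R j k := by
      have key : ∀ j k, U.1.transpose.mulVec (c j) ⬝ᵥ U.1.transpose.mulVec (c k) = c j ⬝ᵥ c k := by
        intro j k
        rw [Matrix.mulVec_transpose, ← Matrix.dotProduct_mulVec, Matrix.mulVec_mulVec,
          coe_mul_transpose, Matrix.one_mulVec]
      have hsum : ∀ b : J → Fin n → ℝ, ∑ l, ∑ j, ∑ k, b j l * b k l * R j k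
          = ∑ j, ∑ k, (b j ⬝ᵥ b k) * R j k := by
        intro b
        rw [Finset.sum_comm]
        refine Finset.sum_congr rfl fun j _ => ?_
        rw [Finset.sum_comm]
        simp [dotProduct, Finset.sum_mul]
      rw [hsum, hsum]
      simp_rw [key]
    simp_rw [h1]
    rw [h.2 fun j => U.1.transpose.mulVec (c j), h2]

/-- The preimage of a cone under the identification of `Fin n → ℝ` with Euclidean space. -/
def coordCone (A : Set (sphere (0 : EuclideanSpace ℝ (Fin n)) 1)) : Set (Fin n → ℝ) :=
  {x | WithLp.toLp 2 x ∈ coneSet A}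

variable {A : Set (sphere (0 : EuclideanSpace ℝ (Fin n)) 1)}

lemma measurableSet_coordCone (hA : MeasurableSet A) : MeasurableSet (coordCone A) :=
  (PiLp.continuous_toLp 2 fun _ : Fin n => ℝ).measurable (measurableSet_coneSet hA)

lemma gaussPi_coordCone (hn : 0 < n) (hA : MeasurableSet A) :
    (gaussPi n).real (coordCone A) = (uSphere n A).toReal := by
  rw [← stdGaussian_coneSet hn hA, ← map_pi_eq_stdGaussian,
    Measure.map_apply (PiLp.continuous_toLp 2 fun _ : Fin n => ℝ).measurable
      (measurableSet_coneSet hA)]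
  rfl

/-- The linear map whose rows are the given vectors. -/
noncomputable def rowMap (Γ : Fin n → EuclideanSpace ℝ (Fin d)) :
    EuclideanSpace ℝ (Fin d) →ₗ[ℝ] EuclideanSpace ℝ (Fin n) where
  toFun x := WithLp.toLp 2 fun l => inner ℝ x (Γ l)
  map_add' x y := by
    ext l
    simp [inner_add_left]
  map_smul' c x := by
    ext l
    simp [real_inner_smul_left]

lemma rowMap_apply (Γ : Fin n → EuclideanSpace ℝ (Fin d)) (x : EuclideanSpace ℝ (Fin d)) :
    rowMap Γ x = WithLp.toLp 2 fun l => inner ℝ x (Γ l) := rfl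

lemma coneInd_orthoIso_toLp (U : Matrix.unitaryGroup (Fin n) ℝ) (x : Fin n → ℝ) :
    coneInd A (orthoIso U (WithLp.toLp 2 x))
      = (coordCone A).indicator (fun _ => (1 : ℝ)) (U.1.mulVec x) := by
  have : orthoIso U (WithLp.toLp 2 x) = WithLp.toLp 2 (U.1.mulVec x) := by
    apply WithLp.ofLp_injective
    rw [orthoIso_ofLp]
  rw [this]
  rfl

lemma ae_rowMap_ne_zero (hn : 0 < n) {x : EuclideanSpace ℝ (Fin d)} (hx : ‖x‖ = 1) :
    ∀ᵐ Γ ∂(Measure.pi fun _ : Fin n => stdGaussian (EuclideanSpace ℝ (Fin d))),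
      rowMap Γ x ≠ 0 := by
  have hm : Measurable fun y : Fin n → ℝ =>
      ({0} : Set (Fin n → ℝ)).indicator (1 : (Fin n → ℝ) → ℝ≥0∞) y :=
    measurable_one.indicator (measurableSet_singleton 0)
  have h := lintegral_inner_eq (n := n) hx hm
  rw [lintegral_indicator_one (measurableSet_singleton 0), gaussPi_singleton_zero hn] at h
  have hl : Measurable fun (Γ : Fin n → EuclideanSpace ℝ (Fin d)) l => inner ℝ x (Γ l) := by
    fun_prop
  replace h := (lintegral_eq_zero_iff (hm.comp hl)).1 h
  filter_upwards [h] with Γ hΓ h0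
  have : (fun l => inner ℝ x (Γ l)) = (0 : Fin n → ℝ) := congrArg WithLp.ofLp h0
  simp [this] at hΓ

/-- A convex function of the measure of a random section is dominated by the same function of the
average over sign vectors. -/
lemma integral_sectionMeas_le_integral_signAvg (hn : 0 < n) (hd : 0 < d) (hA : MeasurableSet A)
    (e : EuclideanSpace ℝ (Fin d) →ₗᵢ[ℝ] EuclideanSpace ℝ (Fin n))
    {φ : ℝ → ℝ} (hφ : ConvexOn ℝ Set.univ φ) (hφc : Continuous φ) :
    ∫ U, φ (sectionMeas A ((orthoIso U).comp e)) ∂orthoHaar n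
      ≤ ∫ Γ, φ (signAvg (coordCone A) Γ)
        ∂(Measure.pi fun _ : Fin n => stdGaussian (EuclideanSpace ℝ (Fin d))) := by
  obtain ⟨K, hK⟩ := exists_bound_of_continuous hφc
  set P := Measure.pi fun _ : Fin n => stdGaussian (EuclideanSpace ℝ (Fin d)) with hP
  have hc : ((2 : ℝ) ^ d)⁻¹ * Fintype.card (Fin d → Bool) = 1 := by simp
  set G := fun p : (Fin n → EuclideanSpace ℝ (Fin d)) × Matrix.unitaryGroup (Fin n) ℝ =>
    ((2 : ℝ) ^ d)⁻¹ * ∑ b : Fin d → Bool, coneInd A (orthoIso p.2 (rowMap p.1 (signVec b)))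
    with hG
  have hG0 : ∀ p, 0 ≤ G p := fun p =>
    mul_nonneg (by positivity) (Finset.sum_nonneg fun i _ => coneInd_nonneg _)
  have hG1 : ∀ p, G p ≤ 1 := fun p => by
    calc _ ≤ ((2 : ℝ) ^ d)⁻¹ * ∑ _b : Fin d → Bool, (1 : ℝ) := by
          simp only [hG]
          gcongr
          exact coneInd_le_one _
      _ = 1 := by simp
  have hGm : Measurable G := by
    refine measurable_const.mul (Finset.measurable_fun_sum _ fun b _ => ?_)
    refine (measurable_coneInd hA).comp (measurable_snd.orthoIso ?_)
    refine (PiLp.continuous_toLp 2 fun _ : Fin n => ℝ).measurable.comp ?_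
    fun_prop
  have hGint : Integrable (fun p => φ (G p)) (P.prod (orthoHaar n)) :=
    Integrable.of_bound (C := K) (hφc.measurable.comp hGm).aestronglyMeasurable
      (.of_forall fun p => hK _ (hG0 p) (hG1 p))
  have hrot : ∀ U, ∫ Γ, φ (G (Γ, U)) ∂P = ∫ Γ, φ (signAvg (coordCone A) Γ) ∂P := by
    intro U
    have h := hasGram_inner (fun b : Fin d → Bool => signVec b) n
    have := (h.mulVec U).integral_eq h (F := fun x => φ (((2 : ℝ) ^ d)⁻¹ *
      ∑ b, (coordCone A).indicator (fun _ => (1 : ℝ)) (x b))) (by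
        refine hφc.measurable.comp (measurable_const.mul (Finset.measurable_fun_sum _ fun b _ => ?_))
        exact (measurable_const.indicator (measurableSet_coordCone hA)).comp (measurable_pi_apply b))
    simpa only [hG, rowMap_apply, coneInd_orthoIso_toLp, signAvg] using this
  calc _ = ∫ Γ, ∫ U, φ (sectionMeas A ((orthoIso U).comp e)) ∂orthoHaar n ∂P := by simp
    _ ≤ ∫ Γ, ∫ U, φ (G (Γ, U)) ∂orthoHaar n ∂P := by
      refine integral_mono_ae (integrable_const _) hGint.integral_prod_left ?_
      have hae : ∀ᵐ Γ ∂P, ∀ b : Fin d → Bool, rowMap Γ (signVec b) ≠ 0 :=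
        ae_all_iff.2 fun b => ae_rowMap_ne_zero hn (norm_signVec hd b)
      filter_upwards [hae] with Γ hΓ
      exact integral_sectionMeas_le hd hA e (rowMap Γ) signVec hΓ (by positivity) hc hφ hφc
    _ = ∫ U, ∫ Γ, φ (G (Γ, U)) ∂P ∂orthoHaar n := integral_integral_swap hGint
    _ = _ := by
      simp only [hrot]
      simp

end
end GaussianBL

namespace GaussianBL
open ProbabilityTheory Filter Topology
open scoped ENNReal NNReal

section
variable {n d : ℕ} {A : Set (sphere (0 : EuclideanSpace ℝ (Fin n)) 1)}
  {ν : Measure (Grass n d)} {F : Grass n d → ℝ}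

/-- Moments of the normalized measure of a random section. -/
lemma integral_section_sub_one_pow_le [IsProbabilityMeasure ν] (hn : 0 < n) (hd : 0 < d)
    (hdn : d ≤ n) (hA : MeasurableSet A)
    (hν : ∀ U ∈ Matrix.orthogonalGroup (Fin n) ℝ, ∀ T : Grass n d → Grass n d,
      Measurable T → (∀ Q : Grass n d, (T Q).1 = U * Q.1 * U.transpose) → ν.map T = ν)
    (hFm : Measurable F)
    (hF : ∀ (Q : Grass n d) (e : EuclideanSpace ℝ (Fin d) →ₗᵢ[ℝ] EuclideanSpace ℝ (Fin n)),
      (∀ v : EuclideanSpace ℝ (Fin n), v ∈ LinearMap.range e.toLinearMap ↔ Q.1.mulVec v = v) →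
      F Q = sectionMeas A e)
    {a ε : ℝ} (ha : 1 ≤ a) (hA' : Real.exp (-a) ≤ (uSphere n A).toReal) (hε0 : 0 < ε)
    (hε1 : ε ≤ 1) {q : ℕ} (hq : 0 < q) (hq2 : Even q)
    (hqd : 4096 * (8 / 3 * a * q / ε) ^ 2 ≤ q * d) :
    ∫ Q, (F Q / (uSphere n A).toReal - 1) ^ q ∂ν ≤ 2 * (4 * Real.exp 1) ^ q * ε ^ ((q : ℝ) / 2) := by
  obtain ⟨e⟩ := exists_linearIsometry hdn
  set μ := (uSphere n A).toReal with hμ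
  have hφc : Continuous fun x : ℝ => (x / μ - 1) ^ q := by fun_prop
  have hφ : ConvexOn ℝ Set.univ fun x : ℝ => (x / μ - 1) ^ q := by
    have h := (Even.convexOn_pow (𝕜 := ℝ) hq2).comp_affineMap
      (AffineMap.lineMap (k := ℝ) (-1 : ℝ) (1 / μ - 1))
    rw [Set.preimage_univ] at h
    have hcomp : (fun x : ℝ => (x / μ - 1) ^ q)
        = (fun x : ℝ => x ^ q) ∘ AffineMap.lineMap (k := ℝ) (-1 : ℝ) (1 / μ - 1) := by
      ext x
      simp only [Function.comp_apply, AffineMap.lineMap_apply, smul_eq_mul, vsub_eq_sub,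
        vadd_eq_add]
      ring
    rw [hcomp]
    exact h
  rw [integral_grass_eq hd hA hν hFm hF e hφc]
  refine (integral_sectionMeas_le_integral_signAvg hn hd hA e hφ hφc).trans ?_
  rw [hμ, ← gaussPi_coordCone hn hA] at hA' ⊢
  exact integral_signAvg_sub_one_pow_le (measurableSet_coordCone hA) ha hA' hε0 hε1 hq hqd

lemma measureReal_lt_le_integral_pow {Ω : Type*} [MeasurableSpace Ω] {ν : Measure Ω}
    [IsFiniteMeasure ν] {F : Ω → ℝ} (hFm : Measurable F) (h0 : ∀ x, 0 ≤ F x) (h1 : ∀ x, F x ≤ 1)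
    {μ : ℝ} (hμ : 0 < μ) {q : ℕ} (hq : Even q) :
    ν.real {x | F x < 0.9 * μ} ≤ 10 ^ q * ∫ x, (F x / μ - 1) ^ q ∂ν := by
  have hφc : Continuous fun x : ℝ => (x / μ - 1) ^ q := by fun_prop
  obtain ⟨K, hK⟩ := exists_bound_of_continuous hφc
  have hint : Integrable (fun x => (F x / μ - 1) ^ q) ν :=
    Integrable.of_bound (C := K) (hφc.measurable.comp hFm).aestronglyMeasurable
      (.of_forall fun x => hK _ (h0 x) (h1 x))
  have h := mul_meas_ge_le_integral_of_nonneg (.of_forall fun x => hq.pow_nonneg _) hint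
    ((10 : ℝ) ^ q)⁻¹
  rw [inv_mul_le_iff₀ (by positivity)] at h
  refine (measureReal_mono fun x hx => ?_).trans h
  have hx' : F x / μ < 0.9 := by
    rw [div_lt_iff₀ hμ]
    exact hx
  change ((10 : ℝ) ^ q)⁻¹ ≤ (F x / μ - 1) ^ q
  rw [← inv_pow, ← hq.neg_pow (F x / μ - 1)]
  refine pow_le_pow_left₀ (by norm_num) ?_ q
  norm_num at hx' ⊢
  linarith

lemma mul_measureReal_sub_le_setIntegral {Ω : Type*} [MeasurableSpace Ω] {ν : Measure Ω}
    [IsFiniteMeasure ν] {F : Ω → ℝ} (hFm : Measurable F) (h0 : ∀ x, 0 ≤ F x) (h1 : ∀ x, F x ≤ 1)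
    {B : Set Ω} (hB : MeasurableSet B) {t : ℝ} (ht : 0 ≤ t) :
    t * (ν.real B - ν.real {x | F x < t}) ≤ ∫ x in B, F x ∂ν := by
  have hint : Integrable F ν := Integrable.of_bound (C := 1) hFm.aestronglyMeasurable
    (.of_forall fun x => by
      rw [Real.norm_of_nonneg (h0 x)]
      exact h1 x)
  have hm : MeasurableSet {x | F x < t} := measurableSet_lt hFm measurable_const
  have hdiff : ν.real B - ν.real {x | F x < t} ≤ ν.real (B \ {x | F x < t}) := by
    have := measureReal_mono (μ := ν) (s₁ := B) (s₂ := (B \ {x | F x < t}) ∪ {x | F x < t})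
      (by rw [Set.sdiff_union_self]; exact Set.subset_union_left)
    linarith [measureReal_union_le (μ := ν) (B \ {x | F x < t}) {x | F x < t}]
  calc _ ≤ t * ν.real (B \ {x | F x < t}) := by gcongr
    _ = ∫ _ in B \ {x | F x < t}, t ∂ν := by simp [mul_comm]
    _ ≤ ∫ x in B \ {x | F x < t}, F x ∂ν :=
      setIntegral_mono_on (integrable_const _) hint.integrableOn (hB.diff hm) fun x hx =>
        not_lt.1 hx.2
    _ ≤ ∫ x in B, F x ∂ν :=
      setIntegral_mono_set hint.integrableOn (.of_forall h0) Set.sdiff_subset.eventuallyLE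

/-- A set of subspaces that is not too small meets a set of points that is not too small in the
expected proportion. -/
lemma mul_measure_le_setIntegral_section [IsProbabilityMeasure ν] (hn : 0 < n) (hd : 0 < d)
    (hdn : d ≤ n) (hA : MeasurableSet A)
    (hν : ∀ U ∈ Matrix.orthogonalGroup (Fin n) ℝ, ∀ T : Grass n d → Grass n d,
      Measurable T → (∀ Q : Grass n d, (T Q).1 = U * Q.1 * U.transpose) → ν.map T = ν)
    (hFm : Measurable F)
    (hF : ∀ (Q : Grass n d) (e : EuclideanSpace ℝ (Fin d) →ₗᵢ[ℝ] EuclideanSpace ℝ (Fin n)),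
      (∀ v : EuclideanSpace ℝ (Fin n), v ∈ LinearMap.range e.toLinearMap ↔ Q.1.mulVec v = v) →
      F Q = sectionMeas A e)
    {a ε : ℝ} (ha : 1 ≤ a) (hA' : Real.exp (-a) ≤ (uSphere n A).toReal)
    (hε : ε = Real.exp (-4) / 1600) (had : 2 ^ 20 / 9 * a ^ 3 / ε ^ 2 ≤ d)
    {B : Set (Grass n d)} (hB : MeasurableSet B) (hB' : 20 * Real.exp (-a) ≤ ν.real B) :
    0.8 * (uSphere n A).toReal * ν.real B ≤ ∫ Q in B, F Q ∂ν := by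
  set μ := (uSphere n A).toReal with hμ
  have hμ0 : 0 < μ := (Real.exp_pos _).trans_le hA'
  have hε0 : 0 < ε := by
    rw [hε]
    positivity
  have hε1 : ε ≤ 1 := by
    rw [hε]
    have : Real.exp (-4) ≤ 1 := Real.exp_le_one_iff.2 (by norm_num)
    linarith
  have h01 : ∀ Q, 0 ≤ F Q ∧ F Q ≤ 1 := fun Q => by
    obtain ⟨e, he⟩ := exists_isometry_range_eq Q
    rw [hF Q e he]
    exact ⟨sectionMeas_nonneg e, sectionMeas_le_one hd hA e⟩
  set k := ⌈a⌉₊ with hk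
  have hak : a ≤ k := Nat.le_ceil a
  have hk2 : (k : ℝ) ≤ 2 * a := by
    have := Nat.ceil_lt_add_one (a := a) (by linarith)
    linarith
  have hk0 : 0 < k := Nat.ceil_pos.2 (by linarith)
  have hqd : 4096 * (8 / 3 * a * (2 * k : ℕ) / ε) ^ 2 ≤ (2 * k : ℕ) * d := by
    push_cast
    calc 4096 * (8 / 3 * a * (2 * k) / ε) ^ 2
        = 2 * k * (2 ^ 19 / 9 * a ^ 2 * k / ε ^ 2) := by
          field_simp
          ring
      _ ≤ 2 * k * (2 ^ 19 / 9 * a ^ 2 * (2 * a) / ε ^ 2) := by gcongr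
      _ = 2 * k * (2 ^ 20 / 9 * a ^ 3 / ε ^ 2) := by ring
      _ ≤ _ := by gcongr
  have hmom := integral_section_sub_one_pow_le hn hd hdn hA hν hFm hF ha hA' hε0 hε1
    (q := 2 * k) (by omega) (even_two_mul k) hqd
  have hlt := measureReal_lt_le_integral_pow (ν := ν) hFm (fun Q => (h01 Q).1) (fun Q => (h01 Q).2)
    hμ0 (even_two_mul k)
  have hbad : ν.real {Q | F Q < 0.9 * μ} ≤ 0.1 * ν.real B := by
    calc _ ≤ 10 ^ (2 * k) * (2 * (4 * Real.exp 1) ^ (2 * k) * ε ^ (((2 * k : ℕ) : ℝ) / 2)) :=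
          hlt.trans (by gcongr)
      _ = 2 * (1600 * Real.exp 1 ^ 2 * ε) ^ k := by
          have : ((2 * k : ℕ) : ℝ) / 2 = k := by
            push_cast
            ring
          rw [this, Real.rpow_natCast, pow_mul, pow_mul, mul_pow, mul_pow, mul_pow, mul_pow]
          have : (1600 : ℝ) ^ k = (10 ^ 2) ^ k * (4 ^ 2) ^ k := by
            rw [← mul_pow]
            norm_num
          rw [this]
          ring
      _ = 2 * Real.exp (-(2 * k)) := by
          have : 1600 * Real.exp 1 ^ 2 * ε = Real.exp (-2) := by
            rw [hε, ← Real.exp_nat_mul]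
            calc _ = Real.exp ((2 : ℕ) * 1) * Real.exp (-4) := by ring
              _ = _ := by
                rw [← Real.exp_add]
                norm_num
          rw [this, ← Real.exp_nat_mul]
          congr 2
          ring
      _ ≤ 2 * Real.exp (-a) := by
          gcongr
          linarith
      _ ≤ 0.1 * ν.real B := by
          norm_num
          linarith
  have hfin := mul_measureReal_sub_le_setIntegral (ν := ν) hFm (fun Q => (h01 Q).1)
    (fun Q => (h01 Q).2) hB (t := 0.9 * μ) (by positivity)
  refine le_trans ?_ hfin
  calc 0.8 * μ * ν.real B ≤ 0.9 * μ * (0.9 * ν.real B) := by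
        have : 0 ≤ μ * ν.real B := by positivity
        norm_num
        linarith
    _ ≤ _ := by
        gcongr
        norm_num at hbad ⊢
        linarith

end
end GaussianBL

/-- Rectangle bound for the incidence measure: there are universal constants `c, C > 0`
such that for `1 ≤ m ≤ 9n/10`, measurable `A ⊆ S^{n-1}` and `B ⊆ 𝒢_{n,n-m}` with
`σ(A) ≥ C exp(-c n^{1/3})` and `σ_𝒢(B) ≥ C exp(-c n^{1/3})`, one has
`σ_ℐ((A × B) ∩ ℐ_{n,m}) ≥ 0.8 σ(A) σ_𝒢(B)`.  Here `σ_𝒢 = ν` is the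
rotation-invariant probability measure on the Grassmannian, the incidence measure of
`(A × B) ∩ ℐ_{n,m}` equals `∫_B σ_H(A ∩ H) dν(H)`, and `F Q = σ_H(A ∩ H)` is
characterized through any isometric parametrization `e : ℝ^{n-m} → ℝⁿ` of the
subspace `H` fixed by the projection `Q`. -/
theorem incidence_rectangle_bound :
    ∃ c : ℝ, 0 < c ∧ ∃ C : ℝ, 0 < C ∧
      ∀ (n m : ℕ), 1 ≤ m → 10 * m ≤ 9 * n →
      ∀ A : Set (sphere (0 : EuclideanSpace ℝ (Fin n)) 1), MeasurableSet A →
        C * Real.exp (-c * (n : ℝ) ^ ((1 : ℝ) / 3)) ≤ (uSphere n A).toReal →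
      ∀ ν : Measure (Grass n (n - m)), IsProbabilityMeasure ν →
        (∀ U ∈ Matrix.orthogonalGroup (Fin n) ℝ, ∀ T : Grass n (n - m) → Grass n (n - m),
          Measurable T → (∀ Q : Grass n (n - m), (T Q).1 = U * Q.1 * U.transpose) →
          ν.map T = ν) →
      ∀ B : Set (Grass n (n - m)), MeasurableSet B →
        C * Real.exp (-c * (n : ℝ) ^ ((1 : ℝ) / 3)) ≤ (ν B).toReal →
      ∀ F : Grass n (n - m) → ℝ, Measurable F →
        (∀ (Q : Grass n (n - m))
            (e : EuclideanSpace ℝ (Fin (n - m)) →ₗᵢ[ℝ] EuclideanSpace ℝ (Fin n)),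
          (∀ v : EuclideanSpace ℝ (Fin n),
            v ∈ LinearMap.range e.toLinearMap ↔ Q.1.mulVec v = v) →
          F Q = (uSphere (n - m) {ω | sphereMap e ω ∈ A}).toReal) →
      0.8 * (uSphere n A).toReal * (ν B).toReal ≤ ∫ Q in B, F Q ∂ν := by
  set ε := Real.exp (-4) / 1600 with hε
  have hε0 : 0 < ε := by positivity
  have hε1 : ε ≤ 1 := by
    have : Real.exp (-4) ≤ 1 := Real.exp_le_one_iff.2 (by norm_num)
    linarith
  refine ⟨ε ^ 2 / 2 ^ 21, by positivity, 20, by norm_num, ?_⟩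
  intro n m hm hmn A hA hA' ν _ hν B hB hB' F hFm hF
  set c := ε ^ 2 / 2 ^ 21 with hc
  have hc0 : 0 < c := by positivity
  have hc1 : c ≤ 1 := by
    rw [hc, div_le_one (by positivity)]
    nlinarith
  set a := c * (n : ℝ) ^ ((1 : ℝ) / 3) with ha
  rw [neg_mul, ← ha] at hA' hB'
  have ha1 : 1 ≤ a := by
    by_contra! h
    have h1 : Real.exp (-1) ≤ Real.exp (-a) := Real.exp_le_exp.2 (by linarith)
    have h2 : 0.36 < Real.exp (-1) := by
      have := Real.exp_neg_one_gt_d9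
      norm_num at this ⊢
      linarith
    have h3 : (ν B).toReal ≤ 1 := by
      rw [← measureReal_def]
      exact measureReal_le_one
    norm_num at h2
    linarith
  have ha3 : a ^ 3 = c ^ 3 * n := by
    rw [ha, mul_pow, ← Real.rpow_natCast ((n : ℝ) ^ ((1 : ℝ) / 3)), ← Real.rpow_mul (by positivity)]
    norm_num
  have hd : (n : ℝ) / 10 ≤ (n - m : ℕ) := by
    rw [div_le_iff₀ (by norm_num)]
    exact_mod_cast (by omega : n ≤ (n - m) * 10)
  refine GaussianBL.mul_measure_le_setIntegral_section (by omega) (by omega) (Nat.sub_le n m) hA hν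
    hFm hF ha1 ?_ hε ?_ hB hB'
  · linarith [Real.exp_pos (-a)]
  · calc 2 ^ 20 / 9 * a ^ 3 / ε ^ 2 = 2 ^ 20 / 9 * (c ^ 2 * (ε ^ 2 / 2 ^ 21)) * n / ε ^ 2 := by
          rw [ha3, ← hc]
          ring
      _ = c ^ 2 * n / 18 := by
          field_simp
          norm_num
          ring
      _ ≤ 1 * n / 10 := by
          gcongr
          · exact pow_le_one₀ hc0.le hc1
          · norm_num
      _ ≤ _ := by simpa using hd
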